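/- For all k, o ∈ ℕ∖{1}, s ∈ ℕ, all η, ν > 0, and every function ε : ℕ^{k−1} → (0,1], there are μ > 0 and t, n_0 ∈ ℕ such that the following holds. Suppose (O1) V is a set with |V| = n ≥ n_0; (O2) O = O(k−1, a^O) is an o-bounded family of partitions on V; (O3) Q = Q(k, a^Q) is a (1/a_1^Q, μ, a^Q)-equitable o-bounded family of partitions on V; and (O4) H^(k) = {H_1^(k),…,H_s^(k)} is a partition of the k-subsets of V with H^(k) ≺ Q^(k). Then there exist a family of partitions P = P(k−1, a^P) and a partition G^(k) = {G_1^(k),…,G_s^(k)} of the k-subsets of V such that for each j ∈ [k−1] and i ∈ [s]: (P1) P is a t-bounded (η, ε(a^P), a^P)-equitable family of partitions and a_j^Q divides a_j^P; (P2) P^(j) ≺ Q^(j) and P^(j) ≺_ν O^(j); (G1) G_i^(k) is perfectly ε(a^P)-regular with respect to P; (G2) Σ_{i=1}^{s} |G_i^(k) △ H_i^(k)| ≤ ν·C(n,k); (G3) G^(k) ≺ Q^(k), and if H_i^(k) ⊆ K_k(Q^(1)) then G_i^(k) ⊆ K_k(Q^(1)). -/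

import Mathlib

namespace HypReg

open Finset

attribute [local instance 10] Classical.propDecidable

noncomputable section

variable {V : Type*} [DecidableEq V]

/-- Representation of a 1-graph: the set of singletons of `U`. -/
def sing (U : Finset V) : Finset (Finset V) :=
  U.image fun v => ({v} : Finset V)

/-- `Kset W j i B`: the i-element subsets of `W` all of whose j-element subsets lie in `B`. -/
def Kset (W : Finset V) (j i : ℕ) (B : Finset (Finset V)) : Finset (Finset V) :=
  (W.powersetCard i).filter fun S => ∀ T ∈ S.powersetCard j, T ∈ B

/-- Clique operator which, at level 1, uses the ambient family `cr` of crossing i-sets. -/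
def KsetC (W : Finset V) (cr : Finset (Finset V)) (j i : ℕ) (B : Finset (Finset V)) :
    Finset (Finset V) :=
  if j = 1 then cr.filter fun S => ∀ v ∈ S, ({v} : Finset V) ∈ B
  else Kset W j i B

/-- `A` (a (j+1)-graph) is (ε,d)-regular with respect to the j-graph `B` (plain clique sets). -/
def RegPair (W : Finset V) (j : ℕ) (ε d : ℝ) (A B : Finset (Finset V)) : Prop :=
  ∀ Q ⊆ B, ε * ((Kset W j (j+1) B).card : ℝ) ≤ ((Kset W j (j+1) Q).card : ℝ) →
    |((A ∩ Kset W j (j+1) Q).card : ℝ) - d * ((Kset W j (j+1) Q).card : ℝ)|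
      ≤ ε * ((Kset W j (j+1) Q).card : ℝ)

/-- (ε,d)-regularity with crossing-aware clique sets. -/
def RegPairC (W : Finset V) (cr : Finset (Finset V)) (j : ℕ) (ε d : ℝ)
    (A B : Finset (Finset V)) : Prop :=
  ∀ Q ⊆ B, ε * ((KsetC W cr j (j+1) B).card : ℝ) ≤ ((KsetC W cr j (j+1) Q).card : ℝ) →
    |((A ∩ KsetC W cr j (j+1) Q).card : ℝ) - d * ((KsetC W cr j (j+1) Q).card : ℝ)|
      ≤ ε * ((KsetC W cr j (j+1) Q).card : ℝ)

/-- Relative density `d(A | B)` of the (j+1)-graph `A` w.r.t. the j-graph `B`. -/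
def dens (W : Finset V) (cr : Finset (Finset V)) (j : ℕ) (A B : Finset (Finset V)) : ℝ :=
  if (KsetC W cr j (j+1) B).card = 0 then 0
  else ((A ∩ KsetC W cr j (j+1) B).card : ℝ) / ((KsetC W cr j (j+1) B).card : ℝ)

/-- `H` is a k-graph on the vertex set `W`. -/
def IsKGraph (W : Finset V) (k : ℕ) (H : Finset (Finset V)) : Prop :=
  ∀ e ∈ H, e ⊆ W ∧ e.card = k

/-- symmetric difference of two hypergraphs -/
def sd (A B : Finset (Finset V)) : Finset (Finset V) := (A \ B) ∪ (B \ A)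

/-- A (candidate) family of partitions: the ground set, the class of each vertex and,
for each level `j ≥ 2`, the class of each crossing j-set. -/
structure PartFam (V : Type*) [DecidableEq V] where
  gnd : Finset V
  vClass : V → Finset V
  cls : ℕ → Finset V → Finset (Finset V)

namespace PartFam

variable (F : PartFam V)

/-- crossing i-sets -/
def cross (i : ℕ) : Finset (Finset V) :=
  (F.gnd.powersetCard i).filter fun S =>
    ∀ u ∈ S, ∀ v ∈ S, u ≠ v → F.vClass u ≠ F.vClass v

/-- the level-j polyad of a vertex set `J` -/
def polyad (j : ℕ) (J : Finset V) : Finset (Finset V) :=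
  if j = 1 then sing (J.sup F.vClass) else (J.powersetCard j).sup (F.cls j)

/-- the clique set `K_j(P̂^{(j-1)}(J))` of the (j−1)-polyad of a crossing j-set `J` -/
def polyCliques (j : ℕ) (J : Finset V) : Finset (Finset V) :=
  KsetC F.gnd (F.cross j) (j-1) j (F.polyad (j-1) J)

/-- `F` is a family of partitions `P(k−1, a)`. -/
def IsFamily (k : ℕ) (a : ℕ → ℕ) : Prop :=
  (∀ v ∈ F.gnd, v ∈ F.vClass v) ∧
  (∀ v ∈ F.gnd, F.vClass v ⊆ F.gnd) ∧
  (∀ u ∈ F.gnd, ∀ v ∈ F.gnd, u ∈ F.vClass v → F.vClass u = F.vClass v) ∧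
  (F.gnd.image F.vClass).card = a 1 ∧ k ≤ a 1 ∧
  ∀ j, 2 ≤ j → j ≤ k - 1 →
    (∀ J ∈ F.cross j, J ∈ F.cls j J) ∧
    (∀ J ∈ F.cross j, ∀ I ∈ F.cls j J, F.cls j I = F.cls j J) ∧
    (∀ J ∈ F.cross j, F.cls j J ⊆ F.polyCliques j J) ∧
    (∀ J ∈ F.cross j, F.polyCliques j J ⊆ F.cross j) ∧
    (∀ J ∈ F.cross j, ((F.polyCliques j J).image (F.cls j)).card = a j)

/-- the regularity condition in the definition of an equitable family of partitions:
all polyad complexes of crossing k-sets are (ε, (1/a_2, …, 1/a_{k−1}))-regular. -/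
def PolyadReg (k : ℕ) (a : ℕ → ℕ) (ε : ℝ) : Prop :=
  ∀ K ∈ F.cross k, ∀ j, 2 ≤ j → j ≤ k - 1 → ∀ J ∈ K.powersetCard j,
    RegPairC F.gnd (F.cross j) (j-1) ε (1 / (a j : ℝ)) (F.polyad j K) (F.polyad (j-1) J)

/-- `(η, ε, a, λ)`-equitable family of partitions -/
def IsEquitable (k : ℕ) (a : ℕ → ℕ) (η ε lam : ℝ) : Prop :=
  1 ≤ η * (a 1 : ℝ) ∧
  (∀ v ∈ F.gnd, |((F.vClass v).card : ℝ) - (F.gnd.card : ℝ) / (a 1 : ℝ)|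
      ≤ lam * (F.gnd.card : ℝ) / (a 1 : ℝ)) ∧
  F.PolyadReg k a ε

/-- `(η, ε, a)`-equitable family of partitions (classes of size ⌊n/a₁⌋ or ⌊n/a₁⌋+1) -/
def IsEquitableE (k : ℕ) (a : ℕ → ℕ) (η ε : ℝ) : Prop :=
  1 ≤ η * (a 1 : ℝ) ∧
  (∀ v ∈ F.gnd, (F.vClass v).card = F.gnd.card / a 1 ∨
      (F.vClass v).card = F.gnd.card / a 1 + 1) ∧
  F.PolyadReg k a ε

/-- `G` is perfectly ε-regular with respect to `F`. -/
def PerfectlyRegular (k : ℕ) (ε : ℝ) (G : Finset (Finset V)) : Prop :=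
  ∀ K ∈ F.cross k, ∃ d : ℝ, 0 ≤ d ∧
    RegPairC F.gnd (F.cross k) (k-1) ε d G (F.polyad (k-1) K)

end PartFam

/-- `a` is a T-bounded vector of length k−1. -/
def BoundedVec (k T : ℕ) (a : ℕ → ℕ) : Prop := ∀ j, 1 ≤ j → j ≤ k - 1 → a j ≤ T

/-- level-j refinement `F^{(j)} ≺ P^{(j)}` between two families of partitions -/
def RefinesAt (F P : PartFam V) (j : ℕ) : Prop :=
  if j = 1 then ∀ v ∈ F.gnd, F.vClass v ⊆ P.vClass v
  else ∀ I ∈ F.cross j,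
    (∃ J ∈ P.cross j, F.cls j I ⊆ P.cls j J) ∨ ∀ S ∈ F.cls j I, S ∉ P.cross j

/-- level-j approximate refinement `F^{(j)} ≺_ν P^{(j)}` -/
def RefinesApproxAt (F P : PartFam V) (j : ℕ) (ν : ℝ) : Prop :=
  if j = 1 then
    ∃ f : Finset V → Finset V,
      (∀ v ∈ F.gnd, f (F.vClass v) ∈ F.gnd.image P.vClass) ∧
      ∑ C ∈ F.gnd.image F.vClass, ((C \ f C).card : ℝ) ≤ ν * (F.gnd.card : ℝ)
  else
    ∃ f : Finset (Finset V) → Finset (Finset V),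
      (∀ I ∈ F.cross j,
        f (F.cls j I) ∈ ((P.cross j).image (P.cls j)) ∪ {F.cross j \ P.cross j}) ∧
      ∑ C ∈ (F.cross j).image (F.cls j), ((C \ f C).card : ℝ) ≤ ν * ((F.cross j).card : ℝ)

/-- The address space: a base set (of class indices) together with a labelling of its subsets. -/
abbrev Addr := Finset ℕ × (Finset ℕ → ℕ)

/-- `x` is an element of the address space `Â(l, j, a)`. -/
def IsAddress (l j : ℕ) (a : ℕ → ℕ) (x : Addr) : Prop :=
  x.1.card = l ∧ (∀ i ∈ x.1, 1 ≤ i ∧ i ≤ a 1) ∧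
  (∀ L : Finset ℕ, L ⊆ x.1 → 2 ≤ L.card → L.card ≤ j → 1 ≤ x.2 L ∧ x.2 L ≤ a L.card) ∧
  (∀ L : Finset ℕ, ¬(L ⊆ x.1 ∧ 2 ≤ L.card ∧ L.card ≤ j) → x.2 L = 0)

/-- restriction `ŷ ≤ x̂` of an address to the base `B`, keeping levels up to `j`. -/
def restrictA (x : Addr) (j : ℕ) (B : Finset ℕ) : Addr :=
  (B, fun L => if L ⊆ B ∧ 2 ≤ L.card ∧ L.card ≤ j then x.2 L else 0)

/-- `d` is a density function of `Â(k, k−1, a)`. -/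
def DensityFun (k : ℕ) (a : ℕ → ℕ) (d : Addr → ℝ) : Prop :=
  ∀ x : Addr, IsAddress k (k-1) a x → 0 ≤ d x ∧ d x ≤ 1

/-- A family of partitions together with an `a`-labelling. -/
structure LabFam (V : Type*) [DecidableEq V] extends PartFam V where
  vIdx : V → ℕ
  lbl : ℕ → Finset V → ℕ

namespace LabFam

variable (F : LabFam V)

/-- `F` is a family of partitions with a legitimate `a`-labelling. -/
def IsLabeled (k : ℕ) (a : ℕ → ℕ) : Prop :=
  F.toPartFam.IsFamily k a ∧
  (∀ v ∈ F.gnd, 1 ≤ F.vIdx v ∧ F.vIdx v ≤ a 1) ∧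
  (∀ u ∈ F.gnd, ∀ v ∈ F.gnd, (F.vIdx u = F.vIdx v ↔ F.vClass u = F.vClass v)) ∧
  ∀ j, 2 ≤ j → j ≤ k - 1 →
    (∀ I ∈ F.toPartFam.cross j, 1 ≤ F.lbl j I ∧ F.lbl j I ≤ a j) ∧
    (∀ I ∈ F.toPartFam.cross j, ∀ I' ∈ F.cls j I, F.lbl j I' = F.lbl j I) ∧
    (∀ I ∈ F.toPartFam.cross j, ∀ I' ∈ F.toPartFam.cross j,
      F.toPartFam.polyad (j-1) I = F.toPartFam.polyad (j-1) I' →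
      F.lbl j I = F.lbl j I' → F.cls j I = F.cls j I')

/-- the address `x̂(L)` (up to level j) of a crossing set `L` -/
def addrOf (j : ℕ) (L : Finset V) : Addr :=
  (L.image F.vIdx,
   fun M => if M ⊆ L.image F.vIdx ∧ 2 ≤ M.card ∧ M.card ≤ j
     then F.lbl M.card (L.filter fun v => F.vIdx v ∈ M) else 0)

/-- the part `P^{(j)}(x̂, b)` -/
def partAt (j : ℕ) (x : Addr) (b : ℕ) : Finset (Finset V) :=
  if j ≤ 1 then (if x.1 = {b} then sing (F.gnd.filter fun v => F.vIdx v = b) else ∅)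
  else (F.toPartFam.cross j).filter fun I => F.addrOf (j-1) I = x ∧ F.lbl j I = b

/-- the polyad `P̂^{(j)}(x̂)` -/
def polyAt (j : ℕ) (x : Addr) : Finset (Finset V) :=
  if j = 1 then sing (F.gnd.filter fun v => F.vIdx v ∈ x.1)
  else (x.1.powersetCard j).sup fun B => F.partAt j (restrictA x (j-1) B) (x.2 B)

/-- `F` is an `(ε, d)`-partition of `H`. -/
def IsDensPartition (k : ℕ) (a : ℕ → ℕ) (ε : ℝ) (d : Addr → ℝ)
    (H : Finset (Finset V)) : Prop :=
  ∀ x : Addr, IsAddress k (k-1) a x →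
    RegPairC F.gnd (F.toPartFam.cross k) (k-1) ε (d x) H (F.polyAt (k-1) x)

/-- `F` is an `(ε, a, d)`-equitable partition of `H`. -/
def IsEquitPartition (k : ℕ) (a : ℕ → ℕ) (ε : ℝ) (d : Addr → ℝ)
    (H : Finset (Finset V)) : Prop :=
  F.IsLabeled k a ∧ F.toPartFam.IsEquitableE k a (1 / (a 1 : ℝ)) ε ∧
  F.IsDensPartition k a ε d H

end LabFam

/-- An ℓ-partite complex: vertex classes and, for each level, a partite graph. -/
structure Cx (V : Type*) [DecidableEq V] (l : ℕ) where
  C : Fin l → Finset V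
  G : ℕ → Finset (Finset V)

namespace Cx

variable {l : ℕ} (X : Cx V l)

def gnd : Finset V := Finset.univ.sup X.C

/-- crossing i-sets with respect to the classes of `X` -/
def cross (i : ℕ) : Finset (Finset V) :=
  (X.gnd.powersetCard i).filter fun S => ∀ t : Fin l, (S ∩ X.C t).card ≤ 1

/-- restriction of the level-j graph to the classes indexed by `L` -/
def restr (j : ℕ) (L : Finset (Fin l)) : Finset (Finset V) :=
  if j = 1 then sing (L.sup X.C) else (X.G j).filter fun e => e ⊆ L.sup X.C

/-- `X` is a complex with levels up to `k`. -/
def IsComplex (k : ℕ) : Prop :=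
  (∀ s t : Fin l, s ≠ t → Disjoint (X.C s) (X.C t)) ∧
  (∀ j, 2 ≤ j → j ≤ k → X.G j ⊆ X.cross j) ∧
  (∀ j, 3 ≤ j → j ≤ k → X.G j ⊆ Kset X.gnd (j-1) j (X.G (j-1)))

/-- `X` is an (ε, (d_2, …, d_k))-regular complex. -/
def IsRegular (k : ℕ) (ε : ℝ) (d : ℕ → ℝ) : Prop :=
  ∀ j, 2 ≤ j → j ≤ k → ∀ L ∈ (Finset.univ : Finset (Fin l)).powersetCard j,
    RegPairC X.gnd (X.cross j) (j-1) ε (d j) (X.G j) (X.restr (j-1) L)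

/-- The restricted complex `X[L]` is (ε, (d_2, …, d_{k−1}, p))-regular. -/
def RestrRegular (k : ℕ) (ε : ℝ) (d : ℕ → ℝ) (L : Finset (Fin l)) (p : ℝ) : Prop :=
  ∀ j, 2 ≤ j → j ≤ k → ∀ L' ∈ L.powersetCard j,
    RegPairC X.gnd (X.cross j) (j-1) ε (if j = k then p else d j)
      (X.restr j L) (X.restr (j-1) L')

/-- clique set `K_i` of the level-j graph of the complex (level 1: crossing sets). -/
def KsetLvl (j i : ℕ) : Finset (Finset V) :=
  if j ≤ 1 then X.cross i else Kset X.gnd j i (X.G j)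

end Cx

/-- `eCL`, `mCL` satisfy the counting lemma of Kohayakawa–Rödl–Skokan. -/
def CountingProp (eCL : ℝ → ℝ → ℕ → ℕ → ℝ) (mCL : ℝ → ℝ → ℕ → ℕ → ℕ) : Prop :=
  ∀ γ d₀ : ℝ, 0 < γ → 0 < d₀ → ∀ k l : ℕ, 2 ≤ k → k ≤ l →
    (0 < eCL γ d₀ k l ∧ eCL γ d₀ k l ≤ 1) ∧
    ∀ (V₀ : Type) [DecidableEq V₀], ∀ (X : Cx V₀ l) (m : ℕ) (lam ε : ℝ) (d : ℕ → ℝ),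
      0 ≤ lam → lam < 1/4 → 0 < ε → ε ≤ eCL γ d₀ k l → mCL γ d₀ k l ≤ m →
      (∀ j, 2 ≤ j → j ≤ k → d₀ ≤ d j) →
      X.IsComplex k →
      (∀ i, |((X.C i).card : ℝ) - (m : ℝ)| ≤ lam * m) →
      X.IsRegular k ε d →
      |((Kset X.gnd k l (X.G k)).card : ℝ) -
        (∏ j ∈ Finset.Icc 2 k, d j ^ (l.choose j)) * ∏ i, ((X.C i).card : ℝ)|
        ≤ γ * ((∏ j ∈ Finset.Icc 2 k, d j ^ (l.choose j)) * ∏ i, ((X.C i).card : ℝ))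

/-- `eRI` is a legitimate function for defining regularity instances. -/
def GoodERI (eRI : ℕ → ℕ → ℝ) : Prop :=
  (∀ t k : ℕ, 1 ≤ t → 2 ≤ k → 0 < eRI t k ∧ eRI t k ≤ 1) ∧
  (∀ k t t' : ℕ, 1 ≤ t → t ≤ t' → eRI t' k ≤ eRI t k) ∧
  (∀ t k k' : ℕ, 2 ≤ k → k ≤ k' → eRI t k' ≤ eRI t k) ∧
  (∀ k : ℕ, Filter.Tendsto (fun t => eRI t k) Filter.atTop (nhds 0)) ∧
  ∃ (eCL : ℝ → ℝ → ℕ → ℕ → ℝ) (mCL : ℝ → ℝ → ℕ → ℕ → ℕ),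
    CountingProp eCL mCL ∧
    ∀ t k : ℕ, 1 ≤ t → 2 ≤ k →
      eRI t k < eCL (1/(t:ℝ)) (1/(t:ℝ)) (k-1) k / (4 * (t:ℝ) ^ (4^k))

/-- `max_i a_i` over `i ∈ [k−1]` -/
def maxA (k : ℕ) (a : ℕ → ℕ) : ℕ := (Finset.Icc 1 (k-1)).sup a

/-- `(ε, a, d)` is a regularity instance. -/
def RegInstance (eRI : ℕ → ℕ → ℝ) (k : ℕ) (ε : ℝ) (a : ℕ → ℕ) (d : Addr → ℝ) : Prop :=
  2 ≤ k ∧ (∀ j, 1 ≤ j → j ≤ k - 1 → 1 ≤ a j) ∧ 0 < ε ∧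
  ε ≤ eRI (maxA k a) k ∧ DensityFun k a d

section Counting

variable {W : Type} [Fintype W] [DecidableEq W]

/-- `S` spans an induced copy of `Fg` in `H` (both k-graphs). -/
def InducedCopy (Fg : Finset (Finset W)) (H : Finset (Finset V)) (k : ℕ) (S : Finset V) :
    Prop :=
  ∃ e : W → V, Function.Injective e ∧ Finset.univ.image e = S ∧
    ∀ A : Finset W, A.card = k → (A.image e ∈ H ↔ A ∈ Fg)

/-- the size of the automorphism group of `Fg` -/
def AutCount (Fg : Finset (Finset W)) : ℕ :=
  Nat.card {π : W ≃ W // ∀ A : Finset W, A.image π ∈ Fg ↔ A ∈ Fg}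

/-- the number `IC_σ(F, H)` of σ-induced copies of `Fg` in the complex `X` -/
def ICosig {l : ℕ} (X : Cx V l) (k : ℕ) (Fg : Finset (Finset W)) (σ : W ≃ Fin l) : ℕ :=
  Set.ncard {e : W → V |
    (∀ v, e v ∈ X.C (σ v)) ∧
    Finset.univ.image e ∈ X.KsetLvl (k-1) l ∧
    ∀ A : Finset W, A.card = k → (A.image e ∈ X.G k ↔ A ∈ Fg)}

/-- `IC(F, d, x̂, σ)` -/
def ICs (Fg : Finset (Finset W)) (k l : ℕ) (a : ℕ → ℕ) (d : Addr → ℝ)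
    (x : Addr) (σ : W → ℕ) : ℝ :=
  (∏ B ∈ x.1.powersetCard k,
    if ∃ A ∈ Fg, A.image σ = B then d (restrictA x (k-1) B)
    else 1 - d (restrictA x (k-1) B)) *
  ∏ j ∈ Finset.Icc 2 (k-1), ((a j : ℝ) ^ (l.choose j))⁻¹

/-- `IC(F, d, x̂)` -/
def ICa (Fg : Finset (Finset W)) (k l : ℕ) (a : ℕ → ℕ) (d : Addr → ℝ) (x : Addr) : ℝ :=
  (AutCount Fg : ℝ)⁻¹ *
    ∑ᶠ σ ∈ {σ : W → ℕ | Set.BijOn σ Set.univ ↑x.1}, ICs Fg k l a d x σ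

/-- `IC(F, d)` -/
def IC (Fg : Finset (Finset W)) (k l : ℕ) (a : ℕ → ℕ) (d : Addr → ℝ) : ℝ :=
  (((a 1).choose l : ℝ))⁻¹ * ∑ᶠ x ∈ {x : Addr | IsAddress l (k-1) a x}, ICa Fg k l a d x

end Counting

end

end HypReg

namespace HypReg
section Averages
open Finset
attribute [local instance 10] Classical.propDecidable

variable {α : Type*}

/-- The part of `X` related to `x`. -/
noncomputable def cellOf (X : Finset α) (r : α → α → Prop) (x : α) : Finset α :=
  X.filter fun y => r x y

/-- The average of `f` over the cell of `x`. -/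
noncomputable def avg (X : Finset α) (r : α → α → Prop) (f : α → ℝ) (x : α) : ℝ :=
  (∑ y ∈ cellOf X r x, f y) / ((cellOf X r x).card : ℝ)

/-- The energy (squared `L²`-norm) of the average of `f`. -/
noncomputable def en (X : Finset α) (r : α → α → Prop) (f : α → ℝ) : ℝ :=
  ∑ x ∈ X, avg X r f x ^ 2

variable {X : Finset α} {r r' : α → α → Prop} {f : α → ℝ}

lemma cellOf_congr (hr : Equivalence r) {x y : α} (h : r x y) : cellOf X r x = cellOf X r y := by
  ext z
  simp only [cellOf, mem_filter, and_congr_right_iff]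
  exact fun _ => ⟨fun hz => hr.trans (hr.symm h) hz, fun hz => hr.trans h hz⟩

lemma avg_congr (hr : Equivalence r) {x y : α} (h : r x y) : avg X r f x = avg X r f y := by
  rw [avg, avg, cellOf_congr hr h]

lemma avg_nonneg (hf : ∀ x ∈ X, 0 ≤ f x) (x : α) : 0 ≤ avg X r f x :=
  div_nonneg (sum_nonneg fun y hy => hf y (mem_filter.1 hy).1) (Nat.cast_nonneg _)

lemma avg_le_one (hf : ∀ x ∈ X, f x ≤ 1) (x : α) : avg X r f x ≤ 1 := by
  refine div_le_one_of_le₀ ?_ (Nat.cast_nonneg _)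
  calc _ ≤ ∑ y ∈ cellOf X r x, (1 : ℝ) := sum_le_sum fun y hy => hf y (mem_filter.1 hy).1
    _ = _ := by simp

lemma avg_sum {ι : Type*} (s : Finset ι) (F : ι → α → ℝ) (x : α) :
    ∑ i ∈ s, avg X r (F i) x = avg X r (fun y => ∑ i ∈ s, F i y) x := by
  simp only [avg, ← sum_div]
  rw [sum_comm]

lemma avg_const_one (hr : Equivalence r) {x : α} (hx : x ∈ X) : avg X r (fun _ => 1) x = 1 := by
  have : 0 < (cellOf X r x).card := card_pos.2 ⟨x, mem_filter.2 ⟨hx, hr.refl x⟩⟩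
  simp only [avg, sum_const, nsmul_eq_mul, mul_one]
  exact div_self (by positivity)

lemma sum_mul_avg (hr : Equivalence r) {σ : α → ℝ}
    (hσ : ∀ x ∈ X, ∀ y ∈ X, r x y → σ x = σ y) :
    ∑ x ∈ X, σ x * avg X r f x = ∑ x ∈ X, σ x * f x := by
  have h1 : ∀ x ∈ X, σ x * avg X r f x =
      ∑ y ∈ X, if r x y then σ x * f y / ((cellOf X r x).card : ℝ) else 0 := by
    intro x _
    rw [avg, cellOf, ← sum_filter, ← mul_div_assoc, mul_sum, sum_div]
  rw [sum_congr rfl h1, sum_comm]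
  refine sum_congr rfl fun y hy => ?_
  have h2 : ∀ x ∈ X, (if r x y then σ x * f y / ((cellOf X r x).card : ℝ) else 0) =
      if r y x then σ y * f y / ((cellOf X r y).card : ℝ) else 0 := by
    intro x hx
    by_cases h : r x y
    · rw [if_pos h, if_pos (hr.symm h), hσ x hx y hy h, cellOf_congr hr h]
    · rw [if_neg h, if_neg fun h' => h (hr.symm h')]
  rw [sum_congr rfl h2, ← sum_filter, sum_const, nsmul_eq_mul]
  have : (cellOf X r y).card ≠ 0 :=
    (card_pos.2 ⟨y, mem_filter.2 ⟨hy, hr.refl y⟩⟩).ne'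
  have h3 : ((cellOf X r y).card : ℝ) ≠ 0 := by exact_mod_cast this
  change ((cellOf X r y).card : ℝ) * _ = _
  field_simp

lemma en_eq (hr : Equivalence r) : en X r f = ∑ x ∈ X, avg X r f x * f x := by
  rw [← sum_mul_avg hr fun x _ y _ h => avg_congr hr h]
  exact sum_congr rfl fun x _ => sq _

lemma en_le_card (hf0 : ∀ x ∈ X, 0 ≤ f x) (hf : ∀ x ∈ X, f x ≤ 1) : en X r f ≤ X.card := by
  calc en X r f ≤ ∑ x ∈ X, (1 : ℝ) := sum_le_sum fun x _ =>
        pow_le_one₀ (avg_nonneg hf0 x) (avg_le_one hf x)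
    _ = _ := by simp

lemma sum_sq_avg_sub (hr : Equivalence r) (hr' : Equivalence r')
    (h : ∀ x ∈ X, ∀ y ∈ X, r' x y → r x y) :
    ∑ x ∈ X, (avg X r' f x - avg X r f x) ^ 2 = en X r' f - en X r f := by
  have h1 : ∑ x ∈ X, avg X r f x * avg X r' f x = en X r f := by
    rw [en_eq hr, sum_mul_avg hr' fun x hx y hy hxy => avg_congr hr (h x hx y hy hxy)]
  have h2 : ∑ x ∈ X, (avg X r' f x - avg X r f x) ^ 2 =
      en X r' f - 2 * ∑ x ∈ X, avg X r f x * avg X r' f x + en X r f := by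
    rw [en, en, mul_sum, ← sum_sub_distrib, ← sum_add_distrib]
    exact sum_congr rfl fun x _ => by ring
  rw [h2, h1]; ring

lemma en_mono (hr : Equivalence r) (hr' : Equivalence r')
    (h : ∀ x ∈ X, ∀ y ∈ X, r' x y → r x y) : en X r f ≤ en X r' f := by
  have := sum_sq_avg_sub (f := f) hr hr' h
  have h2 : 0 ≤ ∑ x ∈ X, (avg X r' f x - avg X r f x) ^ 2 := sum_nonneg fun x _ => sq_nonneg _
  linarith

/-- A test distinguishing `f` from its average increases the energy. -/
lemma sq_sum_test_le (hr : Equivalence r) (hr' : Equivalence r')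
    (h : ∀ x ∈ X, ∀ y ∈ X, r' x y → r x y) {t : α → ℝ}
    (ht : ∀ x ∈ X, ∀ y ∈ X, r' x y → t x = t y) (ht1 : ∀ x ∈ X, |t x| ≤ 1) :
    (∑ x ∈ X, t x * (f x - avg X r f x)) ^ 2 ≤ X.card * (en X r' f - en X r f) := by
  have h1 : ∑ x ∈ X, t x * (f x - avg X r f x) =
      ∑ x ∈ X, t x * (avg X r' f x - avg X r f x) := by
    simp only [mul_sub, sum_sub_distrib]
    rw [sum_mul_avg hr' ht]
  rw [h1, ← sum_sq_avg_sub hr hr' h]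
  refine (sum_mul_sq_le_sq_mul_sq X _ _).trans ?_
  refine mul_le_mul_of_nonneg_right ?_ (sum_nonneg fun x _ => sq_nonneg _)
  calc _ ≤ ∑ x ∈ X, (1 : ℝ) := sum_le_sum fun x hx => (sq_le_one_iff_abs_le_one _).2 (ht1 x hx)
    _ = _ := by simp

/-- The energy cannot drop much when passing to an almost-refinement. -/
lemma en_le_add_bad (hr : Equivalence r) (hr' : Equivalence r')
    (hf0 : ∀ x ∈ X, 0 ≤ f x) (hf : ∀ x ∈ X, f x ≤ 1) {B : Finset α} (hB : B ⊆ X)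
    (h : ∀ x ∈ X \ B, ∀ y ∈ X \ B, r' x y → r x y) :
    en X r f ≤ en X r' f + B.card := by
  let g : α → ℝ := fun x => if hx : ∃ y ∈ X \ B, r' x y then avg X r f hx.choose else 0
  have hg0 : ∀ x, 0 ≤ g x := by
    intro x; by_cases hx : ∃ y ∈ X \ B, r' x y
    · simp only [g, dif_pos hx]; exact avg_nonneg hf0 _
    · simp only [g, dif_neg hx]; exact le_rfl
  have hg1 : ∀ x, g x ≤ 1 := by
    intro x; by_cases hx : ∃ y ∈ X \ B, r' x y
    · simp only [g, dif_pos hx]; exact avg_le_one hf _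
    · simp only [g, dif_neg hx]; exact zero_le_one
  have hgood : ∀ x ∈ X \ B, g x = avg X r f x := by
    intro x hx
    have hx' : ∃ y ∈ X \ B, r' x y := ⟨x, hx, hr'.refl x⟩
    simp only [g, dif_pos hx']
    exact (avg_congr hr (h x hx _ hx'.choose_spec.1 hx'.choose_spec.2)).symm
  have hinv : ∀ x ∈ X, ∀ y ∈ X, r' x y → g x = g y := by
    intro x _ y _ hxy
    have heq : ∀ u v, r' u v → ∀ hu : ∃ w ∈ X \ B, r' u w, g u = g v := by
      intro u v huv hu
      have hv : ∃ w ∈ X \ B, r' v w :=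
        ⟨hu.choose, hu.choose_spec.1, hr'.trans (hr'.symm huv) hu.choose_spec.2⟩
      simp only [g, dif_pos hu, dif_pos hv]
      refine avg_congr hr (h _ hu.choose_spec.1 _ hv.choose_spec.1 ?_)
      exact hr'.trans (hr'.symm hu.choose_spec.2) (hr'.trans huv hv.choose_spec.2)
    by_cases hx : ∃ w ∈ X \ B, r' x w
    · exact heq x y hxy hx
    · by_cases hy : ∃ w ∈ X \ B, r' y w
      · exact (heq y x (hr'.symm hxy) hy).symm
      · simp only [g, dif_neg hx, dif_neg hy]
  have h1 : ∑ x ∈ X, (2 * (g x * f x) - g x ^ 2) ≤ en X r' f := by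
    have h3 := sum_mul_avg (X := X) (f := f) hr' hinv
    have h2 : ∑ x ∈ X, (2 * (g x * f x) - g x ^ 2) =
        ∑ x ∈ X, (2 * (g x * avg X r' f x) - g x ^ 2) := by
      rw [sum_sub_distrib, sum_sub_distrib, ← mul_sum, ← mul_sum, h3]
    rw [h2, en]
    exact sum_le_sum fun x _ => by nlinarith [sq_nonneg (g x - avg X r' f x)]
  have h2 : en X r f = ∑ x ∈ X, (2 * (avg X r f x * f x) - avg X r f x ^ 2) := by
    rw [sum_sub_distrib, ← mul_sum, ← en_eq hr, ← en]; ring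
  have h4 : ∑ x ∈ X, (2 * (avg X r f x * f x) - avg X r f x ^ 2) ≤
      ∑ x ∈ X, ((2 * (g x * f x) - g x ^ 2) + if x ∈ B then 1 else 0) := by
    refine sum_le_sum fun x hx => ?_
    by_cases hxB : x ∈ B
    · rw [if_pos hxB]
      nlinarith [sq_nonneg (avg X r f x - f x), sq_nonneg (g x - f x), hf0 x hx, hf x hx,
        hg0 x, hg1 x, avg_nonneg (r := r) hf0 x, avg_le_one (r := r) hf x]
    · rw [if_neg hxB, hgood x (mem_sdiff.2 ⟨hx, hxB⟩)]; simp
  rw [sum_add_distrib, ← sum_filter, filter_mem_eq_inter, inter_eq_right.2 hB] at h4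
  simp only [sum_const, nsmul_eq_mul, mul_one] at h4
  linarith

end Averages
end HypReg

namespace HypReg
section Random
open Finset

variable {α : Type*}

/-- Method of conditional expectations for a nonnegative combination of products. -/
lemma exists_choice_sum_prod_le {ι : Type*} (I : Finset ι) (b : ℕ) (w : α → ℕ → ℝ)
    (u : ι → α → ℕ → ℝ) (hu : ∀ i x c, 0 ≤ u i x c) {K : ℝ} (hK : 0 ≤ K) (X : Finset α)
    (hw0 : ∀ x ∈ X, ∀ c < b, 0 ≤ w x c) (hw1 : ∀ x ∈ X, ∑ c ∈ range b, w x c = 1)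
    (hE : ∀ i ∈ I, ∀ x ∈ X, ∑ c ∈ range b, w x c * u i x c ≤ K)
    (a : ι → ℝ) (ha : ∀ i, 0 ≤ a i) :
    ∃ φ : α → ℕ, (∀ x ∈ X, φ x < b ∧ 0 < w x (φ x)) ∧
      ∑ i ∈ I, a i * ∏ x ∈ X, u i x (φ x) ≤ (∑ i ∈ I, a i) * K ^ X.card := by
  classical
  induction X using Finset.induction_on generalizing a with
  | empty => exact ⟨fun _ => 0, by simp, by simp⟩
  | insert x X hx ih =>
    have h1 : ∃ c < b, 0 < w x c ∧ ∑ i ∈ I, a i * u i x c ≤ (∑ i ∈ I, a i) * K := by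
      by_contra! hcon
      have hs := hw1 x (mem_insert_self _ _)
      have hpos : ∃ c ∈ range b, 0 < w x c := by
        by_contra! h
        have := sum_nonpos h
        linarith
      obtain ⟨c0, hc0, hc0p⟩ := hpos
      have h2 : ∑ c ∈ range b, w x c * ((∑ i ∈ I, a i) * K) <
          ∑ c ∈ range b, w x c * ∑ i ∈ I, a i * u i x c := by
        refine sum_lt_sum (fun c hc => ?_) ⟨c0, hc0, ?_⟩
        · rcases (hw0 x (mem_insert_self _ _) c (mem_range.1 hc)).eq_or_lt with h | h
          · rw [← h]; simp
          · exact mul_le_mul_of_nonneg_left (hcon c (mem_range.1 hc) h).le h.le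
        · exact mul_lt_mul_of_pos_left (hcon c0 (mem_range.1 hc0) hc0p) hc0p
      rw [← sum_mul, hs, one_mul] at h2
      have h3 : ∑ c ∈ range b, w x c * ∑ i ∈ I, a i * u i x c =
          ∑ i ∈ I, a i * ∑ c ∈ range b, w x c * u i x c := by
        simp only [mul_sum]
        rw [sum_comm]
        exact sum_congr rfl fun i _ => sum_congr rfl fun c _ => by ring
      have h4 : ∑ i ∈ I, a i * ∑ c ∈ range b, w x c * u i x c ≤ ∑ i ∈ I, a i * K :=
        sum_le_sum fun i hi =>
          mul_le_mul_of_nonneg_left (hE i hi x (mem_insert_self _ _)) (ha i)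
      rw [← sum_mul] at h4
      linarith
    obtain ⟨c, hcb, hcw, hc⟩ := h1
    obtain ⟨φ, hφ, hφs⟩ := ih (fun y hy => hw0 y (mem_insert_of_mem hy))
      (fun y hy => hw1 y (mem_insert_of_mem hy))
      (fun i hi y hy => hE i hi y (mem_insert_of_mem hy))
      (fun i => a i * u i x c) (fun i => mul_nonneg (ha i) (hu i x c))
    have hne : ∀ y ∈ X, y ≠ x := fun y hy h => hx (h ▸ hy)
    refine ⟨Function.update φ x c, ?_, ?_⟩
    · intro y hy
      rcases mem_insert.1 hy with rfl | hy
      · simpa using ⟨hcb, hcw⟩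
      · rw [Function.update_of_ne (hne y hy)]; exact hφ y hy
    · have h5 : ∀ i ∈ I, a i * ∏ y ∈ insert x X, u i y (Function.update φ x c y) =
          a i * u i x c * ∏ y ∈ X, u i y (φ y) := by
        intro i _
        rw [prod_insert hx, Function.update_self, mul_assoc]
        congr 2
        exact prod_congr rfl fun y hy => by rw [Function.update_of_ne (hne y hy)]
      rw [sum_congr rfl h5, card_insert_of_notMem hx, pow_succ']
      refine hφs.trans ?_
      rw [← mul_assoc]
      exact mul_le_mul_of_nonneg_right hc (pow_nonneg hK _)

lemma sum_mul_exp_le (b : ℕ) (w t : ℕ → ℝ) (hw0 : ∀ c < b, 0 ≤ w c)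
    (hw1 : ∑ c ∈ range b, w c = 1) (ht : ∀ c < b, |t c| ≤ 1) {l : ℝ} (hl : |l| ≤ 1 / 2) :
    ∑ c ∈ range b, w c * Real.exp (l * (t c - ∑ c' ∈ range b, w c' * t c')) ≤
      Real.exp (4 * l ^ 2) := by
  set m := ∑ c' ∈ range b, w c' * t c' with hm
  have hm1 : |m| ≤ 1 := by
    refine (abs_sum_le_sum_abs _ _).trans ?_
    rw [← hw1]
    refine sum_le_sum fun c hc => ?_
    rw [abs_mul, abs_of_nonneg (hw0 c (mem_range.1 hc))]
    exact mul_le_of_le_one_right (hw0 c (mem_range.1 hc)) (ht c (mem_range.1 hc))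
  have hd : ∀ c < b, |t c - m| ≤ 2 := fun c hc => by
    have := abs_sub (t c) m; linarith [ht c hc]
  have h1 : ∀ c ∈ range b, w c * Real.exp (l * (t c - m)) ≤
      w c * (1 + 4 * l ^ 2) + l * (w c * t c - w c * m) := by
    intro c hc
    have hc := mem_range.1 hc
    have hy : |l * (t c - m)| ≤ 1 := by
      rw [abs_mul]; nlinarith [hd c hc, abs_nonneg l, abs_nonneg (t c - m)]
    have h2 := (abs_le.1 (Real.abs_exp_sub_one_sub_id_le hy)).2
    have h3 : (l * (t c - m)) ^ 2 ≤ 4 * l ^ 2 := by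
      rw [mul_pow, mul_comm]
      refine mul_le_mul_of_nonneg_right ?_ (sq_nonneg l)
      have := sq_le_sq' (by linarith [abs_nonneg (t c - m)]) (hd c hc)
      rw [sq_abs] at this; linarith
    have h4 : Real.exp (l * (t c - m)) ≤ 1 + 4 * l ^ 2 + l * (t c - m) := by linarith
    have := mul_le_mul_of_nonneg_left h4 (hw0 c hc)
    linarith
  refine (sum_le_sum h1).trans ?_
  rw [sum_add_distrib, ← sum_mul, ← mul_sum, sum_sub_distrib, ← sum_mul, hw1, ← hm]
  have := Real.add_one_le_exp (4 * l ^ 2)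
  linarith

/-- Independent random choices satisfy few bounded linear tests simultaneously. -/
lemma exists_random_choice {T : Type*} (𝒯 : Finset T) (b : ℕ) (X : Finset α) (w : α → ℕ → ℝ)
    (t : T → α → ℕ → ℝ) {M δ : ℝ} (hM : (X.card : ℝ) ≤ M) (hδ : 0 < δ) (hδ1 : δ ≤ 1)
    (hw0 : ∀ x ∈ X, ∀ c < b, 0 ≤ w x c) (hw1 : ∀ x ∈ X, ∑ c ∈ range b, w x c = 1)
    (ht : ∀ τ ∈ 𝒯, ∀ x ∈ X, ∀ c < b, |t τ x c| ≤ 1)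
    (hsize : 2 * (𝒯.card : ℝ) * Real.exp (-(δ ^ 2 * M / 16)) < 1) :
    ∃ φ : α → ℕ, (∀ x ∈ X, φ x < b ∧ 0 < w x (φ x)) ∧
      ∀ τ ∈ 𝒯, |∑ x ∈ X, (t τ x (φ x) - ∑ c ∈ range b, w x c * t τ x c)| ≤ δ * M := by
  classical
  let sg : Bool → ℝ := fun z => if z then δ / 8 else -(δ / 8)
  have hsg : ∀ z, sg z ^ 2 = δ ^ 2 / 64 := by intro z; cases z <;> simp [sg] <;> ring
  have hsg1 : ∀ z, |sg z| ≤ 1 / 2 := by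
    intro z; rw [abs_le]; cases z <;> simp [sg] <;> constructor <;> linarith
  obtain ⟨φ, hφ, hs⟩ := exists_choice_sum_prod_le (𝒯 ×ˢ (univ : Finset Bool)) b w
    (fun i x c => Real.exp (sg i.2 * (t i.1 x c - ∑ c' ∈ range b, w x c' * t i.1 x c')))
    (fun _ _ _ => (Real.exp_pos _).le) (Real.exp_pos (4 * (δ ^ 2 / 64))).le X hw0 hw1
    (fun i hi x hx => by
      rw [← hsg i.2]
      exact sum_mul_exp_le b (w x) (t i.1 x) (hw0 x hx) (hw1 x hx)
        (ht i.1 (mem_product.1 hi).1 x hx) (hsg1 i.2))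
    (fun _ => 1) (fun _ => zero_le_one)
  refine ⟨φ, hφ, fun τ hτ => ?_⟩
  by_contra! hcon
  have hM0 : 0 ≤ M := (Nat.cast_nonneg _).trans hM
  set D := ∑ x ∈ X, (t τ x (φ x) - ∑ c ∈ range b, w x c * t τ x c) with hD
  simp only [one_mul, ← Real.exp_sum, ← mul_sum] at hs
  have hz : ∃ z, δ / 8 * (δ * M) ≤ sg z * D := by
    rcases le_abs.1 hcon.le with h | h
    · exact ⟨true, by simp only [sg, if_true]; exact mul_le_mul_of_nonneg_left h (by linarith)⟩
    · refine ⟨false, ?_⟩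
      have := mul_le_mul_of_nonneg_left h (by linarith : 0 ≤ δ / 8)
      simp only [sg, Bool.false_eq_true, if_false]
      linarith
  obtain ⟨z, hz⟩ := hz
  have h1 := single_le_sum (f := fun i : T × Bool => Real.exp (sg i.2 *
      ∑ x ∈ X, (t i.1 x (φ x) - ∑ c' ∈ range b, w x c' * t i.1 x c')))
    (fun i _ => (Real.exp_pos _).le)
    (mem_product.2 ⟨hτ, mem_univ z⟩ : (τ, z) ∈ 𝒯 ×ˢ (univ : Finset Bool))
  have h2 : Real.exp (δ / 8 * (δ * M)) ≤ 2 * 𝒯.card * Real.exp (δ ^ 2 * M / 16) := by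
    refine (Real.exp_le_exp.2 hz).trans (h1.trans (hs.trans ?_))
    rw [← Real.exp_nat_mul]
    simp only [sum_const, card_product, card_univ, Fintype.card_bool, nsmul_eq_mul, mul_one]
    push_cast
    rw [mul_comm (𝒯.card : ℝ) 2]
    refine mul_le_mul_of_nonneg_left (Real.exp_le_exp.2 ?_) (by positivity)
    nlinarith [sq_nonneg δ]
  have h3 : Real.exp (δ / 8 * (δ * M)) * Real.exp (-(δ ^ 2 * M / 16)) =
      Real.exp (δ ^ 2 * M / 16) := by rw [← Real.exp_add]; congr 1; ring
  have h4 := mul_le_mul_of_nonneg_right h2 (Real.exp_pos (-(δ ^ 2 * M / 16))).le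
  rw [h3] at h4
  have h5 : 2 * (𝒯.card : ℝ) * Real.exp (δ ^ 2 * M / 16) * Real.exp (-(δ ^ 2 * M / 16)) <
      Real.exp (δ ^ 2 * M / 16) := by
    have := mul_lt_mul_of_pos_right hsize (Real.exp_pos (δ ^ 2 * M / 16))
    linarith
  linarith

/-- The number of tests is negligible against the concentration. -/
lemma exists_size_bound (k b C : ℕ) (hk : 1 ≤ k) {δ : ℝ} (hδ : 0 < δ) :
    ∃ n₀ : ℕ, ∀ n ≥ n₀, ∀ N : ℕ, N ≤ n ^ (k + 1) * 2 ^ (C * n ^ k) * b + 1 →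
      2 * (N : ℝ) * Real.exp (-(δ ^ 2 * (n : ℝ) ^ (k + 1) / 16)) < 1 := by
  obtain ⟨m, hm⟩ := exists_nat_gt (16 * (k + b + C + 3 : ℝ) / δ ^ 2)
  refine ⟨m + 1, fun n hn N hN => ?_⟩
  have hn1 : 1 ≤ n := by omega
  have h1 : N ≤ 2 ^ ((k + b + C + 2) * n ^ k) := by
    have hnk : n ≤ n ^ k := Nat.le_self_pow (by omega) n
    have hnk1 : 1 ≤ n ^ k := Nat.one_le_pow _ _ hn1
    have e1 : n ^ (k + 1) ≤ 2 ^ ((k + 1) * n ^ k) := by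
      rw [mul_comm, pow_mul]
      exact Nat.pow_le_pow_left (Nat.lt_two_pow_self.le.trans
        (Nat.pow_le_pow_right (by norm_num) hnk)) _
    have e2 : b ≤ 2 ^ (b * n ^ k) := Nat.lt_two_pow_self.le.trans
      (Nat.pow_le_pow_right (by norm_num) (Nat.le_mul_of_pos_right _ hnk1))
    have e3 : n ^ (k + 1) * 2 ^ (C * n ^ k) * b ≤ 2 ^ ((k + b + C + 1) * n ^ k) := by
      calc _ ≤ 2 ^ ((k + 1) * n ^ k) * 2 ^ (C * n ^ k) * 2 ^ (b * n ^ k) := by gcongr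
        _ = _ := by rw [← pow_add, ← pow_add]; congr 1; ring
    have e4 : 2 ^ ((k + b + C + 2) * n ^ k) = 2 ^ ((k + b + C + 1) * n ^ k) * 2 ^ (n ^ k) := by
      rw [← pow_add]; congr 1; ring
    have e5 : 2 ≤ 2 ^ (n ^ k) := Nat.le_self_pow (by omega) 2
    have e6 : 1 ≤ 2 ^ ((k + b + C + 1) * n ^ k) := Nat.one_le_two_pow
    rw [e4]
    nlinarith
  have h2 : 2 * (N : ℝ) ≤ Real.exp ((k + b + C + 3) * (n : ℝ) ^ k) := by
    have e1 : (2 : ℝ) * N ≤ 2 ^ ((k + b + C + 3) * n ^ k) := by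
      have : 2 * N ≤ 2 ^ ((k + b + C + 3) * n ^ k) := by
        have e4 : 2 ^ ((k + b + C + 3) * n ^ k) = 2 ^ ((k + b + C + 2) * n ^ k) * 2 ^ (n ^ k) := by
          rw [← pow_add]; congr 1; ring
        have e5 : 2 ≤ 2 ^ (n ^ k) :=
          Nat.le_self_pow (by have := Nat.one_le_pow k n hn1; omega) 2
        rw [e4, mul_comm]
        exact Nat.mul_le_mul h1 e5
      exact_mod_cast this
    refine e1.trans ?_
    have e2 : (2 : ℝ) ≤ Real.exp 1 := by have := Real.add_one_le_exp (1 : ℝ); linarith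
    calc (2 : ℝ) ^ ((k + b + C + 3) * n ^ k) ≤ Real.exp 1 ^ ((k + b + C + 3) * n ^ k) := by gcongr
      _ = _ := by rw [← Real.exp_nat_mul]; push_cast; ring_nf
  have h3 : (k + b + C + 3) * (n : ℝ) ^ k < δ ^ 2 * (n : ℝ) ^ (k + 1) / 16 := by
    have hmn : 16 * (k + b + C + 3 : ℝ) / δ ^ 2 < n :=
      hm.trans_le (by exact_mod_cast (by omega : m ≤ n))
    rw [div_lt_iff₀ (by positivity)] at hmn
    have : 0 < (n : ℝ) ^ k := by positivity
    have := mul_lt_mul_of_pos_right hmn this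
    rw [pow_succ (n : ℝ) k]
    linarith
  calc 2 * (N : ℝ) * Real.exp (-(δ ^ 2 * (n : ℝ) ^ (k + 1) / 16))
      ≤ Real.exp ((k + b + C + 3) * (n : ℝ) ^ k) *
        Real.exp (-(δ ^ 2 * (n : ℝ) ^ (k + 1) / 16)) := by gcongr
    _ = Real.exp ((k + b + C + 3) * (n : ℝ) ^ k - δ ^ 2 * (n : ℝ) ^ (k + 1) / 16) := by
        rw [← Real.exp_add]; congr 1
    _ < 1 := Real.exp_lt_one_iff.2 (by linarith)

end Random
end HypReg

namespace HypReg
section Couplings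
open Finset

/-- A coupling of two distributions `D`, `d` which rarely moves mass and only moves it into the
support of `d`. -/
lemma exists_transport (s : ℕ) (D d : ℕ → ℝ) (hD : ∀ c < s, 0 ≤ D c) (hd : ∀ c < s, 0 ≤ d c)
    (hD1 : ∑ c ∈ range s, D c = 1) (hd1 : ∑ c ∈ range s, d c = 1) :
    ∃ M : ℕ → ℕ → ℝ, (∀ c < s, ∀ c' < s, 0 ≤ M c c') ∧
      (∀ c < s, ∑ c' ∈ range s, M c c' = 1) ∧
      (∀ c' < s, ∑ c ∈ range s, D c * M c c' = d c') ∧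
      (∀ c < s, ∀ c' < s, 0 < M c c' → c = c' ∨ 0 < d c') ∧
      ∑ c ∈ range s, D c * (1 - M c c) ≤ ∑ c ∈ range s, |D c - d c| := by
  set m : ℕ → ℝ := fun c => if D c = 0 then 1 else min (D c) (d c) / D c with hm
  set e : ℕ → ℝ := fun c => d c - min (D c) (d c) with he
  set E := ∑ c ∈ range s, e c with hE
  have hDm : ∀ c < s, D c * m c = min (D c) (d c) := by
    intro c hc
    by_cases h : D c = 0
    · simp [hm, h, hd c hc]
    · simp only [hm, if_neg h]; field_simp
  have hm0 : ∀ c < s, 0 ≤ m c := by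
    intro c hc
    by_cases h : D c = 0
    · simp [hm, h]
    · simp only [hm, if_neg h]; exact div_nonneg (le_min (hD c hc) (hd c hc)) (hD c hc)
  have hm1 : ∀ c < s, m c ≤ 1 := by
    intro c hc
    by_cases h : D c = 0
    · simp [hm, h]
    · simp only [hm, if_neg h]; exact div_le_one_of_le₀ (min_le_left _ _) (hD c hc)
  have he0 : ∀ c, 0 ≤ e c := fun c => sub_nonneg.2 (min_le_right _ _)
  have hE0 : 0 ≤ E := sum_nonneg fun c _ => he0 c
  have hED : ∑ c ∈ range s, D c * (1 - m c) = E := by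
    have : ∀ c ∈ range s, D c * (1 - m c) = D c - min (D c) (d c) := by
      intro c hc; rw [mul_sub, hDm c (mem_range.1 hc), mul_one]
    rw [sum_congr rfl this, hE, sum_sub_distrib, sum_sub_distrib, hD1, hd1]
  have hcost : ∀ c < s, D c * (1 - m c) ≤ |D c - d c| := by
    intro c hc
    rw [mul_sub, hDm c hc, mul_one]
    rcases min_choice (D c) (d c) with h | h <;> rw [h]
    · simp
    · exact le_abs_self _
  rcases hE0.eq_or_lt with h0 | h0
  · have hez : ∀ c < s, e c = 0 := fun c hc =>
      (sum_eq_zero_iff_of_nonneg fun c _ => he0 c).1 h0.symm c (mem_range.2 hc)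
    have hDz : ∀ c < s, D c = d c := by
      have hDz' : ∀ c ∈ range s, D c * (1 - m c) = 0 :=
        (sum_eq_zero_iff_of_nonneg fun c hc => mul_nonneg (hD c (mem_range.1 hc))
          (by linarith [hm1 c (mem_range.1 hc)])).1 (hED.trans h0.symm)
      intro c hc
      have h1 := hDz' c (mem_range.2 hc)
      have h2 := hez c hc
      rw [mul_sub, hDm c hc, mul_one] at h1
      simp only [he] at h2
      linarith
    refine ⟨fun c c' => if c = c' then 1 else 0, ?_, ?_, ?_, ?_, ?_⟩
    · intro c _ c' _; dsimp only; split_ifs <;> norm_num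
    · intro c hc; simp [hc]
    · intro c hc; simp [hc, hDz c hc]
    · intro c _ c' _ h
      by_cases h' : c = c'
      · exact Or.inl h'
      · simp [h'] at h
    · simp only [if_true, sub_self, mul_zero, sum_const_zero]
      exact sum_nonneg fun c _ => abs_nonneg _
  · refine ⟨fun c c' => (if c = c' then m c else 0) + (1 - m c) * e c' / E, ?_, ?_, ?_, ?_, ?_⟩
    · intro c hc c' _
      have h1 : 0 ≤ 1 - m c := by linarith [hm1 c hc]
      have h2 := div_nonneg (mul_nonneg h1 (he0 c')) hE0
      dsimp only
      split_ifs
      · linarith [hm0 c hc]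
      · linarith
    · intro c hc
      rw [sum_add_distrib, sum_ite_eq, if_pos (mem_range.2 hc), ← sum_div, ← mul_sum, ← hE]
      field_simp; ring
    · intro c' hc'
      have : ∀ c ∈ range s, D c * ((if c = c' then m c else 0) + (1 - m c) * e c' / E) =
          (if c = c' then D c * m c else 0) + D c * (1 - m c) * (e c' / E) := by
        intro c _; split_ifs <;> ring
      rw [sum_congr rfl this, sum_add_distrib, sum_ite_eq', if_pos (mem_range.2 hc'),
        ← sum_mul, hED, hDm c' hc']
      field_simp
      simp only [he]; ring
    · intro c hc c' hc' h
      by_cases h' : c = c'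
      · exact Or.inl h'
      · right
        dsimp only at h
        rw [if_neg h', zero_add] at h
        by_contra! h2
        have h3 : d c' = 0 := le_antisymm h2 (hd c' hc')
        have h4 : e c' = 0 := by simp [he, h3, hD c' hc']
        rw [h4] at h; simp at h
    · refine sum_le_sum fun c hc => ?_
      have hc := mem_range.1 hc
      refine le_trans ?_ (hcost c hc)
      dsimp only
      rw [if_pos rfl]
      have h1 : 0 ≤ 1 - m c := by linarith [hm1 c hc]
      have h2 := div_nonneg (mul_nonneg h1 (he0 c)) hE0
      exact mul_le_mul_of_nonneg_left (by linarith) (hD c hc)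

lemma exists_fibers (s : ℕ) (N : ℕ → ℕ) (m : ℕ) (h : ∑ c ∈ range s, N c ≤ m) :
    ∃ F : ℕ → ℕ, (∀ r, F r ≤ s) ∧ (∀ c < s, ((range m).filter fun r => F r = c).card = N c) ∧
      ((range m).filter fun r => F r = s).card + ∑ c ∈ range s, N c = m := by
  induction s with
  | zero => exact ⟨fun _ => 0, by simp, by simp, by simp⟩
  | succ s ih =>
    rw [sum_range_succ] at h
    obtain ⟨F, h1, h2, h3⟩ := ih (by omega)
    obtain ⟨U, hU, hUc⟩ := exists_subset_card_eq
      (show N s ≤ ((range m).filter fun r => F r = s).card by omega)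
    have hUF : ∀ r ∈ U, r < m ∧ F r = s := fun r hr => by simpa using hU hr
    refine ⟨fun r => if F r = s ∧ r ∉ U then s + 1 else F r, ?_, ?_, ?_⟩
    · intro r; have := h1 r; dsimp only; split_ifs <;> omega
    · intro c hc
      rcases Nat.lt_succ_iff_lt_or_eq.1 hc with hc | rfl
      · rw [← h2 c hc]
        congr 1
        refine filter_congr fun r _ => ?_
        dsimp only
        split_ifs with h
        · omega
        · rfl
      · rw [← hUc]
        congr 1
        ext r
        simp only [mem_filter, mem_range]
        constructor
        · rintro ⟨hr, h⟩
          split_ifs at h with h'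
          · omega
          · by_contra hrU; exact h' ⟨h, hrU⟩
        · intro hr
          simp [hUF r hr, hr]
    · have : ((range m).filter fun r => (if F r = s ∧ r ∉ U then s + 1 else F r) = s + 1) =
          ((range m).filter fun r => F r = s) \ U := by
        ext r
        simp only [mem_filter, mem_range, mem_sdiff]
        have := h1 r
        constructor
        · rintro ⟨hr, h⟩
          split_ifs at h with h'
          · exact ⟨⟨hr, h'.1⟩, h'.2⟩
          · omega
        · rintro ⟨⟨hr, h⟩, h'⟩
          simp [hr, h, h']
      rw [this, card_sdiff_of_subset hU, hUc, sum_range_succ]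
      omega

/-- Splitting a distribution into `m` equal parts, most of which are monochromatic. -/
lemma exists_split (s m : ℕ) (hm : 1 ≤ m) (l : ℕ → ℝ) (hl : ∀ c < s, 0 ≤ l c)
    (hl1 : ∑ c ∈ range s, l c = 1) :
    ∃ (w : ℕ → ℕ → ℝ) (F : ℕ → ℕ), (∀ c < s, ∀ r < m, 0 ≤ w c r) ∧
      (∀ c < s, ∑ r ∈ range m, w c r = 1) ∧
      (∀ r < m, ∑ c ∈ range s, l c * w c r = 1 / m) ∧
      ∑ c ∈ range s, l c * ∑ r ∈ (range m).filter (fun r => F r ≠ c), w c r ≤ s / m := by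
  have hm0 : (0 : ℝ) < m := by exact_mod_cast hm
  set N : ℕ → ℕ := fun c => ⌊l c * m⌋₊ with hN
  have hN1 : ∀ c < s, (N c : ℝ) ≤ l c * m := fun c hc =>
    Nat.floor_le (mul_nonneg (hl c hc) hm0.le)
  have hN2 : ∀ c, l c * m ≤ N c + 1 := fun c => (Nat.lt_floor_add_one _).le
  have hNs : ∑ c ∈ range s, N c ≤ m := by
    have : (∑ c ∈ range s, (N c : ℝ)) ≤ m := by
      calc _ ≤ ∑ c ∈ range s, l c * m := sum_le_sum fun c hc => hN1 c (mem_range.1 hc)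
        _ = m := by rw [← sum_mul, hl1, one_mul]
    exact_mod_cast this
  obtain ⟨F, hF1, hF2, hF3⟩ := exists_fibers s N m hNs
  set P := ((range m).filter fun r => F r = s).card with hP
  have hF3' : (P : ℝ) + ∑ c ∈ range s, (N c : ℝ) = m := by exact_mod_cast hF3
  set ρ : ℕ → ℝ := fun c => l c - N c / m with hρ
  have hρ0 : ∀ c < s, 0 ≤ ρ c := fun c hc => by
    have : (N c : ℝ) / m ≤ l c := by rw [div_le_iff₀ hm0]; exact hN1 c hc
    simp only [hρ]; linarith
  have hρ1 : ∀ c, ρ c ≤ 1 / m := fun c => by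
    have : l c ≤ (N c + 1) / m := by rw [le_div_iff₀ hm0]; exact hN2 c
    rw [add_div] at this
    simp only [hρ]; linarith
  have hρs : ∑ c ∈ range s, ρ c = P / m := by
    simp only [hρ]
    rw [sum_sub_distrib, hl1, ← sum_div]
    field_simp; linarith
  have hz : ∀ c < s, l c = 0 → N c = 0 ∧ ρ c = 0 := fun c hc h => by
    have : N c = 0 := by simp [hN, h]
    simp [hρ, h, this]
  have hPρ : ∀ c < s, P * (ρ c / P) = ρ c := by
    intro c hc
    by_cases h : (P : ℝ) = 0
    · rw [h, zero_div] at hρs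
      have := (sum_eq_zero_iff_of_nonneg fun c hc => hρ0 c (mem_range.1 hc)).1 hρs c
        (mem_range.2 hc)
      rw [this]; simp
    · field_simp
  -- the joint mass
  set J : ℕ → ℕ → ℝ := fun c r => if F r = c then 1 / m else if F r = s then ρ c / P else 0 with hJ
  have hJ0 : ∀ c < s, ∀ r, 0 ≤ J c r := by
    intro c hc r; simp only [hJ]
    have := div_nonneg (hρ0 c hc) (Nat.cast_nonneg (α := ℝ) P)
    split_ifs <;> positivity
  have hbad : ∀ c < s, ∑ r ∈ (range m).filter (fun r => F r ≠ c), J c r = ρ c := by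
    intro c hc
    have h1 : ∑ r ∈ (range m).filter (fun r => F r ≠ c), J c r =
        ∑ r ∈ (range m).filter (fun r => F r = s), ρ c / P := by
      rw [sum_filter, sum_filter]
      refine sum_congr rfl fun r _ => ?_
      simp only [hJ]
      by_cases h1 : F r = c
      · simp [h1, show c ≠ s by omega]
      · simp [h1]
    rw [h1, sum_const, nsmul_eq_mul, ← hP, hPρ c hc]
  have hrow : ∀ c < s, ∑ r ∈ range m, J c r = l c := by
    intro c hc
    rw [← sum_filter_add_sum_filter_not (range m) (fun r => F r = c), hbad c hc]
    have : ∑ r ∈ (range m).filter (fun r => F r = c), J c r = N c / m := by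
      rw [sum_congr rfl (g := fun _ => (1 : ℝ) / m) fun r hr => by
        simp [hJ, (mem_filter.1 hr).2], sum_const, nsmul_eq_mul, hF2 c hc]
      ring
    rw [this]; simp [hρ]
  have hcol : ∀ r < m, ∑ c ∈ range s, J c r = 1 / m := by
    intro r hr
    by_cases h : F r = s
    · have : ∀ c ∈ range s, J c r = ρ c / P := by
        intro c hc
        have : F r ≠ c := by have := mem_range.1 hc; omega
        simp only [hJ, if_neg this, if_pos h]
      rw [sum_congr rfl this, ← sum_div, hρs]
      have hP0 : P ≠ 0 := card_ne_zero_of_mem (mem_filter.2 ⟨mem_range.2 hr, h⟩)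
      have : (P : ℝ) ≠ 0 := by exact_mod_cast hP0
      field_simp
    · have hlt : F r < s := lt_of_le_of_ne (hF1 r) h
      have : ∀ c ∈ range s, J c r = if F r = c then 1 / (m : ℝ) else 0 := by
        intro c _; simp only [hJ, if_neg h]
      rw [sum_congr rfl this, sum_ite_eq, if_pos (mem_range.2 hlt)]
  refine ⟨fun c r => if l c = 0 then 1 / m else J c r / l c, F, ?_, ?_, ?_, ?_⟩
  · intro c hc r _; dsimp only; split_ifs
    · positivity
    · exact div_nonneg (hJ0 c hc r) (hl c hc)
  · intro c hc
    by_cases h : l c = 0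
    · simp only [if_pos h, sum_const, card_range, nsmul_eq_mul]; field_simp
    · simp only [if_neg h]; rw [← sum_div, hrow c hc, div_self h]
  · intro r hr
    rw [← hcol r hr]
    refine sum_congr rfl fun c hc => ?_
    have hc := mem_range.1 hc
    by_cases h : l c = 0
    · rw [h, zero_mul]
      have h1 := hrow c hc
      rw [h] at h1
      exact ((sum_eq_zero_iff_of_nonneg fun r _ => hJ0 c hc r).1 h1 r (mem_range.2 hr)).symm
    · simp only [if_neg h]; field_simp
  · calc _ ≤ ∑ c ∈ range s, (1 : ℝ) / m := by
          refine sum_le_sum fun c hc => ?_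
          have hc := mem_range.1 hc
          by_cases h : l c = 0
          · rw [h, zero_mul]; positivity
          · simp only [if_neg h]
            rw [← sum_div, hbad c hc, mul_div_cancel₀ _ h]
            exact hρ1 c
      _ = s / m := by rw [sum_const, card_range, nsmul_eq_mul]; ring

end Couplings
end HypReg

namespace HypReg
section Colorings
open Finset
attribute [local instance 10] Classical.propDecidable

variable {V : Type*} [DecidableEq V]

/-- `S` and `S'` carry the same colours on their proper subsets, up to a bijection. -/
def pIso (ψ : Finset V → ℕ) (S S' : Finset V) : Prop :=
  ∃ e : V → V, Set.InjOn e S ∧ S.image e = S' ∧ ∀ T ⊂ S, ψ (T.image e) = ψ T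

/-- `S` and `S'` carry the same colours on all their subsets, up to a bijection. -/
def fIso (ψ : Finset V → ℕ) (S S' : Finset V) : Prop := pIso ψ S S' ∧ ψ S = ψ S'

/-- `pIso` for `ψ` together with equality of the top label `θ`. -/
def rel (ψ θ : Finset V → ℕ) (S S' : Finset V) : Prop := pIso ψ S S' ∧ θ S = θ S'

/-- The vertices of `S` have pairwise different colours. -/
def Cross (ψ : Finset V → ℕ) (S : Finset V) : Prop := Set.InjOn (fun v => ψ {v}) S

/-- The sets of size `j - 1` which look like a facet of `S₀`. -/
noncomputable def facets (W : Finset V) (ψ : Finset V → ℕ) (j : ℕ) (S₀ : Finset V) : Finset (Finset V) :=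
  (W.powersetCard (j - 1)).filter fun T => ∃ T₀, T₀ ⊂ S₀ ∧ fIso ψ T T₀

variable {ψ θ : Finset V → ℕ} {S S' S'' S₀ W : Finset V}

lemma pIso_refl (ψ : Finset V → ℕ) (S : Finset V) : pIso ψ S S :=
  ⟨id, Set.injOn_id _, by simp, by simp⟩

lemma pIso.symm (h : pIso ψ S S') : pIso ψ S' S := by
  obtain ⟨e, he, rfl, hT⟩ := h
  rcases S.eq_empty_or_nonempty with rfl | ⟨v, hv⟩
  · exact pIso_refl ψ ∅
  have : Nonempty V := ⟨v⟩
  have hinv : ∀ u ∈ S, Function.invFunOn e S (e u) = u := fun u hu => by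
    have h1 : ∃ a ∈ (S : Set V), e a = e u := ⟨u, hu, rfl⟩
    exact he (Function.invFunOn_mem h1) hu (Function.invFunOn_eq h1)
  have himg : ∀ T ⊆ S, (T.image e).image (Function.invFunOn e S) = T := by
    intro T hTS
    rw [image_image]
    conv_rhs => rw [← image_id (s := T)]
    exact image_congr fun u hu => hinv u (hTS hu)
  refine ⟨Function.invFunOn e S, ?_, himg S subset_rfl, ?_⟩
  · intro a ha b hb hab
    obtain ⟨a', ha', rfl⟩ := mem_image.1 (mem_coe.1 ha)
    obtain ⟨b', hb', rfl⟩ := mem_image.1 (mem_coe.1 hb)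
    rw [hinv a' ha', hinv b' hb'] at hab
    rw [hab]
  · intro T hTS
    obtain ⟨T', hT'S, rfl⟩ := subset_image_iff.1 hTS.1
    have hT'S : T' ⊆ S := by exact_mod_cast hT'S
    rw [himg T' hT'S, hT T' (hT'S.ssubset_of_ne ?_)]
    rintro rfl
    exact hTS.2 subset_rfl

lemma pIso.trans (h : pIso ψ S S') (h' : pIso ψ S' S'') : pIso ψ S S'' := by
  obtain ⟨e, he, rfl, hT⟩ := h
  obtain ⟨e', he', rfl, hT'⟩ := h'
  refine ⟨e' ∘ e, ?_, by rw [image_image], ?_⟩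
  · refine he'.comp he fun u hu => ?_
    exact mem_coe.2 (mem_image_of_mem e hu)
  · intro T hTS
    rw [← image_image, hT', hT T hTS]
    refine (image_subset_image hTS.1).ssubset_of_ne fun h => ?_
    have h1 := congrArg card h
    rw [card_image_of_injOn he, card_image_of_injOn (he.mono hTS.1)] at h1
    exact absurd (card_lt_card hTS) (by omega)

lemma fIso_equivalence (ψ : Finset V → ℕ) : Equivalence (fIso ψ) :=
  ⟨fun S => ⟨pIso_refl ψ S, rfl⟩, fun h => ⟨h.1.symm, h.2.symm⟩,
    fun h h' => ⟨h.1.trans h'.1, h.2.trans h'.2⟩⟩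

lemma rel_equivalence (ψ θ : Finset V → ℕ) : Equivalence (rel ψ θ) :=
  ⟨fun S => ⟨pIso_refl ψ S, rfl⟩, fun h => ⟨h.1.symm, h.2.symm⟩,
    fun h h' => ⟨h.1.trans h'.1, h.2.trans h'.2⟩⟩

lemma pIso.card_eq (h : pIso ψ S S') : S.card = S'.card := by
  obtain ⟨e, he, rfl, -⟩ := h
  exact (card_image_of_injOn he).symm

lemma fIso_iff : fIso ψ S S' ↔
    ∃ e : V → V, Set.InjOn e S ∧ S.image e = S' ∧ ∀ T ⊆ S, ψ (T.image e) = ψ T := by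
  constructor
  · rintro ⟨⟨e, he, rfl, hT⟩, h⟩
    refine ⟨e, he, rfl, fun T hTS => ?_⟩
    rcases hTS.eq_or_ssubset with rfl | h'
    · exact h.symm
    · exact hT T h'
  · rintro ⟨e, he, rfl, hT⟩
    exact ⟨⟨e, he, rfl, fun T h => hT T h.1⟩, (hT S subset_rfl).symm⟩

lemma pIso.exists_fIso (h : pIso ψ S S') {T : Finset V} (hT : T ⊂ S) :
    ∃ T', T' ⊂ S' ∧ fIso ψ T T' := by
  obtain ⟨e, he, rfl, hT'⟩ := h
  refine ⟨T.image e, (image_subset_image hT.1).ssubset_of_ne fun h => ?_, ?_⟩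
  · have h1 := congrArg card h
    rw [card_image_of_injOn he, card_image_of_injOn (he.mono hT.1)] at h1
    exact absurd (card_lt_card hT) (by omega)
  · exact fIso_iff.2 ⟨e, he.mono hT.1, rfl, fun U hU => hT' U (hU.trans_ssubset hT)⟩

/-- Finer colourings on the lower levels have finer isomorphism relations. -/
lemma pIso.mono (h : pIso ψ S S')
    (hψ : ∀ T ⊂ S, ∀ T' ⊂ S', T.card = T'.card → ψ T = ψ T' → θ T = θ T') : pIso θ S S' := by
  obtain ⟨e, he, rfl, hT⟩ := h
  refine ⟨e, he, rfl, fun T hTS => ?_⟩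
  have hc := card_image_of_injOn (he.mono hTS.1)
  refine (hψ T hTS _ ((image_subset_image hTS.1).ssubset_of_ne fun h => ?_) hc.symm
    (hT T hTS).symm).symm
  have h1 := congrArg card h
  rw [hc, card_image_of_injOn he] at h1
  exact absurd (card_lt_card hTS) (by omega)

lemma pIso.cross (h : pIso ψ S S') (hc : Cross ψ S) : Cross ψ S' := by
  rcases le_or_gt S.card 1 with h1 | h1
  · rw [h.card_eq] at h1
    intro a ha b hb _
    exact card_le_one.1 h1 a ha b hb
  obtain ⟨e, he, rfl, hT⟩ := h
  intro a ha b hb hab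
  obtain ⟨a, ha', rfl⟩ := mem_image.1 (mem_coe.1 ha)
  obtain ⟨b, hb', rfl⟩ := mem_image.1 (mem_coe.1 hb)
  have hs : ∀ u ∈ S, ψ {e u} = ψ {u} := fun u hu => by
    have : ({u} : Finset V) ⊂ S :=
      (singleton_subset_iff.2 hu).ssubset_of_ne fun h => by rw [← h] at h1; simp at h1
    simpa using hT _ this
  dsimp only at hab
  rw [hs a ha', hs b hb'] at hab
  rw [hc ha' hb' hab]

lemma Cross.mono (h : Cross ψ S') (hS : S ⊆ S') : Cross ψ S := Set.InjOn.mono hS h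

lemma fIso.exists_map (h : fIso ψ S S') :
    ∃ e : V → V, S.image e = S' ∧ (∀ T ⊆ S, ψ (T.image e) = ψ T) ∧
      ∀ u ∈ S, e u ∈ S' ∧ ψ {e u} = ψ {u} := by
  obtain ⟨e, -, rfl, hT⟩ := fIso_iff.1 h
  refine ⟨e, rfl, hT, fun u hu => ⟨mem_image_of_mem e hu, ?_⟩⟩
  simpa using hT {u} (singleton_subset_iff.2 hu)

lemma exists_facet {T : Finset V} (hT : T ⊂ S) :
    ∃ T₁ ∈ S.powersetCard (S.card - 1), T ⊆ T₁ := by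
  obtain ⟨T₁, h1, h2, h3⟩ := exists_subsuperset_card_eq hT.1
    (show T.card ≤ S.card - 1 by have := card_lt_card hT; omega) (Nat.sub_le _ _)
  exact ⟨T₁, mem_powersetCard.2 ⟨h2, h3⟩, h1⟩

/-- A crossing set is determined, up to isomorphism, by its facets. -/
lemma pIso_iff_facets {j : ℕ} (hj : 2 ≤ j) (hS₀ : S₀.card = j) (h₀ : Cross ψ S₀)
    (hS : S ∈ W.powersetCard j) :
    pIso ψ S S₀ ↔ Cross ψ S ∧ ∀ T ∈ S.powersetCard (j - 1), T ∈ facets W ψ j S₀ := by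
  obtain ⟨hSW, hSc⟩ := mem_powersetCard.1 hS
  constructor
  · refine fun h => ⟨h.symm.cross h₀, fun T hT => ?_⟩
    obtain ⟨hTS, hTc⟩ := mem_powersetCard.1 hT
    refine mem_filter.2 ⟨mem_powersetCard.2 ⟨hTS.trans hSW, hTc⟩, ?_⟩
    exact h.exists_fIso (hTS.ssubset_of_ne fun h => by rw [h] at hTc; omega)
  · rintro ⟨hc, hf⟩
    have hfac : ∀ T ⊂ S, ∃ T₁, T ⊆ T₁ ∧ T₁ ⊆ S ∧ ∃ T₀, T₀ ⊂ S₀ ∧ fIso ψ T₁ T₀ := by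
      intro T hT
      obtain ⟨T₁, h1, h2⟩ := exists_facet hT
      rw [hSc] at h1
      exact ⟨T₁, h2, (mem_powersetCard.1 h1).1, (mem_filter.1 (hf T₁ h1)).2⟩
    have hcol : ∀ v ∈ S, ∃ u ∈ S₀, ψ {u} = ψ {v} := by
      intro v hv
      have : ({v} : Finset V) ⊂ S :=
        (singleton_subset_iff.2 hv).ssubset_of_ne fun h => by rw [← h] at hSc; simp at hSc; omega
      obtain ⟨T₁, h1, -, T₀, h2, h3⟩ := hfac _ this
      obtain ⟨e, -, -, he⟩ := h3.exists_map
      have := he v (h1 (mem_singleton_self v))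
      exact ⟨e v, h2.1 this.1, this.2⟩
    let e : V → V := fun v => if h : ∃ u ∈ S₀, ψ {u} = ψ {v} then h.choose else v
    have he : ∀ v ∈ S, e v ∈ S₀ ∧ ψ {e v} = ψ {v} := by
      intro v hv
      have h := hcol v hv
      simp only [e, dif_pos h]
      exact h.choose_spec
    have hinj : Set.InjOn e S := by
      intro a ha b hb hab
      refine hc ha hb ?_
      dsimp only
      rw [← (he a ha).2, ← (he b hb).2, hab]
    refine ⟨e, hinj, ?_, ?_⟩
    · refine eq_of_subset_of_card_le (image_subset_iff.2 fun v hv => (he v hv).1) ?_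
      rw [card_image_of_injOn hinj, hS₀, hSc]
    · intro T hT
      obtain ⟨T₁, h1, h2, T₀, h3, h4⟩ := hfac T hT
      obtain ⟨e₁, -, h5, h6⟩ := h4.exists_map
      rw [← h5 T h1]
      congr 1
      refine image_congr fun v hv => ?_
      have hv1 := h1 (mem_coe.1 hv)
      have hvS := h2 hv1
      refine h₀ (he v hvS).1 (h3.1 (h6 v hv1).1) ?_
      dsimp only
      rw [(he v hvS).2, (h6 v hv1).2]

/-- For sets of size at least three, the crossing condition follows from the facets. -/
lemma cross_of_facets {j : ℕ} (hj : 3 ≤ j) (h₀ : Cross ψ S₀)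
    (hS : S.card = j) (h : ∀ T ∈ S.powersetCard (j - 1), T ∈ facets W ψ j S₀) : Cross ψ S := by
  intro a ha b hb hab
  have h2 : ({a, b} : Finset V) ⊂ S := by
    refine (insert_subset ha (singleton_subset_iff.2 hb)).ssubset_of_ne fun h => ?_
    have := card_le_two (a := a) (b := b)
    rw [h, hS] at this; omega
  obtain ⟨T₁, h1, h3⟩ := exists_facet h2
  rw [hS] at h1
  obtain ⟨-, T₀, h4, h5⟩ := mem_filter.1 (h T₁ h1)
  exact (h5.1.symm.cross (h₀.mono h4.1)) (h3 (mem_insert_self _ _))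
    (h3 (mem_insert_of_mem (mem_singleton_self _))) hab

end Colorings
end HypReg

namespace HypReg
section Inner
open Finset
attribute [local instance 10] Classical.propDecidable

variable {V : Type*} [DecidableEq V]

/-- The indicator of the colour class `c`. -/
noncomputable def col (H : Finset V → ℕ) (c : ℕ) (S : Finset V) : ℝ := if H S = c then 1 else 0

lemma col_nonneg (H : Finset V → ℕ) (c : ℕ) (S : Finset V) : 0 ≤ col H c S := by
  unfold col; split_ifs <;> norm_num

lemma col_le_one (H : Finset V → ℕ) (c : ℕ) (S : Finset V) : col H c S ≤ 1 := by
  unfold col; split_ifs <;> norm_num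

lemma sum_col {H : Finset V → ℕ} {s : ℕ} {S : Finset V} (h : H S < s) :
    ∑ c ∈ range s, col H c S = 1 := by
  simp [col, h]

/-- The indicator of the cliques of `Q`. -/
noncomputable def clq (W : Finset V) (j : ℕ) (Q : Finset (Finset V)) (S : Finset V) : ℝ :=
  if S ∈ Kset W (j - 1) j Q then 1 else 0

lemma clq_mem (W : Finset V) (j : ℕ) (Q : Finset (Finset V)) (S : Finset V) :
    0 ≤ clq W j Q S ∧ clq W j Q S ≤ 1 := by
  unfold clq; split_ifs <;> norm_num

lemma card_powersetCard_le (W : Finset V) (j : ℕ) :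
    ((W.powersetCard j).card : ℝ) ≤ (W.card : ℝ) ^ j := by
  rw [card_powersetCard]
  exact_mod_cast Nat.choose_le_pow _ _

lemma mem_Kset_of_pIso {W S S' : Finset V} {ψ : Finset V → ℕ} {Q : Finset (Finset V)} {k : ℕ}
    (hψ : ∀ T T', ψ T = ψ T' → (T ∈ Q → T' ∈ Q)) (hS' : S' ∈ W.powersetCard (k + 1))
    (h : pIso ψ S S') (hS : S ∈ Kset W k (k + 1) Q) : S' ∈ Kset W k (k + 1) Q := by
  refine mem_filter.2 ⟨hS', fun T hT => ?_⟩
  obtain ⟨hT1, hT2⟩ := mem_powersetCard.1 hT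
  have hlt : T ⊂ S' := hT1.ssubset_of_ne fun h => by
    have := (mem_powersetCard.1 hS').2; rw [← h, hT2] at this; omega
  obtain ⟨T', h1, h2⟩ := h.symm.exists_fIso hlt
  refine hψ T' T h2.2.symm ((mem_filter.1 hS).2 T' (mem_powersetCard.2 ⟨h1.1, ?_⟩))
  rw [← h2.1.card_eq, hT2]

/-- Total energy of the colouring `H` over the cells of `rel ψ θ`. -/
noncomputable def energy (X : Finset (Finset V)) (s : ℕ) (H ψ θ : Finset V → ℕ) : ℝ :=
  ∑ c ∈ range s, en X (rel ψ θ) (col H c)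

lemma energy_le (X : Finset (Finset V)) (s : ℕ) (H ψ θ : Finset V → ℕ) :
    energy X s H ψ θ ≤ s * X.card := by
  calc _ ≤ ∑ c ∈ range s, (X.card : ℝ) := sum_le_sum fun c _ =>
        en_le_card (fun S _ => col_nonneg H c S) (fun S _ => col_le_one H c S)
    _ = _ := by simp

lemma energy_nonneg (X : Finset (Finset V)) (s : ℕ) (H ψ θ : Finset V → ℕ) :
    0 ≤ energy X s H ψ θ :=
  sum_nonneg fun _ _ => sum_nonneg fun _ _ => sq_nonneg _

/-- The averages of `H` over the cells of `rel ψ θ` fool all clique tests. -/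
def Fools (W : Finset V) (k s : ℕ) (H ψ θ : Finset V → ℕ) (ε : ℝ) : Prop :=
  ∀ c < s, ∀ σ : Finset V → ℝ,
    (∀ S ∈ W.powersetCard (k + 1), ∀ S' ∈ W.powersetCard (k + 1), rel ψ θ S S' → σ S = σ S') →
    (∀ S ∈ W.powersetCard (k + 1), |σ S| ≤ 1) → ∀ Q,
    |∑ S ∈ W.powersetCard (k + 1), σ S * clq W (k + 1) Q S *
      (col H c S - avg (W.powersetCard (k + 1)) (rel ψ θ) (col H c) S)| ≤
        ε * (W.card : ℝ) ^ (k + 1)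

/-- Every colouring of the lower levels can be refined boundedly to one fooling all tests. -/
lemma exists_fooling (k s : ℕ) {ε : ℝ} (hε : 0 < ε) :
    ∃ R : ℕ, ∀ (V : Type) [DecidableEq V] (W : Finset V) (θ H ψ₀ : Finset V → ℕ),
      ∃ (ψ : Finset V → ℕ) (r : ℕ), r ≤ R ∧ (∀ T, ψ T / 2 ^ r = ψ₀ T) ∧ Fools W k s H ψ θ ε := by
  obtain ⟨R, hR⟩ := exists_nat_gt (s / ε ^ 2 : ℝ)
  refine ⟨R, fun V _ W θ H ψ₀ => ?_⟩
  set X := W.powersetCard (k + 1) with hX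
  set M := (W.card : ℝ) ^ (k + 1) with hMdef
  have hXM : (X.card : ℝ) ≤ M := card_powersetCard_le W (k + 1)
  have hM0 : 0 ≤ M := by positivity
  have key : ∀ i : ℕ, ∃ (ψ : Finset V → ℕ) (r : ℕ), r ≤ i ∧ (∀ T, ψ T / 2 ^ r = ψ₀ T) ∧
      (Fools W k s H ψ θ ε ∨ (i * ε ^ 2 * M ≤ energy X s H ψ θ ∧ 0 < M)) := by
    intro i
    induction i with
    | zero =>
      refine ⟨ψ₀, 0, le_rfl, by simp, ?_⟩
      rcases hM0.eq_or_lt with h | h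
      · left
        intro c _ σ _ _ Q
        have : X = ∅ := by
          rw [← card_eq_zero]
          have : (X.card : ℝ) ≤ 0 := by rw [h]; exact hXM
          exact_mod_cast le_antisymm this (Nat.cast_nonneg _)
        rw [← hX, this]
        simpa [← hMdef] using mul_nonneg hε.le hM0
      · right
        exact ⟨by simpa using energy_nonneg _ _ _ _ _, h⟩
    | succ i ih =>
      obtain ⟨ψ, r, hr, hψ, h | ⟨h, hM⟩⟩ := ih
      · exact ⟨ψ, r, by omega, hψ, Or.inl h⟩
      by_cases hF : Fools W k s H ψ θ ε
      · exact ⟨ψ, r, by omega, hψ, Or.inl hF⟩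
      unfold Fools at hF
      push Not at hF
      obtain ⟨c, hc, σ, hσ, hσ1, Q, hQ⟩ := hF
      let ψ' : Finset V → ℕ := fun T => 2 * ψ T + if T ∈ Q then 1 else 0
      have hdiv : ∀ T, ψ' T / 2 = ψ T := by
        intro T; simp only [ψ']; split_ifs <;> omega
      have hQ' : ∀ T T', ψ' T = ψ' T' → (T ∈ Q → T' ∈ Q) := by
        intro T T' h hT; by_contra hT'
        simp only [ψ', if_pos hT, if_neg hT'] at h; omega
      have href : ∀ S S', rel ψ' θ S S' → rel ψ θ S S' := fun S S' h =>
        ⟨h.1.mono fun T _ T' _ _ h => by rw [← hdiv T, ← hdiv T', h], h.2⟩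
      refine ⟨ψ', r + 1, by omega, fun T => ?_, Or.inr ⟨?_, hM⟩⟩
      · rw [pow_succ', ← Nat.div_div_eq_div_mul, hdiv, hψ]
      have hmono : ∀ c', en X (rel ψ θ) (col H c') ≤ en X (rel ψ' θ) (col H c') := fun c' =>
        en_mono (rel_equivalence _ _) (rel_equivalence _ _) fun S _ S' _ h => href S S' h
      have hinv : ∀ S ∈ X, ∀ S' ∈ X, rel ψ' θ S S' →
          σ S * clq W (k + 1) Q S = σ S' * clq W (k + 1) Q S' := by
        intro S hS S' hS' h
        rw [hσ S hS S' hS' (href S S' h)]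
        have : S ∈ Kset W k (k + 1) Q ↔ S' ∈ Kset W k (k + 1) Q :=
          ⟨mem_Kset_of_pIso hQ' hS' h.1, mem_Kset_of_pIso hQ' hS h.1.symm⟩
        simp only [clq, add_tsub_cancel_right, this]
      have habs : ∀ S ∈ X, |σ S * clq W (k + 1) Q S| ≤ 1 := by
        intro S hS
        have h1 := clq_mem W (k + 1) Q S
        rw [abs_mul, abs_of_nonneg h1.1]
        exact mul_le_one₀ (hσ1 S hS) h1.1 h1.2
      have h1 := sq_sum_test_le (f := col H c) (rel_equivalence ψ θ) (rel_equivalence ψ' θ)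
        (fun S _ S' _ h => href S S' h) hinv habs
      have h2 : (ε * M) ^ 2 ≤ (∑ S ∈ X, σ S * clq W (k + 1) Q S *
          (col H c S - avg X (rel ψ θ) (col H c) S)) ^ 2 := by
        rw [sq_le_sq, abs_of_nonneg (mul_nonneg hε.le hM0)]
        exact hQ.le
      have h3 : 0 ≤ en X (rel ψ' θ) (col H c) - en X (rel ψ θ) (col H c) :=
        sub_nonneg.2 (hmono c)
      have h4 : (ε * M) ^ 2 ≤ M * (en X (rel ψ' θ) (col H c) - en X (rel ψ θ) (col H c)) :=
        h2.trans (h1.trans (mul_le_mul_of_nonneg_right hXM h3))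
      have h5 : ε ^ 2 * M ≤ en X (rel ψ' θ) (col H c) - en X (rel ψ θ) (col H c) := by
        have : M * (ε ^ 2 * M) ≤ M * (en X (rel ψ' θ) (col H c) - en X (rel ψ θ) (col H c)) := by
          calc _ = (ε * M) ^ 2 := by ring
            _ ≤ _ := h4
        exact le_of_mul_le_mul_left this hM
      have h6 : energy X s H ψ θ + ε ^ 2 * M ≤ energy X s H ψ' θ := by
        have h7 := sum_erase_add (range s) (fun c => en X (rel ψ θ) (col H c)) (mem_range.2 hc)
        have h8 := sum_erase_add (range s) (fun c => en X (rel ψ' θ) (col H c)) (mem_range.2 hc)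
        have h9 : ∑ c' ∈ (range s).erase c, en X (rel ψ θ) (col H c') ≤
          ∑ c' ∈ (range s).erase c, en X (rel ψ' θ) (col H c') := sum_le_sum fun c' _ => hmono c'
        simp only [energy]
        linarith
      push_cast
      linarith
  obtain ⟨ψ, r, hr, hψ, h | ⟨h, hM⟩⟩ := key R
  · exact ⟨ψ, r, hr, hψ, h⟩
  · exfalso
    have h1 := h.trans ((energy_le X s H ψ θ).trans
      (mul_le_mul_of_nonneg_left hXM (Nat.cast_nonneg s)))
    rw [div_lt_iff₀ (by positivity)] at hR
    have := le_of_mul_le_mul_right h1 hM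
    linarith

end Inner
end HypReg

namespace HypReg
section RandomColoring
open Finset
attribute [local instance 10] Classical.propDecidable

/-- The indicator of the cliques of `Q` satisfying `P`. -/
noncomputable def tst {V : Type*} [DecidableEq V] (W : Finset V) (j : ℕ) (P : Finset V → Prop)
    (Q : Finset (Finset V)) (S : Finset V) : ℝ :=
  (if P S then 1 else 0) * clq W j Q S

section
variable {V : Type*} [DecidableEq V]

lemma tst_mem (W : Finset V) (j : ℕ) (P : Finset V → Prop) (Q : Finset (Finset V))
    (S : Finset V) : 0 ≤ tst W j P Q S ∧ tst W j P Q S ≤ 1 := by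
  have := clq_mem W j Q S
  unfold tst; split_ifs <;> simp [this]

lemma clq_inter (W : Finset V) (k : ℕ) (Q : Finset (Finset V)) (S : Finset V) :
    clq W (k + 1) (Q ∩ W.powersetCard k) S = clq W (k + 1) Q S := by
  have : S ∈ Kset W k (k + 1) (Q ∩ W.powersetCard k) ↔ S ∈ Kset W k (k + 1) Q := by
    simp only [Kset, mem_filter, and_congr_right_iff]
    intro hS
    refine ⟨fun h T hT => (mem_inter.1 (h T hT)).1, fun h T hT => mem_inter.2 ⟨h T hT, ?_⟩⟩
    exact mem_powersetCard.2 ⟨(mem_powersetCard.1 hT).1.trans (mem_powersetCard.1 hS).1,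
      (mem_powersetCard.1 hT).2⟩
  simp only [clq, add_tsub_cancel_right, this]

lemma clq_univ (W : Finset V) (k : ℕ) {S : Finset V} (hS : S ∈ W.powersetCard (k + 1)) :
    clq W (k + 1) (W.powersetCard k) S = 1 := by
  rw [clq, if_pos]
  refine mem_filter.2 ⟨hS, fun T hT => ?_⟩
  simp only [add_tsub_cancel_right] at hT ⊢
  exact powersetCard_mono (mem_powersetCard.1 hS).1 hT

end

/-- A random colouring of the `(k+1)`-sets which behaves as expected on all clique tests and on
one additional test. -/
lemma exists_random_coloring (k b : ℕ) (hk : 1 ≤ k) {δ : ℝ} (hδ : 0 < δ) (hδ1 : δ ≤ 1) :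
    ∃ n₀ : ℕ, ∀ (V : Type) [DecidableEq V] (W : Finset V), n₀ ≤ W.card →
      ∀ (ι : Type) (I : Finset ι) (P : ι → Finset V → Prop),
      I.card ≤ W.card ^ (k + 1) * 2 ^ (W.card ^ k) →
      ∀ (w : Finset V → ℕ → ℝ) (t₀ : Finset V → ℕ → ℝ),
      (∀ S ∈ W.powersetCard (k + 1), ∀ c < b, 0 ≤ w S c) →
      (∀ S ∈ W.powersetCard (k + 1), ∑ c ∈ range b, w S c = 1) →
      (∀ S ∈ W.powersetCard (k + 1), ∀ c < b, |t₀ S c| ≤ 1) →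
      ∃ φ : Finset V → ℕ, (∀ S ∈ W.powersetCard (k + 1), φ S < b ∧ 0 < w S (φ S)) ∧
        (∀ i ∈ I, ∀ Q, ∀ c < b, |∑ S ∈ W.powersetCard (k + 1), tst W (k + 1) (P i) Q S *
          (col φ c S - w S c)| ≤ δ * (W.card : ℝ) ^ (k + 1)) ∧
        |∑ S ∈ W.powersetCard (k + 1), (t₀ S (φ S) - ∑ c ∈ range b, w S c * t₀ S c)| ≤
          δ * (W.card : ℝ) ^ (k + 1) := by
  obtain ⟨n₀, hn₀⟩ := exists_size_bound k b 2 hk hδ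
  refine ⟨n₀, fun V _ W hW ι I P hI w t₀ hw0 hw1 ht₀ => ?_⟩
  set X := W.powersetCard (k + 1) with hX
  let 𝒯 : Finset (Option (ι × Finset (Finset V) × ℕ)) :=
    Finset.insertNone (I ×ˢ ((W.powersetCard k).powerset ×ˢ range b))
  let t : Option (ι × Finset (Finset V) × ℕ) → Finset V → ℕ → ℝ := fun τ S c =>
    match τ with
    | none => t₀ S c
    | some (i, Q, c') => tst W (k + 1) (P i) Q S * if c = c' then 1 else 0
  have hcard : 𝒯.card ≤ W.card ^ (k + 1) * 2 ^ (2 * W.card ^ k) * b + 1 := by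
    simp only [𝒯, card_insertNone, card_product, card_powerset, card_range, card_powersetCard]
    have h1 : 2 ^ (W.card.choose k) ≤ 2 ^ (W.card ^ k) :=
      Nat.pow_le_pow_right (by norm_num) (Nat.choose_le_pow _ _)
    have h2 : 2 ^ (2 * W.card ^ k) = 2 ^ (W.card ^ k) * 2 ^ (W.card ^ k) := by
      rw [← pow_add]; congr 1; ring
    calc _ ≤ W.card ^ (k + 1) * 2 ^ (W.card ^ k) * (2 ^ (W.card ^ k) * b) + 1 := by gcongr
      _ = _ := by rw [h2]; ring
  obtain ⟨φ, h1, h2⟩ := exists_random_choice 𝒯 b X w t (card_powersetCard_le W (k + 1)) hδ hδ1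
    hw0 hw1 (fun τ _ S hS c hc => by
      match τ with
      | none => exact ht₀ S hS c hc
      | some (i, Q, c') =>
        have := tst_mem W (k + 1) (P i) Q S
        simp only [t]
        rw [abs_of_nonneg (by split_ifs <;> simp [this])]
        split_ifs <;> simp [this]) (hn₀ _ hW _ hcard)
  refine ⟨φ, h1, fun i hi Q c hc => ?_, ?_⟩
  · have h3 := h2 (some (i, Q ∩ W.powersetCard k, c)) (by
      simp only [𝒯, some_mem_insertNone, mem_product, mem_powerset, mem_range]
      exact ⟨hi, inter_subset_right, hc⟩)
    refine le_trans (le_of_eq ?_) h3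
    congr 1
    refine sum_congr rfl fun S _ => ?_
    simp only [t, tst, clq_inter, col]
    have : ∀ c' ∈ range b, w S c' * ((if P i S then (1 : ℝ) else 0) * clq W (k + 1) Q S *
        if c' = c then 1 else 0) = if c' = c then w S c *
          ((if P i S then (1 : ℝ) else 0) * clq W (k + 1) Q S) else 0 := by
      intro c' _
      rcases eq_or_ne c' c with rfl | h
      · simp
      · simp [h]
    rw [sum_congr rfl this, sum_ite_eq', if_pos (mem_range.2 hc)]
    ring
  · have := h2 none (by simp [𝒯])
    exact this

end RandomColoring
end HypReg

namespace HypReg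
section Success
open Finset
attribute [local instance 10] Classical.propDecidable

/-- If the energies of a coarse and a fine colouring are close and the fine one fools all tests,
then `H` can be slightly modified to be regular with respect to the coarse one. -/
lemma exists_regular_modification (k s : ℕ) (hk : 1 ≤ k) {δ : ℝ} (hδ : 0 < δ) (hδ1 : δ ≤ 1) :
    ∃ n₀ : ℕ, ∀ (V : Type) [DecidableEq V] (W : Finset V), n₀ ≤ W.card →
      ∀ (H φ ψ θ : Finset V → ℕ) (ε ν : ℝ), 0 ≤ ε →
      (∀ S ∈ W.powersetCard (k + 1), H S < s) →
      (∀ S ∈ W.powersetCard (k + 1), ∀ S' ∈ W.powersetCard (k + 1),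
        rel ψ θ S S' → rel φ θ S S') →
      Fools W k s H ψ θ ε →
      energy (W.powersetCard (k + 1)) s H ψ θ - energy (W.powersetCard (k + 1)) s H φ θ ≤
        ν * (W.card : ℝ) ^ (k + 1) →
      ∃ G : Finset V → ℕ, (∀ S ∈ W.powersetCard (k + 1), G S < s) ∧
        (((W.powersetCard (k + 1)).filter fun S => G S ≠ H S).card : ℝ) ≤
          (√(s * ν) + δ) * (W.card : ℝ) ^ (k + 1) ∧
        (∀ S ∈ W.powersetCard (k + 1), ∃ S' ∈ W.powersetCard (k + 1),
          rel φ θ S S' ∧ H S' = G S) ∧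
        ∀ S₀ ∈ W.powersetCard (k + 1), ∀ Q, ∀ c < s,
          |∑ S ∈ W.powersetCard (k + 1), tst W (k + 1) (fun S => rel φ θ S S₀) Q S *
            (col G c S - avg (W.powersetCard (k + 1)) (rel φ θ) (col G c) S)| ≤
            2 * (s * ε + δ) * (W.card : ℝ) ^ (k + 1) := by
  have htr : ∀ D d : ℕ → ℝ, ∃ M : ℕ → ℕ → ℝ, ((∀ c < s, 0 ≤ D c) ∧ (∀ c < s, 0 ≤ d c) ∧
      (∑ c ∈ range s, D c = 1) ∧ ∑ c ∈ range s, d c = 1) →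
      (∀ c < s, ∀ c' < s, 0 ≤ M c c') ∧
      (∀ c < s, ∑ c' ∈ range s, M c c' = 1) ∧
      (∀ c' < s, ∑ c ∈ range s, D c * M c c' = d c') ∧
      (∀ c < s, ∀ c' < s, 0 < M c c' → c = c' ∨ 0 < d c') ∧
      ∑ c ∈ range s, D c * (1 - M c c) ≤ ∑ c ∈ range s, |D c - d c| := by
    intro D d
    by_cases h : ((∀ c < s, 0 ≤ D c) ∧ (∀ c < s, 0 ≤ d c) ∧
      (∑ c ∈ range s, D c = 1) ∧ ∑ c ∈ range s, d c = 1)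
    · obtain ⟨M, hM⟩ := exists_transport s D d h.1 h.2.1 h.2.2.1 h.2.2.2
      exact ⟨M, fun _ => hM⟩
    · exact ⟨0, fun h' => absurd h' h⟩
  choose Mf hMf using htr
  obtain ⟨n₀, hn₀⟩ := exists_random_coloring k s hk hδ hδ1
  refine ⟨n₀, fun V _ W hW H φ ψ θ ε ν hε hH href hF hE => ?_⟩
  set X := W.powersetCard (k + 1) with hX
  set n := (W.card : ℝ) ^ (k + 1) with hn
  have hXn : (X.card : ℝ) ≤ n := card_powersetCard_le W (k + 1)
  have hn0 : 0 ≤ n := by positivity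
  have hφe := rel_equivalence φ θ
  have hψe := rel_equivalence ψ θ
  set D : Finset V → ℕ → ℝ := fun S c => avg X (rel ψ θ) (col H c) S with hD
  set d : Finset V → ℕ → ℝ := fun S c => avg X (rel φ θ) (col H c) S with hd
  have hDc : ∀ S S', rel ψ θ S S' → D S = D S' := fun S S' h => by
    funext c; exact avg_congr hψe h
  have hdc : ∀ S S', rel φ θ S S' → d S = d S' := fun S S' h => by
    funext c; exact avg_congr hφe h
  have hsum : ∀ r : Finset V → Finset V → Prop, Equivalence r → ∀ S ∈ X,
      ∑ c ∈ range s, avg X r (col H c) S = 1 := by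
    intro r hr S hS
    rw [avg_sum, ← avg_const_one hr hS]
    unfold avg
    congr 1
    exact sum_congr rfl fun y hy => sum_col (hH y (mem_filter.1 hy).1)
  set M : Finset V → ℕ → ℕ → ℝ := fun S => Mf (D S) (d S) with hM
  have hMS : ∀ S ∈ X, _ := fun S hS => hMf (D S) (d S)
    ⟨fun c _ => avg_nonneg (fun x _ => col_nonneg H c x) S,
      fun c _ => avg_nonneg (fun x _ => col_nonneg H c x) S,
      hsum _ hψe S hS, hsum _ hφe S hS⟩
  have hMc : ∀ S ∈ X, ∀ S' ∈ X, rel ψ θ S S' → M S = M S' := fun S hS S' hS' h => by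
    simp only [hM]
    rw [hDc S S' h, hdc S S' (href S hS S' hS' h)]
  have hM1 : ∀ S ∈ X, ∀ c < s, ∀ c' < s, M S c c' ≤ 1 := fun S hS c hc c' hc' => by
    rw [← (hMS S hS).2.1 c hc]
    exact single_le_sum (f := fun c' => Mf (D S) (d S) c c')
      (fun c'' hc'' => (hMS S hS).1 c hc c'' (mem_range.1 hc'')) (mem_range.2 hc')
  obtain ⟨G, hG, hGt, hGc⟩ := hn₀ V W hW (Finset V) X (fun S₀ S => rel φ θ S S₀)
    (by
      rw [hX, card_powersetCard]
      exact (Nat.choose_le_pow _ _).trans (Nat.le_mul_of_pos_right _ (by positivity)))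
    (fun S c => M S (H S) c) (fun S c => if c = H S then 0 else 1)
    (fun S hS c hc => (hMS S hS).1 _ (hH S hS) c hc)
    (fun S hS => (hMS S hS).2.1 _ (hH S hS))
    (fun S _ c _ => by split_ifs <;> simp)
  refine ⟨G, fun S hS => (hG S hS).1, ?_, ?_, ?_⟩
  · have h1 : (((X.filter fun S => G S ≠ H S).card : ℕ) : ℝ) =
        ∑ S ∈ X, if G S = H S then (0 : ℝ) else 1 := by
      rw [card_filter]; push_cast
      exact sum_congr rfl fun S _ => by by_cases h : G S = H S <;> simp [h]
    have h2 : ∀ S ∈ X, ∑ c ∈ range s, M S (H S) c * (if c = H S then (0 : ℝ) else 1) =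
        ∑ c ∈ range s, (1 - M S c c) * col H c S := by
      intro S hS
      have e1 : ∀ c ∈ range s, M S (H S) c * (if c = H S then (0 : ℝ) else 1) =
          M S (H S) c - if c = H S then M S (H S) c else 0 := by
        intro c _; split_ifs <;> ring
      have e2 : ∀ c ∈ range s, (1 - M S c c) * col H c S =
          if H S = c then 1 - M S c c else 0 := by
        intro c _; unfold col; split_ifs <;> ring
      rw [sum_congr rfl e1, sum_congr rfl e2, sum_sub_distrib, sum_ite_eq', sum_ite_eq,
        if_pos (mem_range.2 (hH S hS)), if_pos (mem_range.2 (hH S hS)),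
        (hMS S hS).2.1 _ (hH S hS)]
    have h3 : ∑ S ∈ X, ∑ c ∈ range s, (1 - M S c c) * col H c S ≤
        ∑ S ∈ X, ∑ c ∈ range s, |D S c - d S c| := by
      have : ∑ S ∈ X, ∑ c ∈ range s, (1 - M S c c) * col H c S =
          ∑ S ∈ X, ∑ c ∈ range s, D S c * (1 - M S c c) := by
        rw [sum_comm, sum_comm (s := X)]
        refine sum_congr rfl fun c _ => ?_
        rw [← sum_mul_avg hψe fun S hS S' hS' h => by rw [hMc S hS S' hS' h]]
        exact sum_congr rfl fun S _ => mul_comm _ _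
      rw [this]
      exact sum_le_sum fun S hS => (hMS S hS).2.2.2.2
    have h4 : ∑ S ∈ X, ∑ c ∈ range s, |D S c - d S c| ≤ √(s * ν) * n := by
      have e1 : (∑ p ∈ X ×ˢ range s, |D p.1 p.2 - d p.1 p.2|) ^ 2 ≤ (s * ν) * n ^ 2 := by
        calc _ ≤ ((X ×ˢ range s).card : ℝ) * ∑ p ∈ X ×ˢ range s, |D p.1 p.2 - d p.1 p.2| ^ 2 :=
              sq_sum_le_card_mul_sum_sq
          _ = (X.card * s : ℝ) * (energy X s H ψ θ - energy X s H φ θ) := by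
              rw [card_product, card_range]; push_cast
              congr 1
              rw [energy, energy, ← sum_sub_distrib, sum_product_right]
              refine sum_congr rfl fun c _ => ?_
              rw [← sum_sq_avg_sub hφe hψe href]
              exact sum_congr rfl fun S _ => sq_abs _
          _ ≤ (X.card * s : ℝ) * (ν * n) := mul_le_mul_of_nonneg_left hE (by positivity)
          _ = (X.card : ℝ) * (s * (ν * n)) := by ring
          _ ≤ n * (s * (ν * n)) := by
              refine mul_le_mul_of_nonneg_right hXn (mul_nonneg (Nat.cast_nonneg _) ?_)
              refine le_trans ?_ hE
              rw [energy, energy, ← sum_sub_distrib]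
              exact sum_nonneg fun c _ => sub_nonneg.2 (en_mono hφe hψe href)
          _ = _ := by ring
      rw [← sum_product' X (range s) fun S c => |D S c - d S c|]
      have e2 := Real.sqrt_le_sqrt e1
      rw [Real.sqrt_sq (sum_nonneg fun _ _ => abs_nonneg _), Real.sqrt_mul' _ (sq_nonneg n),
        Real.sqrt_sq hn0] at e2
      exact e2
    rw [sum_sub_distrib, sum_congr rfl h2] at hGc
    have := (abs_le.1 hGc).2
    rw [h1, add_mul]
    linarith
  · intro S hS
    have h1 := (hG S hS).2
    rcases (hMS S hS).2.2.2.1 _ (hH S hS) _ (hG S hS).1 h1 with h | h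
    · exact ⟨S, hS, hφe.refl S, h⟩
    · by_contra! hcon
      refine h.ne' ?_
      simp only [hd, avg]
      rw [sum_eq_zero, zero_div]
      intro S' hS'
      obtain ⟨hS'X, hr⟩ := mem_filter.1 hS'
      rw [col, if_neg (hcon S' hS'X hr)]
  · intro S₀ hS₀ Q c hc
    have key : ∀ Q, |∑ S ∈ X, tst W (k + 1) (fun S => rel φ θ S S₀) Q S *
        (col G c S - d S₀ c)| ≤ (s * ε + δ) * n := by
      intro Q
      have e1 := hGt S₀ hS₀ Q c hc
      have e2 : ∀ S ∈ X, tst W (k + 1) (fun S => rel φ θ S S₀) Q S * (col G c S - d S₀ c) =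
          tst W (k + 1) (fun S => rel φ θ S S₀) Q S * (col G c S - M S (H S) c) +
          ∑ c₀ ∈ range s, ((if rel φ θ S S₀ then 1 else 0) * M S c₀ c) * clq W (k + 1) Q S *
            (col H c₀ S - D S c₀) := by
        intro S hS
        by_cases hr : rel φ θ S S₀
        · have f1 : ∑ c₀ ∈ range s, M S c₀ c * col H c₀ S = M S (H S) c := by
            simp [col, hH S hS]
          have f2 : ∑ c₀ ∈ range s, M S c₀ c * D S c₀ = d S c := by
            rw [← (hMS S hS).2.2.1 c hc]
            exact sum_congr rfl fun c₀ _ => mul_comm _ _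
          have f3 : ∑ c₀ ∈ range s, ((if rel φ θ S S₀ then 1 else 0) * M S c₀ c) *
              clq W (k + 1) Q S * (col H c₀ S - D S c₀) =
              clq W (k + 1) Q S * (M S (H S) c - d S c) := by
            rw [← f1, ← f2, ← sum_sub_distrib, mul_sum]
            exact sum_congr rfl fun c₀ _ => by rw [if_pos hr]; ring
          rw [f3, tst, if_pos hr, hdc S S₀ hr]; ring
        · simp [tst, hr]
      rw [sum_congr rfl e2, sum_add_distrib, sum_comm (s := X), add_mul, add_comm (s * ε * n)]
      refine (abs_add_le _ _).trans (add_le_add e1 ?_)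
      refine (abs_sum_le_sum_abs _ _).trans ?_
      calc _ ≤ ∑ c₀ ∈ range s, ε * n := sum_le_sum fun c₀ hc₀ => by
            have hc₀ := mem_range.1 hc₀
            refine hF c₀ hc₀ (fun S => (if rel φ θ S S₀ then 1 else 0) * M S c₀ c) ?_ ?_ Q
            · intro S hS S' hS' h
              have h1 := href S hS S' hS' h
              have : rel φ θ S S₀ ↔ rel φ θ S' S₀ :=
                ⟨fun h2 => hφe.trans (hφe.symm h1) h2, fun h2 => hφe.trans h1 h2⟩
              rw [hMc S hS S' hS' h]
              simp only [this]
            · intro S hS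
              have h1 := (hMS S hS).1 c₀ hc₀ c hc
              have h2 := hM1 S hS c₀ hc₀ c hc
              split_ifs
              · rw [one_mul, abs_of_nonneg h1]; exact h2
              · simp
        _ = s * ε * n := by simp [mul_assoc]
    set q := avg X (rel φ θ) (col G c) S₀ with hq
    set Y := cellOf X (rel φ θ) S₀ with hY
    have hY0 : (0 : ℝ) < Y.card := by
      exact_mod_cast card_pos.2 ⟨S₀, mem_filter.2 ⟨hS₀, hφe.refl S₀⟩⟩
    have hYr : ∀ S, rel φ θ S S₀ ↔ rel φ θ S₀ S := fun S => ⟨hφe.symm, hφe.symm⟩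
    have e3 : ∀ Q, ∀ F : Finset V → ℝ, ∑ S ∈ X, tst W (k + 1) (fun S => rel φ θ S S₀) Q S * F S =
        ∑ S ∈ Y, clq W (k + 1) Q S * F S := by
      intro Q F
      rw [hY, cellOf, sum_filter]
      refine sum_congr rfl fun S _ => ?_
      simp only [tst, hYr S]
      split_ifs <;> simp
    have e4 : |Y.card * (q - d S₀ c)| ≤ (s * ε + δ) * n := by
      have := key (W.powersetCard k)
      rw [e3] at this
      have e5 : ∑ S ∈ Y, clq W (k + 1) (W.powersetCard k) S * (col G c S - d S₀ c) =
          Y.card * (q - d S₀ c) := by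
        rw [sum_congr rfl (g := fun S => col G c S - d S₀ c) fun S hS => by
          rw [clq_univ W k (mem_filter.1 hS).1, one_mul], sum_sub_distrib, mul_sub, hq, avg, ← hY]
        simp only [sum_const, nsmul_eq_mul]
        field_simp
      rwa [e5] at this
    have e6 : ∑ S ∈ X, tst W (k + 1) (fun S => rel φ θ S S₀) Q S *
        (col G c S - avg X (rel φ θ) (col G c) S) =
        ∑ S ∈ X, tst W (k + 1) (fun S => rel φ θ S S₀) Q S * (col G c S - d S₀ c) -
        (∑ S ∈ Y, clq W (k + 1) Q S) * (q - d S₀ c) := by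
      rw [e3, e3, sum_mul, ← sum_sub_distrib]
      refine sum_congr rfl fun S hS => ?_
      rw [← avg_congr hφe (mem_filter.1 hS).2, ← hq]; ring
    rw [e6]
    refine (abs_sub _ _).trans ?_
    have e7 : |(∑ S ∈ Y, clq W (k + 1) Q S) * (q - d S₀ c)| ≤ (s * ε + δ) * n := by
      refine le_trans ?_ e4
      rw [abs_mul, abs_mul, abs_of_nonneg hY0.le,
        abs_of_nonneg (sum_nonneg fun S _ => (clq_mem W (k + 1) Q S).1)]
      refine mul_le_mul_of_nonneg_right ?_ (abs_nonneg _)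
      calc _ ≤ ∑ S ∈ Y, (1 : ℝ) := sum_le_sum fun S _ => (clq_mem W (k + 1) Q S).2
        _ = _ := by simp
    linarith [key Q]

end Success
end HypReg

namespace HypReg
section Outer
open Finset
attribute [local instance 10] Classical.propDecidable

variable {V : Type*} [DecidableEq V]

lemma pIso.mono_of_fIso {ψ θ : Finset V → ℕ} {S S' : Finset V} (h : pIso ψ S S')
    (hψ : ∀ T ⊂ S, ∀ T' ⊂ S', fIso ψ T T' → θ T = θ T') : pIso θ S S' := by
  obtain ⟨e, he, rfl, hT⟩ := h
  refine ⟨e, he, rfl, fun T hTS => ?_⟩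
  have hc := card_image_of_injOn (he.mono hTS.1)
  refine (hψ T hTS _ ((image_subset_image hTS.1).ssubset_of_ne fun h => ?_)
    (fIso_iff.2 ⟨e, he.mono hTS.1, rfl, fun U hU => hT U (hU.trans_ssubset hTS)⟩)).symm
  have h1 := congrArg card h
  rw [hc, card_image_of_injOn he] at h1
  exact absurd (card_lt_card hTS) (by omega)

/-- The function `F` is (up to `δ`) orthogonal to all clique tests on the crossing cells of `ψ`. -/
def LU (W : Finset V) (j : ℕ) (ψ : Finset V → ℕ) (F : Finset V → ℝ) (δ : ℝ) : Prop :=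
  ∀ S₀ ∈ W.powersetCard j, Cross ψ S₀ → ∀ Q,
    |∑ S ∈ W.powersetCard j, tst W j (fun S => pIso ψ S S₀) Q S * F S| ≤ δ * (W.card : ℝ) ^ j

/-- `θ` is an equitable colouring with `q j` colours on level `j`, up to level `k`. -/
structure GoodTheta (W : Finset V) (k : ℕ) (q : ℕ → ℕ) (μ : ℝ) (θ : Finset V → ℕ) : Prop where
  lt : ∀ S ⊆ W, 1 ≤ S.card → S.card ≤ k → θ S < q S.card
  size : ∀ i < q 1, (W.filter fun v => θ {v} = i).card = W.card / q 1 ∨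
    (W.filter fun v => θ {v} = i).card = W.card / q 1 + 1
  unif : ∀ j, 2 ≤ j → j ≤ k → ∀ ψ : Finset V → ℕ,
    (∀ T ⊆ W, ∀ T' ⊆ W, T.card = T'.card → T.card < j → ψ T = ψ T' → θ T = θ T') →
    ∀ b < q j, LU W j ψ (fun S => col θ b S - 1 / q j) μ

/-- `φ` is an equitable colouring with `a j` colours on level `j` up to level `k`, refining `θ`. -/
structure Fam (W : Finset V) (k : ℕ) (q a : ℕ → ℕ) (θ φ : Finset V → ℕ) (δ : ℝ) : Prop where
  lt : ∀ S ⊆ W, 1 ≤ S.card → S.card ≤ k → φ S < a S.card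
  mod : ∀ S ⊆ W, 1 ≤ S.card → S.card ≤ k → φ S % q S.card = θ S
  dvd : ∀ j, 1 ≤ j → j ≤ k → q j ∣ a j
  pos : ∀ j, 1 ≤ j → j ≤ k → 0 < a j
  zero : ∀ j, (j = 0 ∨ k < j) → a j = 0
  size : ∀ i < a 1, (W.filter fun v => φ {v} = i).card = W.card / a 1 ∨
    (W.filter fun v => φ {v} = i).card = W.card / a 1 + 1
  unif : ∀ j, 2 ≤ j → j ≤ k → ∀ b < a j, LU W j φ (fun S => col φ b S - 1 / a j) δ

/-- Apart from few exceptions, the isomorphism type for `φ` determines the colour `ψ`. -/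
def Appr (W : Finset V) (j : ℕ) (φ ψ : Finset V → ℕ) (ν : ℝ) : Prop :=
  ∃ B : Finset (Finset V), (B.card : ℝ) ≤ ν * (W.card : ℝ) ^ j ∧
    ∀ T ∈ W.powersetCard j, T ∉ B → ∀ T' ∈ W.powersetCard j, T' ∉ B → fIso φ T T' → ψ T = ψ T'

/-- `φ` is a bounded equitable colouring refining `θ` and approximately refining `ψ`. -/
structure Good (W : Finset V) (k L t : ℕ) (q a : ℕ → ℕ) (θ φ ψ : Finset V → ℕ) (ν δ : ℝ) :
    Prop extends Fam W k q a θ φ δ where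
  bdd : ∀ j, a j ≤ t
  large : L ≤ a 1
  appr : ∀ j, 1 ≤ j → j ≤ k → Appr W j φ ψ ν

/-- `G` is a small modification of `H` which is regular with respect to `rel φ θ`. -/
structure RegTop (W : Finset V) (k s : ℕ) (θ φ H G : Finset V → ℕ) (ν δ : ℝ) : Prop where
  lt : ∀ S ∈ W.powersetCard (k + 1), G S < s
  close : (((W.powersetCard (k + 1)).filter fun S => G S ≠ H S).card : ℝ) ≤
    ν * (W.card : ℝ) ^ (k + 1)
  wit : ∀ S ∈ W.powersetCard (k + 1), ∃ S' ∈ W.powersetCard (k + 1),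
    rel φ θ S S' ∧ H S' = G S
  reg : ∀ S₀ ∈ W.powersetCard (k + 1), ∀ Q, ∀ c < s,
    |∑ S ∈ W.powersetCard (k + 1), tst W (k + 1) (fun S => rel φ θ S S₀) Q S *
      (col G c S - avg (W.powersetCard (k + 1)) (rel φ θ) (col G c) S)| ≤
      δ * (W.card : ℝ) ^ (k + 1)

/-- Colourings of the first `k` levels can be approximated by equitable ones. -/
def Build (k : ℕ) : Prop :=
  ∀ (s L : ℕ) (q : ℕ → ℕ), (∀ j, 0 < q j) → ∀ ν : ℝ, 0 < ν → ∀ δ : (ℕ → ℕ) → ℝ,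
    (∀ a, 0 < δ a) → ∃ (t n₀ : ℕ) (μ : ℝ), 0 < μ ∧
    ∀ (V : Type) [DecidableEq V] (W : Finset V) (θ ψ : Finset V → ℕ), n₀ ≤ W.card →
      GoodTheta W k q μ θ → (∀ S ⊆ W, 1 ≤ S.card → S.card ≤ k → ψ S < s) →
      ∃ a φ, Good W k L t q a θ φ ψ ν (δ a)

/-- As `Build k`, together with a regular modification of level `k + 1`. -/
def Regz (k : ℕ) : Prop :=
  ∀ (s L : ℕ) (q : ℕ → ℕ), (∀ j, 0 < q j) → ∀ ν : ℝ, 0 < ν → ∀ δ : (ℕ → ℕ) → ℝ,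
    (∀ a, 0 < δ a) → ∃ (t n₀ : ℕ) (μ : ℝ), 0 < μ ∧
    ∀ (V : Type) [DecidableEq V] (W : Finset V) (θ ψ : Finset V → ℕ), n₀ ≤ W.card →
      GoodTheta W (k + 1) q μ θ → (∀ S ⊆ W, 1 ≤ S.card → S.card ≤ k + 1 → ψ S < s) →
      ∃ a φ G, Good W k L t q a θ φ ψ ν (δ a) ∧ RegTop W k s θ φ ψ G ν (δ a)

lemma LU.mono {W : Finset V} {j : ℕ} {ψ : Finset V → ℕ} {F : Finset V → ℝ} {δ δ' : ℝ}
    (h : LU W j ψ F δ) (hδ : δ ≤ δ') : LU W j ψ F δ' := fun S₀ hS₀ hc Q =>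
  (h S₀ hS₀ hc Q).trans (mul_le_mul_of_nonneg_right hδ (by positivity))

lemma GoodTheta.mono {W : Finset V} {k k' : ℕ} {q : ℕ → ℕ} {μ μ' : ℝ} {θ : Finset V → ℕ}
    (h : GoodTheta W k q μ θ) (hk : k' ≤ k) (hμ : μ ≤ μ') : GoodTheta W k' q μ' θ :=
  ⟨fun S hS h1 h2 => h.lt S hS h1 (h2.trans hk), h.size,
    fun j h1 h2 ψ hψ b hb => (h.unif j h1 (h2.trans hk) ψ hψ b hb).mono hμ⟩

lemma Appr.mono {W : Finset V} {j : ℕ} {φ ψ ψ' : Finset V → ℕ} {ν ν' : ℝ}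
    (h : Appr W j φ ψ ν) (hν : ν ≤ ν')
    (hψ : ∀ T ∈ W.powersetCard j, ∀ T' ∈ W.powersetCard j, ψ T = ψ T' → ψ' T = ψ' T') :
    Appr W j φ ψ' ν' := by
  obtain ⟨B, hB, h⟩ := h
  exact ⟨B, hB.trans (mul_le_mul_of_nonneg_right hν (by positivity)),
    fun T hT hTB T' hT' hTB' hf => hψ T hT T' hT' (h T hT hTB T' hT' hTB' hf)⟩

lemma exists_pos_le_of_bounded (k t : ℕ) {δ : (ℕ → ℕ) → ℝ} (hδ : ∀ a, 0 < δ a) :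
    ∃ d : ℝ, 0 < d ∧ ∀ a : ℕ → ℕ, (∀ j, a j ≤ t) → (∀ j, k < j → a j = 0) → d ≤ δ a := by
  obtain ⟨f₀, hf₀⟩ := Finite.exists_min fun f : Fin (k + 1) → Fin (t + 1) =>
    δ fun j => if h : j < k + 1 then f ⟨j, h⟩ else 0
  refine ⟨_, hδ _, fun a h1 h2 => (hf₀ fun j => ⟨a j, Nat.lt_succ_of_le (h1 j)⟩).trans_eq ?_⟩
  congr 1
  funext j
  split_ifs with h
  · rfl
  · exact (h2 j (by omega)).symm

lemma card_filter_superset_le (W T : Finset V) (K : ℕ) :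
    ((W.powersetCard K).filter fun S => T ⊆ S).card ≤ W.card ^ (K - T.card) := by
  refine le_trans ?_ ((card_powersetCard _ W).trans_le (Nat.choose_le_pow _ _))
  refine card_le_card_of_injOn (fun S => S \ T) ?_ ?_
  · intro S hS
    obtain ⟨h1, h2⟩ := mem_filter.1 (mem_coe.1 hS)
    obtain ⟨h3, h4⟩ := mem_powersetCard.1 h1
    exact mem_coe.2 (mem_powersetCard.2 ⟨sdiff_subset.trans h3, by rw [card_sdiff_of_subset h2, h4]⟩)
  · intro S hS S' hS' h
    have h1 := (mem_filter.1 (mem_coe.1 hS)).2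
    have h2 := (mem_filter.1 (mem_coe.1 hS')).2
    dsimp only at h
    rw [← sdiff_union_of_subset h1, h, sdiff_union_of_subset h2]

/-- Approximate refinement on the lower levels gives true refinement outside a small set. -/
lemma exists_small_bad {W : Finset V} {k : ℕ} {φ ψ : Finset V → ℕ} {ν : ℝ}
    (h : ∀ j, 1 ≤ j → j ≤ k → Appr W j φ ψ ν) :
    ∃ B ⊆ W.powersetCard (k + 1), (B.card : ℝ) ≤ k * ν * (W.card : ℝ) ^ (k + 1) ∧
      ∀ S ∈ W.powersetCard (k + 1) \ B, ∀ S' ∈ W.powersetCard (k + 1) \ B,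
        pIso φ S S' → pIso ψ S S' := by
  choose! B hB hBB using h
  refine ⟨(Icc 1 k).biUnion fun j => (B j ∩ W.powersetCard j).biUnion fun T =>
    (W.powersetCard (k + 1)).filter fun S => T ⊆ S, ?_, ?_, ?_⟩
  · refine biUnion_subset.2 fun j _ => biUnion_subset.2 fun T _ => filter_subset _ _
  · have h1 : ∀ j ∈ Icc 1 k, ((((B j ∩ W.powersetCard j).biUnion fun T =>
        (W.powersetCard (k + 1)).filter fun S => T ⊆ S).card : ℕ) : ℝ) ≤
        ν * (W.card : ℝ) ^ (k + 1) := by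
      intro j hj
      obtain ⟨hj1, hj2⟩ := mem_Icc.1 hj
      have h2 : ((B j ∩ W.powersetCard j).biUnion fun T =>
        (W.powersetCard (k + 1)).filter fun S => T ⊆ S).card ≤
          (B j ∩ W.powersetCard j).card * W.card ^ (k + 1 - j) := by
        refine card_biUnion_le_card_mul _ _ _ fun T hT => ?_
        have h3 := card_filter_superset_le W T (k + 1)
        rwa [(mem_powersetCard.1 (mem_inter.1 hT).2).2] at h3
      calc _ ≤ (((B j ∩ W.powersetCard j).card * W.card ^ (k + 1 - j) : ℕ) : ℝ) := by
            exact_mod_cast h2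
        _ ≤ ((B j).card : ℝ) * (W.card : ℝ) ^ (k + 1 - j) := by
            push_cast
            refine mul_le_mul_of_nonneg_right ?_ (by positivity)
            exact_mod_cast card_le_card inter_subset_left
        _ ≤ ν * (W.card : ℝ) ^ j * (W.card : ℝ) ^ (k + 1 - j) :=
            mul_le_mul_of_nonneg_right (hB j hj1 hj2) (by positivity)
        _ = _ := by rw [mul_assoc, ← pow_add]; congr 2; omega
    calc _ ≤ ((∑ j ∈ Icc 1 k, ((B j ∩ W.powersetCard j).biUnion fun T =>
        (W.powersetCard (k + 1)).filter fun S => T ⊆ S).card : ℕ) : ℝ) := by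
          exact_mod_cast card_biUnion_le
      _ ≤ ∑ j ∈ Icc 1 k, ν * (W.card : ℝ) ^ (k + 1) := by
          push_cast; exact sum_le_sum h1
      _ = _ := by simp [mul_assoc]
  · intro S hS S' hS' hSS
    have hgood : ∀ S, S ∈ W.powersetCard (k + 1) \ ((Icc 1 k).biUnion fun j =>
        (B j ∩ W.powersetCard j).biUnion fun T =>
          (W.powersetCard (k + 1)).filter fun S => T ⊆ S) → ∀ T ⊂ S, 1 ≤ T.card →
        T.card ≤ k ∧ T ∈ W.powersetCard T.card ∧ T ∉ B T.card := by
      intro S hS T hT h1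
      obtain ⟨h2, h3⟩ := mem_sdiff.1 hS
      obtain ⟨h4, h5⟩ := mem_powersetCard.1 h2
      have h6 := card_lt_card hT
      have h7 : T ∈ W.powersetCard T.card := mem_powersetCard.2 ⟨hT.1.trans h4, rfl⟩
      refine ⟨by omega, h7, fun h8 => h3 ?_⟩
      exact mem_biUnion.2 ⟨T.card, mem_Icc.2 ⟨h1, by omega⟩, mem_biUnion.2
        ⟨T, mem_inter.2 ⟨h8, h7⟩, mem_filter.2 ⟨h2, hT.1⟩⟩⟩
    refine hSS.mono_of_fIso fun T hT T' hT' hf => ?_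
    have hc := hf.1.card_eq
    rcases Nat.eq_zero_or_pos T.card with h0 | h0
    · rw [h0] at hc
      rw [card_eq_zero.1 h0, card_eq_zero.1 hc.symm]
    · obtain ⟨h1, h2, h3⟩ := hgood S hS T hT h0
      obtain ⟨-, h5, h6⟩ := hgood S' hS' T' hT' (hc ▸ h0)
      rw [← hc] at h5 h6
      exact hBB _ h0 h1 T h2 h3 T' h5 h6 hf

end Outer
end HypReg

namespace HypReg
section OuterLoop
open Finset
attribute [local instance 10] Classical.propDecidable

lemma Fam.eq_of_eq {V : Type*} [DecidableEq V] {W : Finset V} {k : ℕ} {q a : ℕ → ℕ}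
    {θ φ : Finset V → ℕ} {δ : ℝ} (h : Fam W k q a θ φ δ) {T T' : Finset V} (hT : T ⊆ W)
    (hT' : T' ⊆ W) (hc : T.card = T'.card) (hk : T.card ≤ k) (hφ : φ T = φ T') : θ T = θ T' := by
  rcases Nat.eq_zero_or_pos T.card with h0 | h0
  · rw [h0] at hc
    rw [card_eq_zero.1 h0, card_eq_zero.1 hc.symm]
  · rw [← h.mod T hT h0 hk, ← h.mod T' hT' (hc ▸ h0) (hc ▸ hk), hc, hφ]

lemma regz_of_build {k : ℕ} (hk : 1 ≤ k) (hb : Build k) : Regz k := by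
  intro s L q hq ν hν δ hδ
  rcases Nat.eq_zero_or_pos s with rfl | hs
  · refine ⟨0, 1, 1, one_pos, fun V _ W θ ψ hW _ hψ => ?_⟩
    obtain ⟨v, hv⟩ := card_pos.1 hW
    exact absurd (hψ {v} (singleton_subset_iff.2 hv) (by simp) (by simp)) (by omega)
  have hs' : (0 : ℝ) < s := by exact_mod_cast hs
  have hk' : (0 : ℝ) < k := by exact_mod_cast hk
  set ν₁ : ℝ := ν ^ 2 / (4 * s) with hν₁
  set ν₂ : ℝ := ν₁ / 2 with hν₂
  have hν₁0 : 0 < ν₁ := by positivity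
  have hν₂0 : 0 < ν₂ := by positivity
  have key : ∀ i : ℕ, ∃ (t n₀ : ℕ) (μ : ℝ), 0 < μ ∧
      ∀ (V : Type) [DecidableEq V] (W : Finset V) (θ ψ : Finset V → ℕ), n₀ ≤ W.card →
      GoodTheta W (k + 1) q μ θ → (∀ S ⊆ W, 1 ≤ S.card → S.card ≤ k + 1 → ψ S < s) →
      (∃ a φ G, Good W k L t q a θ φ ψ ν (δ a) ∧ RegTop W k s θ φ ψ G ν (δ a)) ∨
      ∃ a φ, Good W k L t q a θ φ ψ ν (δ a) ∧
        i * ν₂ * (W.card : ℝ) ^ (k + 1) ≤ energy (W.powersetCard (k + 1)) s ψ φ θ := by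
    intro i
    induction i with
    | zero =>
      obtain ⟨t, n₀, μ, hμ, h⟩ := hb s L q hq ν hν δ hδ
      refine ⟨t, n₀, μ, hμ, fun V _ W θ ψ hW hθ hψ => Or.inr ?_⟩
      obtain ⟨a, φ, hφ⟩ := h V W θ ψ hW (hθ.mono (Nat.le_succ k) le_rfl)
        fun S hS h1 h2 => hψ S hS h1 (by omega)
      exact ⟨a, φ, hφ, by simpa using energy_nonneg _ _ _ _ _⟩
    | succ i ih =>
      obtain ⟨t, n₀, μ, hμ, h⟩ := ih
      obtain ⟨d, hd, hdδ⟩ := exists_pos_le_of_bounded k t hδ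
      set d₁ : ℝ := min (min (d / 4) (ν / 2)) 1 with hd₁
      have hd₁0 : 0 < d₁ := by positivity
      obtain ⟨R, hR⟩ := exists_fooling k s (show 0 < d / (4 * s) by positivity)
      obtain ⟨n₁, hn₁⟩ := exists_regular_modification k s hk hd₁0 (min_le_right _ _)
      obtain ⟨t', n₂, μ', hμ', hB⟩ := hb (s * (t + 1) * 2 ^ R) L q hq
        (min ν (ν₂ / (k * s))) (by positivity) δ hδ
      refine ⟨max t t', max n₀ (max n₁ n₂), min μ μ', lt_min hμ hμ',
        fun V _ W θ ψ hW hθ hψ => ?_⟩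
      have hmono : ∀ {t₀ a φ}, t₀ ≤ max t t' → Good W k L t₀ q a θ φ ψ ν (δ a) →
          Good W k L (max t t') q a θ φ ψ ν (δ a) := fun h1 h2 =>
        ⟨h2.toFam, fun j => (h2.bdd j).trans h1, h2.large, h2.appr⟩
      rcases h V W θ ψ ((le_max_left _ _).trans hW) (hθ.mono le_rfl (min_le_left _ _)) hψ with
        ⟨a, φ, G, h1, h2⟩ | ⟨a, φ, hφ, hE⟩
      · exact Or.inl ⟨a, φ, G, hmono (le_max_left _ _) h1, h2⟩
      obtain ⟨ψ', r, hr, hψ', hF⟩ := hR V W θ ψ fun T => ψ T + s * φ T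
      have hmem : ∀ S ∈ W.powersetCard (k + 1), ∀ T ⊂ S, T ⊆ W ∧ T.card ≤ k := by
        intro S hS T hT
        obtain ⟨h1, h2⟩ := mem_powersetCard.1 hS
        have := card_lt_card hT
        exact ⟨hT.1.trans h1, by omega⟩
      have hdec : ∀ T ⊆ W, ∀ T' ⊆ W, T.card = T'.card → 1 ≤ T.card → T.card ≤ k →
          ψ' T = ψ' T' → ψ T = ψ T' ∧ φ T = φ T' := by
        intro T hT T' hT' hc h0 h1 h2
        have h3 := hψ T hT h0 (by omega)
        have h4 := hψ T' hT' (by omega) (by omega)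
        have h5 : ψ T + s * φ T = ψ T' + s * φ T' := by rw [← hψ' T, ← hψ' T', h2]
        have h6 : ψ T = ψ T' := by
          have := congrArg (· % s) h5
          simpa [Nat.add_mul_mod_self_left, Nat.mod_eq_of_lt h3, Nat.mod_eq_of_lt h4] using this
        exact ⟨h6, Nat.eq_of_mul_eq_mul_left hs (by omega)⟩
      have href : ∀ S ∈ W.powersetCard (k + 1), ∀ S' ∈ W.powersetCard (k + 1),
          rel ψ' θ S S' → rel φ θ S S' := by
        refine fun S hS S' hS' h => ⟨h.1.mono fun T hT T' hT' hc he => ?_, h.2⟩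
        rcases Nat.eq_zero_or_pos T.card with h0 | h0
        · rw [h0] at hc
          rw [card_eq_zero.1 h0, card_eq_zero.1 hc.symm]
        · exact (hdec T (hmem S hS T hT).1 T' (hmem S' hS' T' hT').1 hc h0
            (hmem S hS T hT).2 he).2
      have hX : ∀ S ∈ W.powersetCard (k + 1), ψ S < s := fun S hS => by
        obtain ⟨h1, h2⟩ := mem_powersetCard.1 hS
        exact hψ S h1 (by omega) (by omega)
      by_cases hgap : energy (W.powersetCard (k + 1)) s ψ ψ' θ -
          energy (W.powersetCard (k + 1)) s ψ φ θ ≤ ν₁ * (W.card : ℝ) ^ (k + 1)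
      · left
        obtain ⟨G, hG1, hG2, hG3, hG4⟩ := hn₁ V W
          (((le_max_left _ _).trans (le_max_right _ _)).trans hW) ψ φ ψ' θ _ ν₁
          (by positivity) hX href hF hgap
        refine ⟨a, φ, G, hmono (le_max_left _ _) hφ, hG1, hG2.trans ?_, hG3, ?_⟩
        · refine mul_le_mul_of_nonneg_right ?_ (by positivity)
          have h1 : √(s * ν₁) = ν / 2 := by
            rw [show (s : ℝ) * ν₁ = (ν / 2) ^ 2 by rw [hν₁]; field_simp; ring,
              Real.sqrt_sq (by positivity)]
          have h2 : d₁ ≤ ν / 2 := (min_le_left _ _).trans (min_le_right _ _)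
          linarith
        · intro S₀ hS₀ Q c hc
          refine (hG4 S₀ hS₀ Q c hc).trans (mul_le_mul_of_nonneg_right ?_ (by positivity))
          have h1 : (s : ℝ) * (d / (4 * s)) = d / 4 := by field_simp
          have h2 : d₁ ≤ d / 4 := (min_le_left _ _).trans (min_le_left _ _)
          have h3 := hdδ a hφ.bdd fun j hj => hφ.zero j (Or.inr hj)
          linarith
      · right
        obtain ⟨a', φ', hφ'⟩ := hB V W θ ψ'
          (((le_max_right _ _).trans (le_max_right _ _)).trans hW)
          (hθ.mono (Nat.le_succ k) (min_le_right _ _)) fun S hS h0 h1 => by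
            have h2 : ψ S + s * φ S < s * (t + 1) := by
              have h3 := hψ S hS h0 (by omega)
              have h4 : φ S < t := (hφ.lt S hS h0 h1).trans_le (hφ.bdd _)
              nlinarith
            rw [← hψ' S, Nat.div_lt_iff_lt_mul (by positivity)] at h2
            exact h2.trans_le (Nat.mul_le_mul_left _ (Nat.pow_le_pow_right (by norm_num) hr))
        refine ⟨a', φ', hmono (le_max_right _ _) ⟨hφ'.toFam, hφ'.bdd, hφ'.large,
          fun j h1 h2 => (hφ'.appr j h1 h2).mono (min_le_left _ _) fun T hT T' hT' he => ?_⟩, ?_⟩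
        · obtain ⟨h3, h4⟩ := mem_powersetCard.1 hT
          obtain ⟨h5, h6⟩ := mem_powersetCard.1 hT'
          exact (hdec T h3 T' h5 (by omega) (by omega) (by omega) he).1
        · obtain ⟨B, hBX, hB1, hB2⟩ := exists_small_bad hφ'.appr
          have h1 : energy (W.powersetCard (k + 1)) s ψ ψ' θ ≤
              energy (W.powersetCard (k + 1)) s ψ φ' θ + s * B.card := by
            calc _ ≤ ∑ c ∈ range s, (en (W.powersetCard (k + 1)) (rel φ' θ) (col ψ c) + B.card) :=
                  sum_le_sum fun c _ => en_le_add_bad (rel_equivalence _ _) (rel_equivalence _ _)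
                    (fun S _ => col_nonneg ψ c S) (fun S _ => col_le_one ψ c S) hBX
                    fun S hS S' hS' h => ⟨hB2 S (by convert hS) S' (by convert hS') h.1, h.2⟩
              _ = _ := by rw [sum_add_distrib]; simp [energy]
          have h2 : (s : ℝ) * B.card ≤ ν₂ * (W.card : ℝ) ^ (k + 1) := by
            have h3 : (k : ℝ) * min ν (ν₂ / (k * s)) ≤ ν₂ / s := by
              calc _ ≤ (k : ℝ) * (ν₂ / (k * s)) :=
                    mul_le_mul_of_nonneg_left (min_le_right _ _) hk'.le
                _ = _ := by field_simp
            calc _ ≤ (s : ℝ) * (ν₂ / s * (W.card : ℝ) ^ (k + 1)) :=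
                  mul_le_mul_of_nonneg_left (hB1.trans
                    (mul_le_mul_of_nonneg_right h3 (by positivity))) hs'.le
              _ = _ := by field_simp
          have h3 : ν₁ = 2 * ν₂ := by rw [hν₂]; ring
          push Not at hgap
          rw [h3] at hgap
          push_cast
          linarith
  obtain ⟨i, hi⟩ := exists_nat_gt (s / ν₂ : ℝ)
  obtain ⟨t, n₀, μ, hμ, h⟩ := key i
  refine ⟨t, max n₀ 1, μ, hμ, fun V _ W θ ψ hW hθ hψ => ?_⟩
  rcases h V W θ ψ ((le_max_left _ _).trans hW) hθ hψ with h1 | ⟨a, φ, -, hE⟩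
  · exact h1
  exfalso
  have hW1 : (0 : ℝ) < (W.card : ℝ) ^ (k + 1) := by
    have : 0 < W.card := (le_max_right _ _).trans hW
    positivity
  have h1 := hE.trans ((energy_le _ s ψ φ θ).trans
    (mul_le_mul_of_nonneg_left (card_powersetCard_le W (k + 1)) (Nat.cast_nonneg s)))
  rw [div_lt_iff₀ hν₂0] at hi
  have := le_of_mul_le_mul_right h1 hW1
  linarith

end OuterLoop
end HypReg

namespace HypReg
section Splitting
open Finset
attribute [local instance 10] Classical.propDecidable

/-- A regular colouring can be split at random into `m` equitable pieces almost refining it. -/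
lemma exists_equitable_split (k s m : ℕ) (hk : 1 ≤ k) (hm : 1 ≤ m) {δ : ℝ} (hδ : 0 < δ)
    (hδ1 : δ ≤ 1) :
    ∃ n₀ : ℕ, ∀ (V : Type) [DecidableEq V] (W : Finset V), n₀ ≤ W.card →
      ∀ (θ φ G : Finset V → ℕ) (δ' : ℝ), (∀ S ∈ W.powersetCard (k + 1), G S < s) →
      (∀ S₀ ∈ W.powersetCard (k + 1), ∀ Q, ∀ c < s,
        |∑ S ∈ W.powersetCard (k + 1), tst W (k + 1) (fun S => rel φ θ S S₀) Q S *
          (col G c S - avg (W.powersetCard (k + 1)) (rel φ θ) (col G c) S)| ≤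
          δ' * (W.card : ℝ) ^ (k + 1)) →
      ∃ r : Finset V → ℕ, (∀ S ∈ W.powersetCard (k + 1), r S < m) ∧
        (∀ S₀ ∈ W.powersetCard (k + 1), ∀ Q, ∀ c < m,
          |∑ S ∈ W.powersetCard (k + 1), tst W (k + 1) (fun S => rel φ θ S S₀) Q S *
            (col r c S - 1 / m)| ≤ (δ + s * δ') * (W.card : ℝ) ^ (k + 1)) ∧
        ∃ B : Finset (Finset V), (B.card : ℝ) ≤ (s / m + δ) * (W.card : ℝ) ^ (k + 1) ∧
          ∀ S ∈ W.powersetCard (k + 1), S ∉ B → ∀ S' ∈ W.powersetCard (k + 1), S' ∉ B →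
            rel φ θ S S' → r S = r S' → G S = G S' := by
  have hsp : ∀ l : ℕ → ℝ, ∃ p : (ℕ → ℕ → ℝ) × (ℕ → ℕ),
      ((∀ c < s, 0 ≤ l c) ∧ ∑ c ∈ range s, l c = 1) →
      (∀ c < s, ∀ r < m, 0 ≤ p.1 c r) ∧ (∀ c < s, ∑ r ∈ range m, p.1 c r = 1) ∧
      (∀ r < m, ∑ c ∈ range s, l c * p.1 c r = 1 / m) ∧
      ∑ c ∈ range s, l c * ∑ r ∈ (range m).filter (fun r => p.2 r ≠ c), p.1 c r ≤ s / m := by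
    intro l
    by_cases h : (∀ c < s, 0 ≤ l c) ∧ ∑ c ∈ range s, l c = 1
    · obtain ⟨w, F, h1⟩ := exists_split s m hm l h.1 h.2
      exact ⟨(w, F), fun _ => h1⟩
    · exact ⟨(0, 0), fun h' => absurd h' h⟩
  choose p hp using hsp
  obtain ⟨n₀, hn₀⟩ := exists_random_coloring k m hk hδ hδ1
  refine ⟨n₀, fun V _ W hW θ φ G δ' hG hreg => ?_⟩
  set X := W.powersetCard (k + 1) with hX
  set n := (W.card : ℝ) ^ (k + 1) with hn
  have hXn : (X.card : ℝ) ≤ n := card_powersetCard_le W (k + 1)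
  have he := rel_equivalence φ θ
  set l : Finset V → ℕ → ℝ := fun S c => avg X (rel φ θ) (col G c) S with hl
  have hlc : ∀ S S', rel φ θ S S' → l S = l S' := fun S S' h => by
    funext c; exact avg_congr he h
  have hpS : ∀ S ∈ X, _ := fun S hS => hp (l S) ⟨fun c _ => avg_nonneg
    (fun x _ => col_nonneg G c x) S, by
      rw [avg_sum, ← avg_const_one he hS]
      unfold avg
      congr 1
      exact sum_congr rfl fun y hy => sum_col (hG y (mem_filter.1 hy).1)⟩
  have hw1 : ∀ S ∈ X, ∀ c < s, ∀ r < m, (p (l S)).1 c r ≤ 1 := fun S hS c hc r hr => by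
    rw [← (hpS S hS).2.1 c hc]
    exact single_le_sum (f := fun r => (p (l S)).1 c r)
      (fun r hr => (hpS S hS).1 c hc r (mem_range.1 hr)) (mem_range.2 hr)
  obtain ⟨r, hr, hrt, hr0⟩ := hn₀ V W hW (Finset V) X (fun S₀ S => rel φ θ S S₀)
    (by
      rw [hX, card_powersetCard]
      exact (Nat.choose_le_pow _ _).trans (Nat.le_mul_of_pos_right _ (by positivity)))
    (fun S c => (p (l S)).1 (G S) c) (fun S c => if (p (l S)).2 c ≠ G S then 1 else 0)
    (fun S hS c hc => (hpS S hS).1 _ (hG S hS) c hc)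
    (fun S hS => (hpS S hS).2.1 _ (hG S hS))
    (fun S _ c _ => by split_ifs <;> simp)
  refine ⟨r, fun S hS => (hr S hS).1, ?_, X.filter fun S => (p (l S)).2 (r S) ≠ G S, ?_, ?_⟩
  · intro S₀ hS₀ Q ρ hρ
    have e2 : ∀ S ∈ X, tst W (k + 1) (fun S => rel φ θ S S₀) Q S * (col r ρ S - 1 / m) =
        tst W (k + 1) (fun S => rel φ θ S S₀) Q S * (col r ρ S - (p (l S)).1 (G S) ρ) +
        ∑ c ∈ range s, (p (l S₀)).1 c ρ * (tst W (k + 1) (fun S => rel φ θ S S₀) Q S *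
          (col G c S - l S c)) := by
      intro S hS
      by_cases hrel : rel φ θ S S₀
      · have f1 : ∑ c ∈ range s, (p (l S)).1 c ρ * col G c S = (p (l S)).1 (G S) ρ := by
          simp [col, hG S hS]
        have f2 : ∑ c ∈ range s, (p (l S)).1 c ρ * l S c = 1 / m := by
          rw [← (hpS S hS).2.2.1 ρ hρ]
          exact sum_congr rfl fun c _ => mul_comm _ _
        have f3 : ∑ c ∈ range s, (p (l S₀)).1 c ρ *
            (tst W (k + 1) (fun S => rel φ θ S S₀) Q S * (col G c S - l S c)) =
            tst W (k + 1) (fun S => rel φ θ S S₀) Q S * ((p (l S)).1 (G S) ρ - 1 / m) := by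
          rw [← f1, ← f2, ← sum_sub_distrib, mul_sum, hlc S S₀ hrel]
          exact sum_congr rfl fun c _ => by ring
        rw [f3]; ring
      · simp [tst, hrel]
    rw [sum_congr rfl e2, sum_add_distrib, sum_comm (s := X), add_mul]
    refine (abs_add_le _ _).trans (add_le_add (hrt S₀ hS₀ Q ρ hρ) ?_)
    refine (abs_sum_le_sum_abs _ _).trans ?_
    calc _ ≤ ∑ c ∈ range s, δ' * n := sum_le_sum fun c hc => by
          have hc := mem_range.1 hc
          rw [← mul_sum, abs_mul, abs_of_nonneg ((hpS S₀ hS₀).1 c hc ρ hρ)]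
          exact (mul_le_of_le_one_left (abs_nonneg _) (hw1 S₀ hS₀ c hc ρ hρ)).trans
            (hreg S₀ hS₀ Q c hc)
      _ = s * δ' * n := by simp [mul_assoc]
  · have h1 : (((X.filter fun S => (p (l S)).2 (r S) ≠ G S).card : ℕ) : ℝ) =
        ∑ S ∈ X, if (p (l S)).2 (r S) ≠ G S then (1 : ℝ) else 0 := by
      rw [card_filter]; push_cast; rfl
    have h2 : ∀ S ∈ X, ∑ c ∈ range m, (p (l S)).1 (G S) c *
        (if (p (l S)).2 c ≠ G S then (1 : ℝ) else 0) =
        ∑ c ∈ range s, (∑ ρ ∈ (range m).filter (fun ρ => (p (l S)).2 ρ ≠ c), (p (l S)).1 c ρ) *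
          col G c S := by
      intro S hS
      simp only [col, mul_ite, mul_one, mul_zero]
      rw [sum_ite_eq, if_pos (mem_range.2 (hG S hS)), sum_filter]
    have h3 : ∑ S ∈ X, ∑ c ∈ range s, (∑ ρ ∈ (range m).filter (fun ρ => (p (l S)).2 ρ ≠ c),
        (p (l S)).1 c ρ) * col G c S ≤ ∑ S ∈ X, (s / m : ℝ) := by
      rw [sum_comm]
      have : ∀ c ∈ range s, ∑ S ∈ X, (∑ ρ ∈ (range m).filter (fun ρ => (p (l S)).2 ρ ≠ c),
          (p (l S)).1 c ρ) * col G c S = ∑ S ∈ X, l S c *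
            ∑ ρ ∈ (range m).filter (fun ρ => (p (l S)).2 ρ ≠ c), (p (l S)).1 c ρ := by
        intro c _
        rw [← sum_mul_avg he fun S _ S' _ h => by rw [hlc S S' h]]
        exact sum_congr rfl fun S _ => mul_comm _ _
      rw [sum_congr rfl this, sum_comm]
      exact sum_le_sum fun S hS => (hpS S hS).2.2.2
    rw [sum_sub_distrib, sum_congr rfl h2] at hr0
    have h4 := (abs_le.1 hr0).2
    have h5 : ∑ S ∈ X, (s / m : ℝ) ≤ s / m * n := by
      rw [sum_const, nsmul_eq_mul, mul_comm]
      exact mul_le_mul_of_nonneg_left hXn (by positivity)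
    rw [h1, add_mul]
    linarith
  · intro S hS hSB S' hS' hSB' hrel hrr
    have h1 : (p (l S)).2 (r S) = G S := by
      by_contra h; exact hSB (mem_filter.2 ⟨hS, h⟩)
    have h2 : (p (l S')).2 (r S') = G S' := by
      by_contra h; exact hSB' (mem_filter.2 ⟨hS', h⟩)
    rw [← h1, ← h2, hlc S S' hrel, hrr]

end Splitting
end HypReg

namespace HypReg
section Induction
open Finset
attribute [local instance 10] Classical.propDecidable

lemma pIso_congr {V : Type*} [DecidableEq V] {φ φ' : Finset V → ℕ} {k : ℕ}
    (h : ∀ T, T.card ≤ k → φ T = φ' T) {S S' : Finset V} (hS : S.card ≤ k + 1) :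
    pIso φ S S' ↔ pIso φ' S S' := by
  constructor <;> intro hp <;> have hc := hp.card_eq <;>
    refine hp.mono fun T hT T' hT' _ he => ?_ <;>
    have h1 := card_lt_card hT <;> have h2 := card_lt_card hT'
  · rw [← h T (by omega), ← h T' (by omega), he]
  · rw [h T (by omega), h T' (by omega), he]

lemma LU.congr {V : Type*} [DecidableEq V] {W : Finset V} {j k : ℕ} {φ φ' : Finset V → ℕ}
    {F F' : Finset V → ℝ} {δ : ℝ} (h : LU W j φ F δ) (hk : 1 ≤ k) (hj : j ≤ k + 1)
    (hφ : ∀ T, T.card ≤ k → φ T = φ' T) (hF : ∀ S ∈ W.powersetCard j, F S = F' S) :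
    LU W j φ' F' δ := by
  intro S₀ hS₀ hc Q
  have hc' : Cross φ S₀ := fun u hu v hv he => hc hu hv (by
    dsimp only at he ⊢
    rwa [← hφ {u} (by simpa using hk), ← hφ {v} (by simpa using hk)])
  have he : ∑ S ∈ W.powersetCard j, tst W j (fun S => pIso φ S S₀) Q S * F S =
      ∑ S ∈ W.powersetCard j, tst W j (fun S => pIso φ' S S₀) Q S * F' S := by
    refine sum_congr rfl fun S hS => ?_
    rw [hF S hS, tst, tst,
      if_congr (pIso_congr hφ ((mem_powersetCard.1 hS).2.trans_le hj)) rfl rfl]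
  rw [← he]
  exact h S₀ hS₀ hc' Q

lemma LU.of_split {V : Type*} [DecidableEq V] {W : Finset V} {k q m : ℕ}
    {θ φ φ' r : Finset V → ℕ} {δ μ : ℝ} (hq : 0 < q) (hm : 0 < m)
    (hmod : ∀ S ∈ W.powersetCard (k + 1), φ' S % q = θ S)
    (hdiv : ∀ S ∈ W.powersetCard (k + 1), φ' S / q = r S)
    (hr : ∀ S₀ ∈ W.powersetCard (k + 1), ∀ Q, ∀ c < m,
      |∑ S ∈ W.powersetCard (k + 1), tst W (k + 1) (fun S => rel φ θ S S₀) Q S *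
        (col r c S - 1 / m)| ≤ δ * (W.card : ℝ) ^ (k + 1))
    (hθ : ∀ β < q, LU W (k + 1) φ (fun S => col θ β S - 1 / q) μ) {b : ℕ} (hb : b < q * m) :
    LU W (k + 1) φ (fun S => col φ' b S - 1 / ((q * m : ℕ) : ℝ)) (max δ 0 + max μ 0) := by
  intro S₀ hS₀ hc Q
  have hq' : (0 : ℝ) < q := by exact_mod_cast hq
  have hm' : (0 : ℝ) < m := by exact_mod_cast hm
  have hβ : b % q < q := Nat.mod_lt _ hq
  have hρ : b / q < m := Nat.div_lt_of_lt_mul hb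
  have hcol : ∀ S ∈ W.powersetCard (k + 1), col φ' b S = col θ (b % q) S * col r (b / q) S := by
    intro S hS
    have : φ' S = b ↔ θ S = b % q ∧ r S = b / q := by
      rw [← hmod S hS, ← hdiv S hS]
      refine ⟨fun h => by rw [h]; simp, fun h => ?_⟩
      rw [← Nat.mod_add_div (φ' S) q, h.1, h.2, Nat.mod_add_div]
    by_cases h1 : θ S = b % q <;> by_cases h2 : r S = b / q <;> simp [col, this, h1, h2]
  set t₁ : Finset V → ℝ := fun S => tst W (k + 1) (fun S => pIso φ S S₀) Q S with ht₁
  have e1 : ∀ S ∈ W.powersetCard (k + 1),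
      t₁ S * (col φ' b S - 1 / ((q * m : ℕ) : ℝ)) =
      t₁ S * col θ (b % q) S * (col r (b / q) S - 1 / m) +
      (1 / m : ℝ) * (t₁ S * (col θ (b % q) S - 1 / q)) := by
    intro S hS
    rw [hcol S hS]; push_cast; field_simp; ring
  have h1 : |∑ S ∈ W.powersetCard (k + 1),
      t₁ S * col θ (b % q) S * (col r (b / q) S - 1 / m)| ≤
      max δ 0 * (W.card : ℝ) ^ (k + 1) := by
    by_cases hex : ∃ S₁ ∈ W.powersetCard (k + 1), pIso φ S₁ S₀ ∧ θ S₁ = b % q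
    · obtain ⟨S₁, hS₁, hp, hb1⟩ := hex
      have h2 := hr S₁ hS₁ Q _ hρ
      have h3 : ∀ S, tst W (k + 1) (fun S => rel φ θ S S₁) Q S = t₁ S * col θ (b % q) S := by
        intro S
        have : rel φ θ S S₁ ↔ pIso φ S S₀ ∧ θ S = b % q := by
          rw [← hb1]
          exact ⟨fun h => ⟨h.1.trans hp, h.2⟩, fun h => ⟨h.1.trans hp.symm, h.2⟩⟩
        by_cases h4 : pIso φ S S₀ <;> by_cases h5 : θ S = b % q <;>
          simp [ht₁, tst, col, this, h4, h5]
      simp only [h3] at h2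
      exact h2.trans (mul_le_mul_of_nonneg_right (le_max_left _ _) (by positivity))
    · rw [sum_eq_zero, abs_zero]
      · positivity
      · intro S hS
        push Not at hex
        by_cases hp : pIso φ S S₀
        · simp [col, hex S hS hp]
        · simp [ht₁, tst, hp]
  have h2 : |∑ S ∈ W.powersetCard (k + 1),
      (1 / m : ℝ) * (t₁ S * (col θ (b % q) S - 1 / q))| ≤
      max μ 0 * (W.card : ℝ) ^ (k + 1) := by
    have h3 := hθ _ hβ S₀ hS₀ hc Q
    rw [← mul_sum, abs_mul, abs_of_pos (by positivity)]
    refine (mul_le_of_le_one_left (abs_nonneg _) ?_).trans (h3.trans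
      (mul_le_mul_of_nonneg_right (le_max_left _ _) (by positivity)))
    rw [div_le_one hm']; exact_mod_cast hm
  rw [sum_congr rfl e1, sum_add_distrib, add_mul]
  exact (abs_add_le _ _).trans (add_le_add h1 h2)

lemma build_succ_of_regz {k : ℕ} (hk : 1 ≤ k) (hr : Regz k) : Build (k + 1) := by
  intro s L q hq ν hν δ hδ
  obtain ⟨m, hm⟩ := exists_nat_gt (4 * s / ν : ℝ)
  have hm0 : (0 : ℝ) < m := lt_of_le_of_lt (by positivity) hm
  have hm1 : 1 ≤ m := by exact_mod_cast hm0
  have hsm : (s : ℝ) / m ≤ ν / 4 := by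
    rw [div_lt_iff₀ hν] at hm
    rw [div_le_iff₀ hm0]; linarith
  have hqk := hq (k + 1)
  have hqk' : (0 : ℝ) < q (k + 1) := by exact_mod_cast hqk
  let ext : (ℕ → ℕ) → ℕ → ℕ := fun a j => if j = k + 1 then q (k + 1) * m else a j
  obtain ⟨t, n₀, μ, hμ, h⟩ := hr s L q hq (ν / 2) (by positivity)
    (fun a => δ (ext a) / (3 * (s + 1))) (fun a => by have := hδ (ext a); positivity)
  obtain ⟨d, hd, hdδ⟩ := exists_pos_le_of_bounded (k + 1) (max t (q (k + 1) * m)) hδ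
  have hd₁0 : 0 < min (min (d / 3) (ν / 4)) 1 := by positivity
  obtain ⟨n₁, hn₁⟩ := exists_equitable_split k s m hk hm1 hd₁0 (min_le_right _ _)
  refine ⟨max t (q (k + 1) * m), max n₀ n₁, min μ (d / 3), by positivity,
    fun V _ W θ ψ hW hθ hψ => ?_⟩
  obtain ⟨a, φ, G, hφ, hG⟩ := h V W θ ψ ((le_max_left _ _).trans hW)
    (hθ.mono le_rfl (min_le_left _ _)) hψ
  obtain ⟨r, hrm, hrt, B, hB, hBB⟩ := hn₁ V W ((le_max_right _ _).trans hW) θ φ G _ hG.lt hG.reg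
  set φ' : Finset V → ℕ := fun S => if S.card = k + 1 then θ S + q (k + 1) * r S else φ S with hφ'
  have hlow : ∀ T, T.card ≤ k → φ T = φ' T := fun T hT => by
    simp only [hφ']; rw [if_neg (by omega)]
  have htop : ∀ T, T.card = k + 1 → φ' T = θ T + q (k + 1) * r T := fun T hT => by
    simp only [hφ']; rw [if_pos hT]
  have hal : ∀ j, j ≤ k → ext a j = a j := fun j hj => if_neg (by omega)
  have hatop : ext a (k + 1) = q (k + 1) * m := if_pos rfl
  have hbdd : ∀ j, ext a j ≤ max t (q (k + 1) * m) := by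
    intro j
    simp only [ext]
    split_ifs
    · exact le_max_right _ _
    · exact (hφ.bdd j).trans (le_max_left _ _)
  have hzero : ∀ j, (j = 0 ∨ k + 1 < j) → ext a j = 0 := by
    intro j hj
    simp only [ext]
    rw [if_neg (by omega)]
    exact hφ.zero j (by omega)
  have hdd : d ≤ δ (ext a) := hdδ _ hbdd fun j hj => hzero j (Or.inr hj)
  have hX : ∀ S ∈ W.powersetCard (k + 1), S ⊆ W ∧ S.card = k + 1 := fun S hS =>
    mem_powersetCard.1 hS
  have hθlt : ∀ S ∈ W.powersetCard (k + 1), θ S < q (k + 1) := fun S hS => by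
    have := hθ.lt S (hX S hS).1 (by rw [(hX S hS).2]; omega) (hX S hS).2.le
    rwa [(hX S hS).2] at this
  have hmod : ∀ S ∈ W.powersetCard (k + 1), φ' S % q (k + 1) = θ S := fun S hS => by
    rw [htop S (hX S hS).2, Nat.add_mul_mod_self_left, Nat.mod_eq_of_lt (hθlt S hS)]
  have hdivr : ∀ S ∈ W.powersetCard (k + 1), φ' S / q (k + 1) = r S := fun S hS => by
    rw [htop S (hX S hS).2, Nat.add_mul_div_left _ _ hqk, Nat.div_eq_of_lt (hθlt S hS), zero_add]
  refine ⟨ext a, φ', ⟨⟨?_, ?_, ?_, ?_, hzero, ?_, ?_⟩, hbdd, ?_, ?_⟩⟩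
  · intro S hS h1 h2
    rcases h2.lt_or_eq with h3 | h3
    · rw [← hlow S (by omega), hal _ (by omega)]
      exact hφ.lt S hS h1 (by omega)
    · rw [htop S h3, h3, hatop]
      have hSX := mem_powersetCard.2 ⟨hS, h3⟩
      have h4 := hθlt S hSX
      have h5 := hrm S hSX
      nlinarith
  · intro S hS h1 h2
    rcases h2.lt_or_eq with h3 | h3
    · rw [← hlow S (by omega)]
      exact hφ.mod S hS h1 (by omega)
    · rw [h3]
      exact hmod S (mem_powersetCard.2 ⟨hS, h3⟩)
  · intro j h1 h2
    rcases h2.lt_or_eq with h3 | rfl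
    · rw [hal _ (by omega)]; exact hφ.dvd j h1 (by omega)
    · rw [hatop]; exact Dvd.intro _ rfl
  · intro j h1 h2
    rcases h2.lt_or_eq with h3 | rfl
    · rw [hal _ (by omega)]; exact hφ.pos j h1 (by omega)
    · rw [hatop]; positivity
  · intro i hi
    rw [hal 1 hk] at hi ⊢
    have := hφ.size i hi
    simpa only [← hlow {_} (by simpa using hk)] using this
  · intro j h1 h2 b hb
    rcases h2.lt_or_eq with h3 | rfl
    · rw [hal _ (by omega)] at hb ⊢
      refine ((hφ.unif j h1 (by omega) b hb).mono ?_).congr hk (by omega) hlow ?_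
      · exact div_le_self (hδ _).le (by have : (0 : ℝ) ≤ s := Nat.cast_nonneg s; linarith)
      · intro S hS
        have := (mem_powersetCard.1 hS).2
        simp only [col, hlow S (by omega)]
    · rw [hatop] at hb ⊢
      have hLU := LU.of_split (φ := φ) (φ' := φ') hqk (hm1.trans_lt' one_pos) hmod hdivr hrt
        (fun β hβ => hθ.unif (k + 1) h1 le_rfl φ (fun T hT T' hT' hc hl he =>
            hφ.eq_of_eq hT hT' hc (by omega) he) β hβ) hb
      refine (hLU.mono ?_).congr hk le_rfl hlow fun S _ => rfl
      have h4 : min (min (d / 3) (ν / 4)) 1 ≤ d / 3 :=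
        (min_le_left _ _).trans (min_le_left _ _)
      have h5 : (s : ℝ) * (δ (ext a) / (3 * (s + 1))) ≤ δ (ext a) / 3 := by
        rw [mul_div_assoc', div_le_div_iff₀ (by positivity) (by positivity)]
        have := hδ (ext a)
        nlinarith
      have h6 := min_le_right μ (d / 3)
      have h7 : 0 ≤ min (min (d / 3) (ν / 4)) 1 + s * (δ (ext a) / (3 * (s + 1))) := by
        have := hδ (ext a)
        positivity
      rw [max_eq_left h7, max_eq_left (by positivity)]
      linarith
  · rw [hal 1 hk]; exact hφ.large
  · intro j h1 h2
    rcases h2.lt_or_eq with h3 | rfl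
    · obtain ⟨B, hB, h4⟩ := hφ.appr j h1 (by omega)
      refine ⟨B, hB.trans (mul_le_mul_of_nonneg_right (by linarith) (by positivity)),
        fun T hT hTB T' hT' hTB' hf => h4 T hT hTB T' hT' hTB' ?_⟩
      have h5 := (mem_powersetCard.1 hT).2
      have h6 := (mem_powersetCard.1 hT').2
      exact ⟨(pIso_congr hlow (by omega)).2 hf.1, by
        rw [hlow T (by omega), hlow T' (by omega), hf.2]⟩
    · refine ⟨((W.powersetCard (k + 1)).filter fun S => G S ≠ ψ S) ∪ B, ?_, ?_⟩
      · refine (Nat.cast_le.2 (card_union_le _ _)).trans ?_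
        push_cast
        refine (add_le_add hG.close hB).trans ?_
        rw [← add_mul]
        refine mul_le_mul_of_nonneg_right ?_ (by positivity)
        have : min (min (d / 3) (ν / 4)) 1 ≤ ν / 4 := (min_le_left _ _).trans (min_le_right _ _)
        linarith
      · intro T hT hTB T' hT' hTB' hf
        rw [mem_union, not_or, mem_filter] at hTB hTB'
        have h3 : G T = ψ T := by by_contra h; exact hTB.1 ⟨hT, h⟩
        have h4 : G T' = ψ T' := by by_contra h; exact hTB'.1 ⟨hT', h⟩
        rw [← h3, ← h4]
        refine hBB T hT hTB.2 T' hT' hTB'.2 ⟨?_, ?_⟩ ?_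
        · exact (pIso_congr hlow (hX T hT).2.le).2 hf.1
        · rw [← hmod T hT, ← hmod T' hT', hf.2]
        · rw [← hdivr T hT, ← hdivr T' hT', hf.2]

end Induction
end HypReg

namespace HypReg
section Base
open Finset
attribute [local instance 10] Classical.propDecidable

/-- A coloured set can be cut into pieces of given sizes, most of them monochromatic. -/
lemma exists_chop {α : Type*} (s Z : ℕ) (ψ : α → ℕ) (z : ℕ → ℕ) (m : ℕ) :
    ∀ C : Finset α, C.card = ∑ r ∈ range m, z r → (∀ r < m, z r ≤ Z) → (∀ v ∈ C, ψ v < s) →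
      ∃ r : α → ℕ, (∀ v ∈ C, r v < m) ∧ (∀ ρ < m, (C.filter fun v => r v = ρ).card = z ρ) ∧
        ∃ B : Finset α, B.card ≤ s * Z ∧
          ∀ u ∈ C, u ∉ B → ∀ v ∈ C, v ∉ B → r u = r v → ψ u = ψ v := by
  induction m with
  | zero =>
    intro C hC _ _
    rw [range_zero, sum_empty, card_eq_zero] at hC
    subst hC
    exact ⟨0, by simp, by simp, ∅, by simp, by simp⟩
  | succ m ih =>
    intro C hC hz hψ
    rw [sum_range_succ] at hC
    have main : ∀ D ⊆ C, D.card = z m → ∃ r : α → ℕ, (∀ v ∈ C, r v < m + 1) ∧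
        (∀ ρ < m + 1, (C.filter fun v => r v = ρ).card = z ρ) ∧
        ∃ B : Finset α, B.card ≤ s * Z ∧ ((∀ u ∈ D, ∀ v ∈ D, ψ u = ψ v) →
          ∀ u ∈ C, u ∉ B → ∀ v ∈ C, v ∉ B → r u = r v → ψ u = ψ v) := by
      intro D hD hDz
      obtain ⟨r, h1, h2, B, hB, h3⟩ := ih (C \ D)
        (by rw [card_sdiff_of_subset hD, hC, hDz, Nat.add_sub_cancel])
        (fun r hr => hz r (by omega)) fun v hv => hψ v (mem_sdiff.1 hv).1
      refine ⟨fun v => if v ∈ D then m else r v, ?_, ?_, B, hB, ?_⟩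
      · intro v hv
        dsimp only
        split_ifs with h
        · omega
        · exact (h1 v (mem_sdiff.2 ⟨hv, h⟩)).trans (Nat.lt_succ_self m)
      · intro ρ hρ
        rcases (Nat.lt_succ_iff.1 hρ).lt_or_eq with h | rfl
        · rw [← h2 ρ h]
          congr 1
          ext v
          simp only [mem_filter, mem_sdiff]
          by_cases hv : v ∈ D
          · simp [hv, h.ne']
          · simp [hv]
        · rw [← hDz]
          congr 1
          ext v
          simp only [mem_filter]
          by_cases hv : v ∈ D
          · simp [hv, hD hv]
          · simp only [hv, if_false, iff_false, not_and]
            exact fun hvC => (h1 v (mem_sdiff.2 ⟨hvC, hv⟩)).ne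
      · intro hmono u hu huB v hv hvB he
        dsimp only at he
        by_cases hu' : u ∈ D <;> by_cases hv' : v ∈ D
        · exact hmono u hu' v hv'
        · rw [if_pos hu', if_neg hv'] at he
          exact absurd he.symm (h1 v (mem_sdiff.2 ⟨hv, hv'⟩)).ne
        · rw [if_neg hu', if_pos hv'] at he
          exact absurd he (h1 u (mem_sdiff.2 ⟨hu, hu'⟩)).ne
        · rw [if_neg hu', if_neg hv'] at he
          exact h3 u (mem_sdiff.2 ⟨hu, hu'⟩) huB v (mem_sdiff.2 ⟨hv, hv'⟩) hvB he
    by_cases hex : ∃ c < s, z m ≤ (C.filter fun v => ψ v = c).card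
    · obtain ⟨c, -, hc⟩ := hex
      obtain ⟨D, hD, hDz⟩ := exists_subset_card_eq hc
      obtain ⟨r, h1, h2, B, hB, h3⟩ := main D (hD.trans (filter_subset _ _)) hDz
      refine ⟨r, h1, h2, B, hB, h3 fun u hu v hv => ?_⟩
      rw [(mem_filter.1 (hD hu)).2, (mem_filter.1 (hD hv)).2]
    · obtain ⟨D, hD, hDz⟩ := exists_subset_card_eq (show z m ≤ C.card by omega)
      obtain ⟨r, h1, h2, -⟩ := main D hD hDz
      refine ⟨r, h1, h2, C, ?_, fun u hu huC => absurd hu huC⟩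
      push Not at hex
      rw [card_eq_sum_card_fiberwise (f := ψ) (t := range s) fun v hv =>
        mem_coe.2 (mem_range.2 (hψ v hv))]
      calc _ ≤ ∑ c ∈ range s, Z := sum_le_sum fun c hc =>
            (hex c (mem_range.1 hc)).le.trans (hz m (by omega))
        _ = _ := by simp

lemma card_filter_powersetCard_one {V : Type*} [DecidableEq V] (W : Finset V)
    (p : Finset V → Prop) :
    ((W.powersetCard 1).filter p).card = (W.filter fun v => p {v}).card := by
  rw [powersetCard_one, filter_map, card_map]
  rfl

lemma build_one : Build 1 := by
  intro s L q hq ν hν δ hδ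
  obtain ⟨m, hm⟩ := exists_nat_gt (max (2 * s / ν) (L + 1) : ℝ)
  have hm1 : (2 * s / ν : ℝ) < m := (le_max_left _ _).trans_lt hm
  have hm2 : (L + 1 : ℝ) < m := (le_max_right _ _).trans_lt hm
  have hLm : L + 1 ≤ m := by exact_mod_cast hm2.le
  have hm0 : 0 < m := by omega
  have hq1 := hq 1
  have hq1' : (0 : ℝ) < q 1 := by exact_mod_cast hq1
  have hm0' : (0 : ℝ) < m := by exact_mod_cast hm0
  obtain ⟨n₀, hn₀⟩ := exists_nat_gt (2 * (q 1 * s) / ν : ℝ)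
  refine ⟨q 1 * m, n₀, 1, one_pos, fun V _ W θ ψ hW hθ hψ => ?_⟩
  set n := W.card with hn
  set z := n / (q 1 * m) with hz
  set C : ℕ → Finset (Finset V) := fun i => (W.powersetCard 1).filter fun S => θ S = i with hC
  have hCcard : ∀ i < q 1, (C i).card = n / q 1 ∨ (C i).card = n / q 1 + 1 := fun i hi => by
    have := hθ.size i hi
    rw [show (C i).card = _ from (by convert card_filter_powersetCard_one W (fun S => θ S = i))]
    convert this
  have hzm : z = n / q 1 / m := by rw [hz, Nat.div_div_eq_div_mul]
  have hz1 : m * z ≤ n / q 1 := by rw [hzm]; exact Nat.mul_div_le _ _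
  have hz2 : n / q 1 + 1 ≤ m * z + m := by
    rw [hzm]
    have := Nat.lt_mul_div_succ (n / q 1) hm0
    rw [Nat.mul_add] at this
    omega
  have hchop : ∀ i, ∃ r : Finset V → ℕ, i < q 1 → (∀ S ∈ C i, r S < m) ∧
      (∀ ρ < m, ((C i).filter fun S => r S = ρ).card = z ∨
        ((C i).filter fun S => r S = ρ).card = z + 1) ∧
      ∃ B : Finset (Finset V), B.card ≤ s * (z + 1) ∧
        ∀ u ∈ C i, u ∉ B → ∀ v ∈ C i, v ∉ B → r u = r v → ψ u = ψ v := by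
    intro i
    by_cases hi : i < q 1
    swap
    · exact ⟨0, fun h => absurd h hi⟩
    obtain ⟨r, h1, h2, h3⟩ := exists_chop s (z + 1) ψ
      (fun r => if r < (C i).card - m * z then z + 1 else z) m (C i) (by
        have hle : (C i).card - m * z ≤ m := by rcases hCcard i hi with h | h <;> omega
        have hle' : m * z ≤ (C i).card := by rcases hCcard i hi with h | h <;> omega
        have e1 : ∀ r ∈ range m, (if r < (C i).card - m * z then z + 1 else z) =
            z + if r < (C i).card - m * z then 1 else 0 := fun r _ => by split_ifs <;> rfl
        rw [sum_congr rfl e1, sum_add_distrib, ← card_filter]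
        have e2 : (range m).filter (fun r => r < (C i).card - m * z) =
            range ((C i).card - m * z) := by
          ext r; simp only [mem_filter, mem_range]; omega
        rw [e2, card_range, sum_const, card_range, smul_eq_mul]
        omega)
      (fun r _ => by split_ifs <;> omega)
      (fun S hS => by
        obtain ⟨h4, h5⟩ := mem_powersetCard.1 (mem_filter.1 hS).1
        exact hψ S h4 h5.ge h5.le)
    refine ⟨r, fun _ => ⟨h1, fun ρ hρ => ?_, h3⟩⟩
    rw [h2 ρ hρ]
    split_ifs
    · exact Or.inr rfl
    · exact Or.inl rfl
  choose r hr using hchop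
  have hW1 : ∀ S ∈ W.powersetCard 1, θ S < q 1 ∧ S ∈ C (θ S) := fun S hS => by
    obtain ⟨h4, h5⟩ := mem_powersetCard.1 hS
    exact ⟨by simpa [h5] using hθ.lt S h4 h5.ge h5.le, mem_filter.2 ⟨hS, rfl⟩⟩
  have hmem : ∀ S ⊆ W, 1 ≤ S.card → S.card ≤ 1 → S ∈ W.powersetCard 1 ∧ S.card = 1 :=
    fun S hS h1 h2 => ⟨mem_powersetCard.2 ⟨hS, by omega⟩, by omega⟩
  set φ : Finset V → ℕ := fun S => θ S + q 1 * r (θ S) S with hφ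
  have hmod : ∀ S ∈ W.powersetCard 1, φ S % q 1 = θ S := fun S hS => by
    rw [hφ, Nat.add_mul_mod_self_left, Nat.mod_eq_of_lt (hW1 S hS).1]
  have hdiv : ∀ S ∈ W.powersetCard 1, φ S / q 1 = r (θ S) S := fun S hS => by
    rw [hφ, Nat.add_mul_div_left _ _ hq1, Nat.div_eq_of_lt (hW1 S hS).1, zero_add]
  have ha1 : (if (1 : ℕ) = 1 then q 1 * m else 0) = q 1 * m := if_pos rfl
  refine ⟨fun j => if j = 1 then q 1 * m else 0, φ, ⟨⟨?_, ?_, ?_, ?_, ?_, ?_, ?_⟩, ?_, ?_, ?_⟩⟩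
  · intro S hS h1 h2
    obtain ⟨h3, h4⟩ := hmem S hS h1 h2
    rw [if_pos h4]
    have h5 := (hW1 S h3).1
    have h6 := (hr _ h5).1 S (hW1 S h3).2
    simp only [hφ]
    nlinarith
  · intro S hS h1 h2
    obtain ⟨h3, h4⟩ := hmem S hS h1 h2
    rw [h4]; exact hmod S h3
  · intro j h1 h2
    obtain rfl : j = 1 := by omega
    rw [ha1]; exact Dvd.intro _ rfl
  · intro j h1 h2
    obtain rfl : j = 1 := by omega
    rw [ha1]; positivity
  · intro j hj
    exact if_neg (by omega)
  · intro i hi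
    rw [ha1] at hi ⊢
    have hβ : i % q 1 < q 1 := Nat.mod_lt _ hq1
    have h1 := (hr _ hβ).2.1 (i / q 1) (Nat.div_lt_of_lt_mul hi)
    have h2 : ((C (i % q 1)).filter fun S => r (i % q 1) S = i / q 1) =
        (W.powersetCard 1).filter fun S => φ S = i := by
      ext S
      simp only [hC, mem_filter, and_assoc]
      refine and_congr_right fun hS => ?_
      constructor
      · rintro ⟨h3, h4⟩
        rw [← Nat.mod_add_div i (q 1), ← h4, ← h3]
      · rintro rfl
        rw [hmod S hS, hdiv S hS]; exact ⟨rfl, rfl⟩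
    have h6 := card_filter_powersetCard_one W (fun S => φ S = i)
    rw [h2] at h1
    have h7 : (W.filter fun v => φ {v} = i).card =
        ((W.powersetCard 1).filter fun S => φ S = i).card := by convert h6.symm
    rwa [← h7] at h1
  · intro j h1 h2; omega
  · intro j
    split_ifs
    · exact le_rfl
    · exact Nat.zero_le _
  · rw [ha1]
    calc L ≤ m := by omega
      _ ≤ q 1 * m := Nat.le_mul_of_pos_left _ hq1
  · intro j h1 h2
    obtain rfl : j = 1 := by omega
    have hB : ∀ i, ∃ B : Finset (Finset V), i < q 1 → B.card ≤ s * (z + 1) ∧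
        ∀ u ∈ C i, u ∉ B → ∀ v ∈ C i, v ∉ B → r i u = r i v → ψ u = ψ v := by
      intro i
      by_cases hi : i < q 1
      · obtain ⟨B, hB⟩ := (hr i hi).2.2
        exact ⟨B, fun _ => hB⟩
      · exact ⟨∅, fun h => absurd h hi⟩
    choose B hB using hB
    refine ⟨(range (q 1)).biUnion B, ?_, ?_⟩
    · have h3 : ((range (q 1)).biUnion B).card ≤ q 1 * (s * (z + 1)) := by
        have := card_biUnion_le_card_mul (range (q 1)) B (s * (z + 1))
          fun i hi => (hB i (mem_range.1 hi)).1
        rwa [card_range] at this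
      have h4 : (z : ℝ) ≤ n / (q 1 * m) := by
        have : ((n / (q 1 * m) : ℕ) : ℝ) ≤ (n : ℝ) / ((q 1 * m : ℕ) : ℝ) := Nat.cast_div_le
        rw [hz]; exact_mod_cast this
      have h5 : (n₀ : ℝ) ≤ n := by exact_mod_cast hW
      have h6 : 2 * (q 1 * s : ℝ) ≤ n * ν := by
        rw [div_lt_iff₀ hν] at hn₀
        nlinarith
      have h7 : (s : ℝ) / m ≤ ν / 2 := by
        rw [div_lt_iff₀ hν] at hm1
        rw [div_le_iff₀ hm0']; linarith
      rw [pow_one]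
      calc _ ≤ ((q 1 * (s * (z + 1)) : ℕ) : ℝ) := by exact_mod_cast h3
        _ = (q 1 * s : ℝ) * z + q 1 * s := by push_cast; ring
        _ ≤ (q 1 * s : ℝ) * (n / (q 1 * m)) + q 1 * s := by gcongr
        _ = (s / m : ℝ) * n + q 1 * s := by field_simp
        _ ≤ ν / 2 * n + ν / 2 * n :=
          add_le_add (mul_le_mul_of_nonneg_right h7 (by positivity)) (by linarith)
        _ = ν * n := by ring
    · intro T hT hTB T' hT' hTB' hf
      have h3 : θ T = θ T' := by rw [← hmod T hT, ← hmod T' hT', hf.2]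
      have h4 := (hW1 T hT).1
      refine (hB _ h4).2 T (hW1 T hT).2
        (fun h => hTB (mem_biUnion.2 ⟨_, mem_range.2 h4, h⟩)) T' (h3 ▸ (hW1 T' hT').2)
        (fun h => hTB' (mem_biUnion.2 ⟨_, mem_range.2 h4, h⟩)) ?_
      rw [← hdiv T hT, hf.2, hdiv T' hT', h3]

lemma regz (k : ℕ) (hk : 1 ≤ k) : Regz k := by
  refine regz_of_build hk ?_
  induction k, hk using Nat.le_induction with
  | base => exact build_one
  | succ k hk ih => exact build_succ_of_regz hk (regz_of_build hk ih)

end Base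
end HypReg

namespace HypReg
section CountingLemma
open Finset
attribute [local instance 10] Classical.propDecidable

variable {V : Type*} [DecidableEq V]

/-- The vertices of `S` having the colour of some vertex of `J`. -/
noncomputable def restrCol (φ : Finset V → ℕ) (S J : Finset V) : Finset V :=
  S.filter fun v => ∃ u ∈ J, φ {u} = φ {v}

/-- `S` has the same vertex colours as `S₀`. -/
def SameCol (φ : Finset V → ℕ) (S S₀ : Finset V) : Prop :=
  S.card = S₀.card ∧ (∀ v ∈ S, ∃ u ∈ S₀, φ {u} = φ {v}) ∧ ∀ u ∈ S₀, ∃ v ∈ S, φ {u} = φ {v}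

variable {φ : Finset V → ℕ} {S S' S₀ I J R : Finset V}

lemma SameCol.cross (h : SameCol φ S S₀) (h₀ : Cross φ S₀) : Cross φ S := by
  have h1 : S.image (fun v => φ {v}) = S₀.image fun v => φ {v} := by
    ext c
    simp only [mem_image]
    constructor
    · rintro ⟨v, hv, rfl⟩
      obtain ⟨u, hu, huv⟩ := h.2.1 v hv
      exact ⟨u, hu, huv⟩
    · rintro ⟨u, hu, rfl⟩
      obtain ⟨v, hv, huv⟩ := h.2.2 u hu
      exact ⟨v, hv, huv.symm⟩
  refine card_image_iff.1 ?_
  rw [h1, h.1]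
  exact card_image_iff.2 h₀

lemma SameCol.restr (h : SameCol φ S S₀) (h₀ : Cross φ S₀) (hJ : J ⊆ S₀) :
    SameCol φ (restrCol φ S J) J := by
  have h2 : ∀ u ∈ J, ∃ v ∈ restrCol φ S J, φ {u} = φ {v} := fun u hu => by
    obtain ⟨v, hv, huv⟩ := h.2.2 u (hJ hu)
    exact ⟨v, mem_filter.2 ⟨hv, u, hu, huv⟩, huv⟩
  have h1 : ∀ v ∈ restrCol φ S J, ∃ u ∈ J, φ {u} = φ {v} := fun v hv => (mem_filter.1 hv).2
  refine ⟨?_, h1, h2⟩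
  have h3 : Cross φ (restrCol φ S J) := (h.cross h₀).mono (filter_subset _ _)
  rw [← card_image_iff.2 h3, ← card_image_iff.2 (h₀.mono hJ)]
  congr 1
  ext c
  simp only [mem_image]
  constructor
  · rintro ⟨v, hv, rfl⟩
    obtain ⟨u, hu, huv⟩ := h1 v hv
    exact ⟨u, hu, huv⟩
  · rintro ⟨u, hu, rfl⟩
    obtain ⟨v, hv, huv⟩ := h2 u hu
    exact ⟨v, hv, huv.symm⟩

lemma SameCol.pIso (h : SameCol φ S S₀) (h₀ : Cross φ S₀)
    (hφ : ∀ J ⊂ S₀, 2 ≤ J.card → φ (restrCol φ S J) = φ J) : pIso φ S₀ S := by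
  have h1 := h.2.2
  choose! e he using h1
  have hinj : Set.InjOn e S₀ := fun u hu v hv huv =>
    h₀ hu hv (by dsimp only; rw [(he u hu).2, (he v hv).2, huv])
  have himg : ∀ J ⊆ S₀, J.image e = restrCol φ S J := by
    intro J hJ
    ext v
    simp only [mem_image, restrCol, mem_filter]
    constructor
    · rintro ⟨u, hu, rfl⟩
      exact ⟨(he u (hJ hu)).1, u, hu, (he u (hJ hu)).2⟩
    · rintro ⟨hv, u, hu, huv⟩
      exact ⟨u, hu, h.cross h₀ (he u (hJ hu)).1 hv (by dsimp only; rw [← huv, (he u (hJ hu)).2])⟩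
  refine ⟨e, hinj, ?_, fun J hJ => ?_⟩
  · rw [himg S₀ subset_rfl]
    exact filter_true_of_mem h.2.1
  · by_cases h2 : 2 ≤ J.card
    · rw [himg J hJ.1, hφ J hJ h2]
    · rcases J.eq_empty_or_nonempty with rfl | h3
      · simp
      · obtain ⟨u, rfl⟩ := card_eq_one.1 (show J.card = 1 by have := h3.card_pos; omega)
        rw [image_singleton, (he u (hJ.1 (mem_singleton_self u))).2]

/-- The sets coloured like `S₀`, as far as the subsets in `A` are concerned. -/
noncomputable def copies (W : Finset V) (φ : Finset V → ℕ) (S₀ : Finset V)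
    (A : Finset (Finset V)) : Finset (Finset V) :=
  (W.powersetCard S₀.card).filter fun S => SameCol φ S S₀ ∧ ∀ J ∈ A, φ (restrCol φ S J) = φ J

/-- The facets which do not violate any condition from `A` when completed by `R`. -/
noncomputable def linkTest (W : Finset V) (φ : Finset V → ℕ) (A : Finset (Finset V))
    (I R : Finset V) : Finset (Finset V) :=
  (W.powersetCard (I.card - 1)).filter fun T => ∀ J ∈ A,
    (∀ u ∈ J, u ∈ I → ∃ t ∈ T, φ {u} = φ {t}) → φ (restrCol φ (T ∪ R) J) = φ J

lemma mem_Kset_linkTest {W : Finset V} {A : Finset (Finset V)} (h₀ : Cross φ S₀) (hI : I ⊆ S₀)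
    (hA : ∀ J ∈ A, J ⊆ S₀ ∧ J.card ≤ I.card) (hIA : I ∉ A) (hSW : S ⊆ W)
    (hS : SameCol φ S I) :
    S ∈ Kset W (I.card - 1) I.card (linkTest W φ A I R) ↔
      ∀ J ∈ A, φ (restrCol φ (S ∪ R) J) = φ J := by
  have hSc := hS.cross (h₀.mono hI)
  have key : ∀ T ⊆ S, ∀ J ∈ A, (∀ u ∈ J, u ∈ I → ∃ t ∈ T, φ {u} = φ {t}) →
      restrCol φ (T ∪ R) J = restrCol φ (S ∪ R) J := by
    intro T hT J hJ h
    ext v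
    simp only [restrCol, mem_filter, mem_union]
    constructor
    · rintro ⟨h1 | h1, h2⟩
      · exact ⟨Or.inl (hT h1), h2⟩
      · exact ⟨Or.inr h1, h2⟩
    · rintro ⟨h1 | h1, u, hu, huv⟩
      · obtain ⟨w, hw, hwv⟩ := hS.2.1 v h1
        obtain rfl : w = u := h₀ (hI hw) ((hA J hJ).1 hu) (hwv.trans huv.symm)
        obtain ⟨t, ht, hut⟩ := h w hu hw
        obtain rfl : t = v := hSc (hT ht) h1 (hut.symm.trans huv)
        exact ⟨Or.inl ht, w, hu, huv⟩
      · exact ⟨Or.inr h1, u, hu, huv⟩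
  simp only [Kset, linkTest, mem_filter]
  constructor
  · rintro ⟨-, h⟩ J hJ
    obtain ⟨u₀, hu₀, hu₀J⟩ : ∃ u₀ ∈ I, u₀ ∉ J := by
      by_contra! hc
      exact hIA (eq_of_subset_of_card_le hc (hA J hJ).2 ▸ hJ)
    obtain ⟨s₀, hs₀, hus₀⟩ := hS.2.2 u₀ hu₀
    have hc : ∀ u ∈ J, u ∈ I → ∃ t ∈ S.erase s₀, φ {u} = φ {t} := fun u hu huI => by
      obtain ⟨t, ht, hut⟩ := hS.2.2 u huI
      refine ⟨t, mem_erase.2 ⟨?_, ht⟩, hut⟩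
      rintro rfl
      exact hu₀J (h₀ (hI huI) (hI hu₀) (hut.trans hus₀.symm) ▸ hu)
    rw [← key _ (erase_subset _ _) J hJ hc]
    exact (h _ (mem_powersetCard.2 ⟨erase_subset _ _, by rw [card_erase_of_mem hs₀, hS.1]⟩)).2
      J hJ hc
  · intro h
    refine ⟨mem_powersetCard.2 ⟨hSW, hS.1⟩, fun T hT => ?_⟩
    obtain ⟨h1, h2⟩ := mem_powersetCard.1 hT
    refine ⟨mem_powersetCard.2 ⟨h1.trans hSW, h2⟩, fun J hJ hc => ?_⟩
    rw [key T h1 J hJ hc]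
    exact h J hJ

end CountingLemma
end HypReg

namespace HypReg
section CountingLemmaStep
open Finset
attribute [local instance 10] Classical.propDecidable

variable {V : Type*} [DecidableEq V] {φ : Finset V → ℕ} {S S' S₀ I J R : Finset V}

lemma restrCol_restrCol (hJ : J ⊆ I) : restrCol φ (restrCol φ S I) J = restrCol φ S J := by
  ext v
  simp only [restrCol, mem_filter]
  exact ⟨fun h => ⟨h.1.1, h.2⟩, fun h => ⟨⟨h.1, h.2.imp fun u hu => ⟨hJ hu.1, hu.2⟩⟩, h.2⟩⟩

lemma pIso.sameCol (h : pIso φ S S') (hS : 2 ≤ S.card) : SameCol φ S S' := by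
  refine ⟨h.card_eq, ?_⟩
  have hcard := h.card_eq
  obtain ⟨e, he, rfl, hT⟩ := h
  have h1 : ∀ v ∈ S, φ {e v} = φ {v} := fun v hv => by
    have h2 := hT {v} ((singleton_subset_iff.2 hv).ssubset_of_ne fun h => by
      rw [← h, card_singleton] at hS; omega)
    rwa [image_singleton] at h2
  refine ⟨fun v hv => ⟨e v, mem_image_of_mem e hv, h1 v hv⟩, fun u hu => ?_⟩
  obtain ⟨v, hv, rfl⟩ := mem_image.1 hu
  exact ⟨v, hv, h1 v hv⟩

lemma SameCol.glue (h₀ : Cross φ S₀) (hI : I ⊆ S₀) (hS : SameCol φ S S₀) (hS' : SameCol φ S' I) :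
    SameCol φ (S' ∪ (S \ restrCol φ S I)) S₀ ∧
      restrCol φ (S' ∪ (S \ restrCol φ S I)) I = S' ∧ Disjoint S' (S \ restrCol φ S I) := by
  have hR : ∀ v ∈ S \ restrCol φ S I, ∀ u ∈ I, φ {u} ≠ φ {v} := fun v hv u hu h =>
    (mem_sdiff.1 hv).2 (mem_filter.2 ⟨(mem_sdiff.1 hv).1, u, hu, h⟩)
  have hdisj : Disjoint S' (S \ restrCol φ S I) := disjoint_left.2 fun v hv hv' => by
    obtain ⟨u, hu, huv⟩ := hS'.2.1 v hv
    exact hR v hv' u hu huv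
  refine ⟨⟨?_, ?_, ?_⟩, ?_, hdisj⟩
  · have h1 : (restrCol φ S I).card = I.card := (hS.restr h₀ hI).1
    have h2 : restrCol φ S I ⊆ S := filter_subset _ _
    rw [card_union_of_disjoint hdisj, card_sdiff_of_subset h2, hS'.1, h1, hS.1]
    have := card_le_card hI
    omega
  · intro v hv
    rcases mem_union.1 hv with h | h
    · obtain ⟨u, hu, huv⟩ := hS'.2.1 v h
      exact ⟨u, hI hu, huv⟩
    · exact hS.2.1 v (mem_sdiff.1 h).1
  · intro u hu
    by_cases huI : u ∈ I
    · obtain ⟨v, hv, huv⟩ := hS'.2.2 u huI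
      exact ⟨v, mem_union_left _ hv, huv⟩
    · obtain ⟨v, hv, huv⟩ := hS.2.2 u hu
      refine ⟨v, mem_union_right _ (mem_sdiff.2 ⟨hv, fun hc => ?_⟩), huv⟩
      obtain ⟨-, w, hw, hwv⟩ := mem_filter.1 hc
      exact huI (h₀ (hI hw) hu (hwv.trans huv.symm) ▸ hw)
  · ext v
    simp only [restrCol, mem_filter, mem_union]
    constructor
    · rintro ⟨h1 | h1, u, hu, huv⟩
      · exact h1
      · exact absurd huv (hR v (by exact h1) u hu)
    · intro hv
      exact ⟨Or.inl hv, hS'.2.1 v hv⟩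

lemma sum_copies_fiber {W : Finset V} {A : Finset (Finset V)} (h₀ : Cross φ S₀) (hI : I ⊆ S₀)
    (hI2 : 2 ≤ I.card) (hA : ∀ J ∈ A, J ⊆ S₀ ∧ J.card ≤ I.card) (hIA : I ∉ A)
    (hdown : ∀ J ⊂ I, 2 ≤ J.card → J ∈ A) (hS : S ∈ copies W φ S₀ A) (g : Finset V → ℝ) :
    ∑ T ∈ (copies W φ S₀ A).filter (fun T => T \ restrCol φ T I = S \ restrCol φ S I),
      g (restrCol φ T I) = ∑ T ∈ W.powersetCard I.card, tst W I.card (fun T => pIso φ T I)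
        (linkTest W φ A I (S \ restrCol φ S I)) T * g T := by
  have hcop : ∀ {T}, T ∈ copies W φ S₀ A ↔ T ⊆ W ∧ SameCol φ T S₀ ∧
      ∀ J ∈ A, φ (restrCol φ T J) = φ J := fun {T} => by
    simp only [copies, mem_filter, mem_powersetCard]
    exact ⟨fun h => ⟨h.1.1, h.2⟩, fun h => ⟨⟨h.1, h.2.1.1⟩, h.2⟩⟩
  obtain ⟨hSW, hSc, -⟩ := hcop.1 hS
  set R := S \ restrCol φ S I with hR
  have hRW : R ⊆ W := sdiff_subset.trans hSW
  have h1 : ∀ T, tst W I.card (fun T => pIso φ T I) (linkTest W φ A I R) T * g T =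
      if pIso φ T I ∧ T ∈ Kset W (I.card - 1) I.card (linkTest W φ A I R) then g T else 0 := by
    intro T
    simp only [tst, clq]
    split_ifs <;> simp_all
  simp only [h1]
  rw [← sum_filter]
  refine sum_nbij' (fun T => restrCol φ T I) (fun T => T ∪ R) ?_ ?_ ?_ ?_ ?_
  · intro T hT
    obtain ⟨h2, h3⟩ := mem_filter.1 hT
    obtain ⟨h4, h5, h6⟩ := hcop.1 h2
    have h7 := h5.restr h₀ hI
    have h8 : restrCol φ T I ⊆ T := filter_subset _ _
    refine mem_filter.2 ⟨mem_powersetCard.2 ⟨h8.trans h4, h7.1⟩, ?_, ?_⟩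
    · refine (h7.pIso (h₀.mono hI) fun J hJ hJ2 => ?_).symm
      rw [restrCol_restrCol hJ.1]
      exact h6 J (hdown J hJ hJ2)
    · rw [mem_Kset_linkTest h₀ hI hA hIA (h8.trans h4) h7, ← h3, union_sdiff_of_subset h8]
      exact h6
  · intro T hT
    obtain ⟨h2, h3, h4⟩ := mem_filter.1 hT
    obtain ⟨h5, h6⟩ := mem_powersetCard.1 h2
    have h7 := h3.sameCol (by omega)
    rw [mem_Kset_linkTest h₀ hI hA hIA h5 h7] at h4
    obtain ⟨h8, h9, h10⟩ := hSc.glue h₀ hI h7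
    refine mem_filter.2 ⟨hcop.2 ⟨union_subset h5 hRW, h8, h4⟩, ?_⟩
    rw [h9, union_sdiff_cancel_left h10]
  · intro T hT
    rw [← (mem_filter.1 hT).2]
    exact union_sdiff_of_subset (filter_subset _ _)
  · intro T hT
    obtain ⟨h2, h3, h4⟩ := mem_filter.1 hT
    exact (hSc.glue h₀ hI (h3.sameCol (by rw [(mem_powersetCard.1 h2).2]; omega))).2.1
  · intro T _
    rfl

lemma card_copies_insert {W : Finset V} {A : Finset (Finset V)} (h₀ : Cross φ S₀) (hI : I ⊆ S₀)
    (hSW : S₀ ⊆ W)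
    (hI2 : 2 ≤ I.card) (hA : ∀ J ∈ A, J ⊆ S₀ ∧ J.card ≤ I.card) (hIA : I ∉ A)
    (hdown : ∀ J ⊂ I, 2 ≤ J.card → J ∈ A) {d δ : ℝ}
    (hLU : LU W I.card φ (fun S => col φ (φ I) S - d) δ) :
    |((copies W φ S₀ (insert I A)).card : ℝ) - d * (copies W φ S₀ A).card| ≤
      δ * (W.card : ℝ) ^ S₀.card := by
  have h1 : copies W φ S₀ (insert I A) =
      (copies W φ S₀ A).filter fun S => φ (restrCol φ S I) = φ I := by
    ext S
    simp only [copies, mem_filter, mem_insert, forall_eq_or_imp]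
    tauto
  have h2 : ((copies W φ S₀ (insert I A)).card : ℝ) - d * (copies W φ S₀ A).card =
      ∑ S ∈ copies W φ S₀ A, (col φ (φ I) (restrCol φ S I) - d) := by
    rw [h1, sum_sub_distrib, sum_const, nsmul_eq_mul, mul_comm d]
    simp only [col, sum_boole]
  have h3 : ∀ S ∈ copies W φ S₀ A, S \ restrCol φ S I ∈ W.powersetCard (S₀.card - I.card) := by
    intro S hS
    obtain ⟨h4, h5, -⟩ := mem_filter.1 hS
    obtain ⟨h6, h7⟩ := mem_powersetCard.1 h4
    refine mem_powersetCard.2 ⟨sdiff_subset.trans h6, ?_⟩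
    have h8 : restrCol φ S I ⊆ S := filter_subset _ _
    rw [card_sdiff_of_subset h8, (h5.restr h₀ hI).1, h7]
  have hc := card_le_card hI
  have hδ : 0 ≤ δ * (W.card : ℝ) ^ I.card :=
    (abs_nonneg _).trans (hLU I (mem_powersetCard.2 ⟨hI.trans hSW, rfl⟩) (h₀.mono hI) ∅)
  rw [h2, ← sum_fiberwise_of_maps_to (g := fun S => S \ restrCol φ S I) h3]
  calc _ ≤ ∑ R ∈ W.powersetCard (S₀.card - I.card), δ * (W.card : ℝ) ^ I.card := by
        refine (abs_sum_le_sum_abs _ _).trans (sum_le_sum fun R _ => ?_)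
        by_cases hR : ∃ S ∈ copies W φ S₀ A, S \ restrCol φ S I = R
        · obtain ⟨S, hS, rfl⟩ := hR
          rw [sum_copies_fiber h₀ hI hI2 hA hIA hdown hS fun T => col φ (φ I) T - d]
          exact hLU I (mem_powersetCard.2 ⟨hI.trans hSW, rfl⟩) (h₀.mono hI) _
        · rw [filter_false_of_mem fun S hS h => hR ⟨S, hS, h⟩]
          simpa using hδ
    _ ≤ (W.card : ℝ) ^ (S₀.card - I.card) * (δ * (W.card : ℝ) ^ I.card) := by
        rw [sum_const, nsmul_eq_mul]
        refine mul_le_mul_of_nonneg_right ?_ hδ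
        exact_mod_cast card_powersetCard_le W _
    _ = _ := by
        rw [mul_left_comm, ← pow_add, Nat.sub_add_cancel hc]

/-- Every crossing isomorphism type is represented many times. -/
lemma card_pIso_lower {W : Finset V} {k M : ℕ} {q a : ℕ → ℕ} {θ : Finset V → ℕ} {δ : ℝ}
    (hF : Fam W k q a θ φ δ) (hk : 1 ≤ k) (hM : ∀ j, a j ≤ M) (hn : M ≤ W.card)
    (hδ : 0 ≤ δ) (hδM : 2 ^ (k + 1) * δ ≤ (1 / (2 * M : ℝ)) ^ (k + 1 + 2 ^ (k + 1)) / 2)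
    (hS₀ : S₀ ⊆ W) (h₀ : Cross φ S₀) (hl : S₀.card ≤ k + 1) :
    (1 / (2 * M : ℝ)) ^ (k + 1 + 2 ^ (k + 1)) / 2 * (W.card : ℝ) ^ S₀.card ≤
      ((W.powersetCard S₀.card).filter fun S => pIso φ S S₀).card := by
  set n := W.card with hnW
  set l := S₀.card with hlc
  have hM1 : 1 ≤ M := (Nat.succ_le_of_lt (hF.pos 1 le_rfl hk)).trans (hM 1)
  have hM1' : (1 : ℝ) ≤ M := by exact_mod_cast hM1
  set x : ℝ := 1 / (2 * M) with hx
  have hx0 : 0 < x := by positivity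
  have hx1 : x ≤ 1 := by rw [hx, div_le_one (by positivity)]; linarith
  have hbase : (x * n) ^ l ≤ ((copies W φ S₀ ∅).card : ℝ) := by
    have h1 : (Fintype.piFinset fun v : S₀ => W.filter fun u => φ {u} = φ {(v : V)}).card ≤
        (copies W φ S₀ ∅).card := by
      have hmem : ∀ {f : S₀ → V}, f ∈ (Fintype.piFinset fun v : S₀ =>
          W.filter fun u => φ {u} = φ {(v : V)}) ↔ ∀ v : S₀, f v ∈ W ∧ φ {f v} = φ {(v : V)} := by
        intro f; simp only [Fintype.mem_piFinset, mem_filter]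
      have hinj : ∀ {f : S₀ → V}, (∀ v : S₀, f v ∈ W ∧ φ {f v} = φ {(v : V)}) →
          Function.Injective f := fun {f} hf u v huv => by
        refine Subtype.ext (h₀ u.2 v.2 ?_)
        dsimp only
        rw [← (hf u).2, ← (hf v).2, huv]
      refine card_le_card_of_injOn (fun f => univ.image f) ?_ ?_
      · intro f hf
        have hf := hmem.1 (mem_coe.1 hf)
        have hcard : (univ.image f).card = l := by
          rw [card_image_of_injective _ (hinj hf), card_univ, Fintype.card_coe]
        refine mem_coe.2 (mem_filter.2 ⟨mem_powersetCard.2 ⟨?_, hcard⟩, ⟨hcard, ?_, ?_⟩, by simp⟩)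
        · intro v hv
          obtain ⟨u, -, rfl⟩ := mem_image.1 hv
          exact (hf u).1
        · intro v hv
          obtain ⟨u, -, rfl⟩ := mem_image.1 hv
          exact ⟨u, u.2, (hf u).2.symm⟩
        · intro u hu
          exact ⟨f ⟨u, hu⟩, mem_image_of_mem _ (mem_univ _), (hf ⟨u, hu⟩).2.symm⟩
      · intro f hf g hg hfg
        have hf := hmem.1 (mem_coe.1 hf)
        have hg := hmem.1 (mem_coe.1 hg)
        funext v
        have h2 : f v ∈ univ.image g := by
          have h3 : f v ∈ univ.image f := mem_image_of_mem _ (mem_univ _)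
          have h4 : univ.image f = univ.image g := hfg
          rwa [h4] at h3
        obtain ⟨u, -, hu⟩ := mem_image.1 h2
        have h5 : u = v := Subtype.ext (h₀ u.2 v.2 (by
          dsimp only; rw [← (hg u).2, hu, (hf v).2]))
        rw [← hu, h5]
    have h2 : ∀ v : S₀, x * n ≤ ((W.filter fun u => φ {u} = φ {(v : V)}).card : ℝ) := by
      intro v
      have h3 := hF.lt {(v : V)} (singleton_subset_iff.2 (hS₀ v.2)) (by simp) (by simpa)
      rw [card_singleton] at h3
      have ha : 1 ≤ a 1 := hF.pos 1 le_rfl hk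
      have h4 : n / a 1 ≤ (W.filter fun u => φ {u} = φ {(v : V)}).card := by
        rcases hF.size _ h3 with h | h
        · exact h.ge
        · exact (Nat.le_succ _).trans h.ge
      have h5 : n ≤ 2 * M * (n / a 1) := by
        have h6 := Nat.lt_mul_div_succ n ha
        have h7 : 1 ≤ n / a 1 := (Nat.one_le_div_iff ha).2 ((hM 1).trans hn)
        have h8 : a 1 * (n / a 1 + 1) ≤ M * (n / a 1 + 1) := Nat.mul_le_mul_right _ (hM 1)
        have h9 : M * (n / a 1 + 1) ≤ M * (2 * (n / a 1)) := Nat.mul_le_mul_left _ (by omega)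
        nlinarith
      have h6 : (n : ℝ) ≤ 2 * M * ((n / a 1 : ℕ) : ℝ) := by exact_mod_cast h5
      calc x * n ≤ ((n / a 1 : ℕ) : ℝ) := by
            rw [hx, one_div, inv_mul_le_iff₀ (by positivity)]; exact h6
        _ ≤ _ := by exact_mod_cast h4
    calc (x * n) ^ l = ∏ _v : S₀, x * n := by
          rw [prod_const, card_univ, Fintype.card_coe]
      _ ≤ ∏ v : S₀, ((W.filter fun u => φ {u} = φ {(v : V)}).card : ℝ) :=
          prod_le_prod (fun _ _ => by positivity) fun v _ => h2 v
      _ = ((Fintype.piFinset fun v : S₀ =>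
          W.filter fun u => φ {u} = φ {(v : V)}).card : ℝ) := by
          rw [Fintype.card_piFinset]; push_cast; rfl
      _ ≤ _ := by exact_mod_cast h1
  have main : ∀ A : Finset (Finset V), (∀ J ∈ A, J ⊆ S₀ ∧ 2 ≤ J.card ∧ J.card ≤ k) →
      (∀ J ∈ A, ∀ I ⊂ J, 2 ≤ I.card → I ∈ A) →
      (x * n) ^ l * x ^ A.card - A.card * (δ * (n : ℝ) ^ l) ≤ ((copies W φ S₀ A).card : ℝ) := by
    intro A
    induction A using Finset.induction_on_max_value (fun J : Finset V => J.card) with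
    | empty => intro _ _; simpa using hbase
    | insert I A hIA hmax ih =>
      intro h1 h2
      have h3 := h1 I (mem_insert_self _ _)
      have h4 := ih (fun J hJ => h1 J (mem_insert_of_mem hJ)) fun J hJ T hT hT2 =>
        mem_of_mem_insert_of_ne (h2 J (mem_insert_of_mem hJ) T hT hT2) fun h => by
          have h5 := card_lt_card hT
          have h6 := hmax J hJ
          rw [h] at h5
          omega
      have h5 := card_copies_insert (W := W) h₀ h3.1 hS₀ h3.2.1
        (fun J hJ => ⟨(h1 J (mem_insert_of_mem hJ)).1, hmax J hJ⟩) hIA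
        (fun J hJ hJ2 => mem_of_mem_insert_of_ne (h2 I (mem_insert_self _ _) J hJ hJ2) hJ.ne)
        (hF.unif I.card h3.2.1 h3.2.2 (φ I)
          (hF.lt I (h3.1.trans hS₀) (by omega) h3.2.2))
      have h6 := (abs_le.1 h5).1
      rw [card_insert_of_notMem hIA]
      have ha : 0 < a I.card := hF.pos _ (by omega) h3.2.2
      have ha' : (1 : ℝ) ≤ a I.card := by exact_mod_cast ha
      have haM : (a I.card : ℝ) ≤ M := by exact_mod_cast hM _
      have h7 : x ≤ 1 / (a I.card : ℝ) := by
        rw [hx]; exact one_div_le_one_div_of_le (by positivity) (by linarith)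
      have h8 : x * ((copies W φ S₀ A).card : ℝ) ≤
          1 / (a I.card : ℝ) * ((copies W φ S₀ A).card : ℝ) := by gcongr
      have h9 : x * ((x * n) ^ l * x ^ A.card - A.card * (δ * (n : ℝ) ^ l)) ≤
          x * ((copies W φ S₀ A).card : ℝ) := by gcongr
      have h10 : 0 ≤ (A.card : ℝ) * (δ * (n : ℝ) ^ l) := by positivity
      have h11 : x * ((A.card : ℝ) * (δ * (n : ℝ) ^ l)) ≤ A.card * (δ * (n : ℝ) ^ l) := by
        nlinarith
      push_cast
      rw [pow_succ]
      nlinarith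
  set A := (S₀.powerset.filter fun J => 2 ≤ J.card ∧ J ≠ S₀) with hA
  have hcl : (copies W φ S₀ A).card ≤ ((W.powersetCard l).filter fun S => pIso φ S S₀).card := by
    refine card_le_card fun S hS => ?_
    obtain ⟨h1, h2, h3⟩ := mem_filter.1 hS
    exact mem_filter.2 ⟨h1, (h2.pIso h₀ fun J hJ hJ2 => h3 J (mem_filter.2
      ⟨mem_powerset.2 hJ.1, hJ2, hJ.ne⟩)).symm⟩
  have h1 := main A (fun J hJ => by
      obtain ⟨h1, h2, h3⟩ := mem_filter.1 hJ
      have h1 := mem_powerset.1 h1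
      have h4 := card_lt_card (h1.ssubset_of_ne h3)
      exact ⟨h1, h2, by omega⟩)
    (fun J hJ I hI hI2 => by
      obtain ⟨h1, h2, h3⟩ := mem_filter.1 hJ
      have h1 := mem_powerset.1 h1
      exact mem_filter.2 ⟨mem_powerset.2 (hI.1.trans h1), hI2, (hI.trans_subset h1).ne⟩)
  have hAc : A.card ≤ 2 ^ (k + 1) := by
    refine (card_filter_le _ _).trans ?_
    rw [card_powerset]
    exact Nat.pow_le_pow_right (by norm_num) hl
  have h2 : x ^ (k + 1 + 2 ^ (k + 1)) ≤ x ^ (l + A.card) :=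
    pow_le_pow_of_le_one hx0.le hx1 (by omega)
  have h3 : (A.card : ℝ) * δ ≤ 2 ^ (k + 1) * δ :=
    mul_le_mul_of_nonneg_right (by exact_mod_cast hAc) hδ
  calc _ = (x ^ (k + 1 + 2 ^ (k + 1)) - x ^ (k + 1 + 2 ^ (k + 1)) / 2) * (n : ℝ) ^ l := by ring
    _ ≤ (x ^ (l + A.card) - A.card * δ) * (n : ℝ) ^ l :=
        mul_le_mul_of_nonneg_right (by linarith) (by positivity)
    _ = (x * n) ^ l * x ^ A.card - A.card * (δ * (n : ℝ) ^ l) := by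
        rw [mul_pow, pow_add]; ring
    _ ≤ _ := h1
    _ ≤ _ := by exact_mod_cast hcl

end CountingLemmaStep
end HypReg

namespace HypReg
section OfCol
open Finset
attribute [local instance 10] Classical.propDecidable

variable {V : Type*} [DecidableEq V]

/-- The family of partitions defined by a colouring. -/
noncomputable def ofCol (W : Finset V) (φ : Finset V → ℕ) : PartFam V where
  gnd := W
  vClass v := W.filter fun u => φ {u} = φ {v}
  cls j J := (W.powersetCard j).filter fun S => Cross φ S ∧ fIso φ S J

variable {W : Finset V} {φ : Finset V → ℕ} {S S' S₀ K J : Finset V} {j i : ℕ}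

lemma vClass_ofCol_eq_iff {u v : V} (hu : u ∈ W) :
    (ofCol W φ).vClass u = (ofCol W φ).vClass v ↔ φ {u} = φ {v} := by
  constructor
  · intro h
    have h1 : u ∈ (ofCol W φ).vClass u := mem_filter.2 ⟨hu, rfl⟩
    rw [h] at h1
    exact (mem_filter.1 h1).2
  · intro h
    simp only [ofCol, h]

lemma mem_cross_ofCol : S ∈ (ofCol W φ).cross j ↔ S ∈ W.powersetCard j ∧ Cross φ S := by
  simp only [PartFam.cross, mem_filter]
  refine and_congr_right fun hS => ?_
  have hSW := (mem_powersetCard.1 hS).1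
  constructor
  · intro h u hu v hv huv
    by_contra hne
    exact h u hu v hv hne ((vClass_ofCol_eq_iff (hSW hu)).2 huv)
  · intro h u hu v hv hne huv
    exact hne (h hu hv ((vClass_ofCol_eq_iff (hSW hu)).1 huv))

lemma mem_cls_ofCol :
    S ∈ (ofCol W φ).cls j J ↔ S ∈ (ofCol W φ).cross j ∧ fIso φ S J := by
  rw [mem_cross_ofCol, ofCol, mem_filter, and_assoc]

lemma fIso_singleton {u v : V} : fIso φ {u} {v} ↔ φ {u} = φ {v} := by
  refine ⟨fun h => h.2, fun h => ⟨⟨fun _ => v, by simp, by simp, fun T hT => ?_⟩, h⟩⟩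
  rw [ssubset_singleton_iff.1 hT, image_empty]

lemma mem_polyad_ofCol (hj : 1 ≤ j) (hJ : J ∈ (ofCol W φ).cross i) :
    S ∈ (ofCol W φ).polyad j J ↔ S ∈ W.powersetCard j ∧ ∃ T ∈ J.powersetCard j, fIso φ S T := by
  obtain ⟨hJ1, hJc⟩ := mem_cross_ofCol.1 hJ
  rcases hj.eq_or_lt with rfl | hj2
  · simp only [PartFam.polyad, if_true, sing, mem_image, mem_sup, powersetCard_one, mem_map]
    constructor
    · rintro ⟨v, ⟨u, hu, hv⟩, rfl⟩
      obtain ⟨h1, h2⟩ := mem_filter.1 hv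
      exact ⟨⟨v, h1, rfl⟩, {u}, ⟨u, hu, rfl⟩, fIso_singleton.2 h2⟩
    · rintro ⟨⟨v, hv, rfl⟩, T, ⟨u, hu, rfl⟩, h⟩
      exact ⟨v, ⟨u, hu, mem_filter.2 ⟨hv, fIso_singleton.1 h⟩⟩, rfl⟩
  · rw [PartFam.polyad, if_neg (by omega)]
    simp only [mem_sup, mem_cls_ofCol, mem_cross_ofCol]
    constructor
    · rintro ⟨T, hT, ⟨h1, -⟩, h2⟩
      exact ⟨h1, T, hT, h2⟩
    · rintro ⟨h1, T, hT, h2⟩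
      exact ⟨T, hT, ⟨h1, h2.1.symm.cross (hJc.mono (mem_powersetCard.1 hT).1)⟩, h2⟩

lemma mem_facets_iff (hS₀ : S₀.card = i + 1) :
    S ∈ facets W φ (i + 1) S₀ ↔ S ∈ W.powersetCard i ∧ ∃ T ∈ S₀.powersetCard i, fIso φ S T := by
  simp only [facets, mem_filter, add_tsub_cancel_right]
  refine and_congr_right fun hS => exists_congr fun T => ?_
  constructor
  · rintro ⟨h1, h2⟩
    exact ⟨mem_powersetCard.2 ⟨h1.1, by rw [← h2.1.card_eq, (mem_powersetCard.1 hS).2]⟩, h2⟩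
  · rintro ⟨h1, h2⟩
    obtain ⟨h3, h4⟩ := mem_powersetCard.1 h1
    refine ⟨h3.ssubset_of_ne ?_, h2⟩
    rintro rfl
    omega

lemma polyad_ofCol_eq_facets (hi : 1 ≤ i) (hJ : J ∈ (ofCol W φ).cross (i + 1)) :
    (ofCol W φ).polyad i J = facets W φ (i + 1) J := by
  ext S
  rw [mem_polyad_ofCol hi hJ, mem_facets_iff (mem_powersetCard.1 (mem_cross_ofCol.1 hJ).1).2]

lemma mem_KsetC_ofCol (hi : 1 ≤ i) (hJ : J ∈ (ofCol W φ).cross (i + 1))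
    {Q : Finset (Finset V)} (hQ : Q ⊆ (ofCol W φ).polyad i J) :
    S ∈ KsetC W ((ofCol W φ).cross (i + 1)) i (i + 1) Q ↔
      S ∈ W.powersetCard (i + 1) ∧ pIso φ S J ∧ S ∈ Kset W i (i + 1) Q := by
  rw [polyad_ofCol_eq_facets hi hJ] at hQ
  obtain ⟨hJ1, hJc⟩ := mem_cross_ofCol.1 hJ
  have hJ2 := (mem_powersetCard.1 hJ1).2
  rcases hi.eq_or_lt with rfl | hi2
  · have hK : ∀ S : Finset V, (∀ v ∈ S, ({v} : Finset V) ∈ Q) ↔ ∀ T ∈ S.powersetCard 1, T ∈ Q := by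
      intro S
      simp [powersetCard_one]
    simp only [KsetC, if_true, mem_filter, mem_cross_ofCol, Kset, hK]
    constructor
    · rintro ⟨⟨h1, h2⟩, h3⟩
      exact ⟨h1, (pIso_iff_facets le_rfl hJ2 hJc h1).2 ⟨h2, fun T hT => hQ (h3 T hT)⟩, h1, h3⟩
    · rintro ⟨h1, h2, -, h3⟩
      exact ⟨⟨h1, h2.symm.cross hJc⟩, h3⟩
  · rw [KsetC, if_neg (by omega)]
    constructor
    · intro h
      obtain ⟨h1, h2⟩ := mem_filter.1 h
      refine ⟨h1, (pIso_iff_facets (by omega) hJ2 hJc h1).2 ⟨?_, fun T hT => hQ (h2 T hT)⟩, h⟩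
      exact cross_of_facets (W := W) (by omega) hJc (mem_powersetCard.1 h1).2
        fun T hT => hQ (h2 T hT)
    · exact fun h => h.2.2

lemma mem_polyCliques_ofCol (hi : 1 ≤ i) (hJ : J ∈ (ofCol W φ).cross (i + 1)) :
    S ∈ (ofCol W φ).polyCliques (i + 1) J ↔ S ∈ W.powersetCard (i + 1) ∧ pIso φ S J := by
  obtain ⟨hJ1, hJc⟩ := mem_cross_ofCol.1 hJ
  have hJ2 := (mem_powersetCard.1 hJ1).2
  rw [PartFam.polyCliques, add_tsub_cancel_right]
  refine (mem_KsetC_ofCol hi hJ subset_rfl).trans (and_congr_right fun h1 => ?_)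
  refine ⟨fun h => h.1, fun h => ⟨h, mem_filter.2 ⟨h1, fun T hT => ?_⟩⟩⟩
  rw [polyad_ofCol_eq_facets hi hJ]
  exact ((pIso_iff_facets (by omega) hJ2 hJc h1).1 h).2 T hT

lemma regPairC_ofCol (hi : 1 ≤ i) (hJ : J ∈ (ofCol W φ).cross (i + 1)) {A : Finset (Finset V)}
    {d ε c δ : ℝ} (hε : 0 < ε) (hc : c * (W.card : ℝ) ^ (i + 1) ≤
      (((W.powersetCard (i + 1)).filter fun S => pIso φ S J).card : ℝ))
    (hδ : δ ≤ ε ^ 2 * c)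
    (hA : ∀ Q, |∑ S ∈ W.powersetCard (i + 1), tst W (i + 1) (fun S => pIso φ S J) Q S *
      ((if S ∈ A then 1 else 0) - d)| ≤ δ * (W.card : ℝ) ^ (i + 1)) :
    RegPairC W ((ofCol W φ).cross (i + 1)) i ε d A ((ofCol W φ).polyad i J) := by
  intro Q hQ hlarge
  set N := KsetC W ((ofCol W φ).cross (i + 1)) i (i + 1) Q with hN
  have hmem : ∀ S, S ∈ N ↔ S ∈ W.powersetCard (i + 1) ∧ pIso φ S J ∧ S ∈ Kset W i (i + 1) Q :=
    fun S => mem_KsetC_ofCol hi hJ hQ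
  have h1 : ∑ S ∈ W.powersetCard (i + 1), tst W (i + 1) (fun S => pIso φ S J) Q S *
      ((if S ∈ A then 1 else 0) - d) = ((A ∩ N).card : ℝ) - d * N.card := by
    have h2 : ∀ S ∈ W.powersetCard (i + 1), tst W (i + 1) (fun S => pIso φ S J) Q S *
        ((if S ∈ A then 1 else 0) - d) = if S ∈ N then (if S ∈ A then 1 else 0) - d else 0 := by
      intro S hS
      simp only [tst, clq, hmem, add_tsub_cancel_right]
      split_ifs <;> simp_all
    rw [sum_congr rfl h2, ← sum_filter]
    have h3 : (W.powersetCard (i + 1)).filter (fun S => S ∈ N) = N := by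
      ext S
      rw [mem_filter]
      exact ⟨fun h => h.2, fun h => ⟨((hmem S).1 h).1, h⟩⟩
    rw [h3, sum_sub_distrib, sum_const, nsmul_eq_mul, sum_boole, mul_comm d]
    congr 2
    congr 1
    ext S
    simp only [mem_filter, mem_inter]
    tauto
  have hcl : (((W.powersetCard (i + 1)).filter fun S => pIso φ S J).card : ℝ) =
      (KsetC W ((ofCol W φ).cross (i + 1)) i (i + 1) ((ofCol W φ).polyad i J)).card := by
    congr 2
    ext S
    have := mem_polyCliques_ofCol (S := S) hi hJ
    rw [PartFam.polyCliques, add_tsub_cancel_right] at this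
    rw [mem_filter]
    exact this.symm
  rw [← h1]
  calc _ ≤ δ * (W.card : ℝ) ^ (i + 1) := hA Q
    _ ≤ ε ^ 2 * c * (W.card : ℝ) ^ (i + 1) := by gcongr
    _ = ε * (ε * (c * (W.card : ℝ) ^ (i + 1))) := by ring
    _ ≤ ε * (ε * (KsetC W ((ofCol W φ).cross (i + 1)) i (i + 1)
        ((ofCol W φ).polyad i J)).card) := by rw [← hcl]; gcongr
    _ ≤ ε * N.card := by gcongr

end OfCol
end HypReg

namespace HypReg
section OfFam
open Finset
attribute [local instance 10] Classical.propDecidable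

lemma card_image_congr {α β γ : Type*} [DecidableEq β] [DecidableEq γ] {s : Finset α} {f : α → β} {g : α → γ}
    (h : ∀ x ∈ s, ∀ y ∈ s, f x = f y ↔ g x = g y) : (s.image f).card = (s.image g).card := by
  have h1 : s.image f = (s.image fun x => (f x, g x)).image Prod.fst := by
    rw [image_image]; rfl
  have h2 : s.image g = (s.image fun x => (f x, g x)).image Prod.snd := by
    rw [image_image]; rfl
  rw [h1, h2]
  refine (card_image_of_injOn ?_).trans (card_image_of_injOn ?_).symm
  · intro p hp p' hp' hpp
    obtain ⟨x, hx, rfl⟩ := mem_image.1 (mem_coe.1 hp)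
    obtain ⟨y, hy, rfl⟩ := mem_image.1 (mem_coe.1 hp')
    exact Prod.ext hpp ((h x hx y hy).1 hpp)
  · intro p hp p' hp' hpp
    obtain ⟨x, hx, rfl⟩ := mem_image.1 (mem_coe.1 hp)
    obtain ⟨y, hy, rfl⟩ := mem_image.1 (mem_coe.1 hp')
    exact Prod.ext ((h x hx y hy).2 hpp) hpp

/-- A lower bound for the density of the cells of a colouring with at most `M` colours. -/
noncomputable def cellDens (k M : ℕ) : ℝ := (1 / (2 * M : ℝ)) ^ (k + 1 + 2 ^ (k + 1)) / 2

lemma cellDens_pos {k M : ℕ} (hM : 0 < M) : 0 < cellDens k M := by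
  have : (0 : ℝ) < M := by exact_mod_cast hM
  unfold cellDens; positivity

variable {V : Type*} [DecidableEq V] {W : Finset V} {k M : ℕ} {q a : ℕ → ℕ}
  {θ φ : Finset V → ℕ} {δ : ℝ}

/-- The parameters are chosen such that all cells of the colouring are large. -/
structure BigCells (W : Finset V) (k M : ℕ) (q a : ℕ → ℕ) (θ φ : Finset V → ℕ) (δ : ℝ) :
    Prop where
  fam : Fam W k q a θ φ δ
  one_le : 1 ≤ k
  le : ∀ j, a j ≤ M
  le_card : M ≤ W.card
  nonneg : 0 ≤ δ
  small : 2 ^ (k + 1) * δ ≤ cellDens k M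
  small' : δ * M < cellDens k M

lemma BigCells.lower (h : BigCells W k M q a θ φ δ) {S₀ : Finset V} {j : ℕ}
    (hS₀ : S₀ ∈ W.powersetCard j) (h₀ : Cross φ S₀) (hj : j ≤ k + 1) :
    cellDens k M * (W.card : ℝ) ^ j ≤ ((W.powersetCard j).filter fun S => pIso φ S S₀).card := by
  obtain ⟨h1, rfl⟩ := mem_powersetCard.1 hS₀
  exact card_pIso_lower h.fam h.one_le h.le h.le_card h.nonneg h.small h1 h₀ hj

lemma BigCells.card_pos (h : BigCells W k M q a θ φ δ) : 0 < M ∧ 0 < W.card := by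
  have h1 := h.fam.pos 1 le_rfl h.one_le
  have h2 := h.le 1
  have h3 := h.le_card
  omega

lemma BigCells.exists_color (h : BigCells W k M q a θ φ δ) {J : Finset V} {j b : ℕ}
    (hJ : J ∈ W.powersetCard j) (hc : Cross φ J) (hj : 2 ≤ j) (hjk : j ≤ k) (hb : b < a j) :
    ∃ S ∈ W.powersetCard j, pIso φ S J ∧ φ S = b := by
  by_contra! hno
  obtain ⟨j, rfl⟩ : ∃ i, j = i + 1 := ⟨j - 1, by omega⟩
  have ha : 0 < a (j + 1) := h.fam.pos _ (by omega) hjk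
  have ha' : (0 : ℝ) < a (j + 1) := by exact_mod_cast ha
  have h1 := h.fam.unif (j + 1) hj hjk b hb J hJ hc (W.powersetCard j)
  have h2 : ∀ S ∈ W.powersetCard (j + 1),
      tst W (j + 1) (fun S => pIso φ S J) (W.powersetCard j) S * (col φ b S - 1 / a (j + 1)) =
      -(1 / a (j + 1)) * if pIso φ S J then 1 else 0 := by
    intro S hS
    rw [tst, clq_univ W j hS]
    split_ifs with h3
    · rw [col, if_neg (hno S hS h3)]; ring
    · ring
  rw [sum_congr rfl h2, ← mul_sum, sum_boole, abs_mul, abs_neg,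
    abs_of_pos (by positivity : (0 : ℝ) < 1 / a (j + 1)), Nat.abs_cast] at h1
  have h3 := h.lower hJ hc (hjk.trans (Nat.le_succ k))
  have hn : (0 : ℝ) < (W.card : ℝ) ^ (j + 1) := by
    have : (0 : ℝ) < W.card := by exact_mod_cast h.card_pos.2
    positivity
  have h4 : cellDens k M * (W.card : ℝ) ^ (j + 1) ≤ (δ * M) * (W.card : ℝ) ^ (j + 1) := by
    refine h3.trans ?_
    rw [one_div, inv_mul_le_iff₀ ha'] at h1
    refine h1.trans ?_
    have : (a (j + 1) : ℝ) ≤ M := by exact_mod_cast h.le _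
    have hδ := h.nonneg
    calc _ = (δ * a (j + 1)) * (W.card : ℝ) ^ (j + 1) := by ring
      _ ≤ _ := by gcongr
  exact absurd (le_of_mul_le_mul_right h4 hn) (not_le.2 h.small')

lemma cls_ofCol_eq_iff {S S' : Finset V} {j : ℕ} (hS : S ∈ (ofCol W φ).cross j) :
    (ofCol W φ).cls j S = (ofCol W φ).cls j S' ↔ fIso φ S S' := by
  constructor
  · intro h
    have h1 : S ∈ (ofCol W φ).cls j S :=
      mem_cls_ofCol.2 ⟨hS, (fIso_equivalence φ).refl S⟩
    rw [h] at h1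
    exact (mem_cls_ofCol.1 h1).2
  · intro h
    ext U
    rw [mem_cls_ofCol, mem_cls_ofCol]
    exact and_congr_right fun _ => ⟨fun h' => (fIso_equivalence φ).trans h' h,
      fun h' => (fIso_equivalence φ).trans h' ((fIso_equivalence φ).symm h)⟩

lemma BigCells.isFamily (h : BigCells W k M q a θ φ δ) (hka : k + 1 ≤ a 1) :
    (ofCol W φ).IsFamily (k + 1) a := by
  have hk := h.one_le
  have ha1 : a 1 ≤ W.card := (h.le 1).trans h.le_card
  refine ⟨fun v hv => mem_filter.2 ⟨hv, rfl⟩, fun v _ => filter_subset _ _, ?_, ?_, hka, ?_⟩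
  · intro u hu v _ huv
    exact (vClass_ofCol_eq_iff hu).2 (mem_filter.1 huv).2
  · have h1 : ((ofCol W φ).gnd.image (ofCol W φ).vClass).card =
        (W.image fun v => φ {v}).card :=
      card_image_congr fun x hx y _ => vClass_ofCol_eq_iff hx
    rw [h1]
    have h2 : (W.image fun v => φ {v}) = range (a 1) := by
      ext i
      rw [mem_image, mem_range]
      constructor
      · rintro ⟨v, hv, rfl⟩
        simpa using h.fam.lt {v} (singleton_subset_iff.2 hv) (by simp) (by simpa using hk)
      · intro hi
        have h3 : 0 < W.card / a 1 := Nat.div_pos ha1 (by omega)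
        have h4 : 0 < (W.filter fun v => φ {v} = i).card := by
          rcases h.fam.size i hi with h5 | h5 <;> omega
        obtain ⟨v, hv⟩ := Finset.card_pos.1 h4
        exact ⟨v, (mem_filter.1 hv).1, (mem_filter.1 hv).2⟩
    rw [h2, card_range]
  · intro j hj hjk
    rw [add_tsub_cancel_right] at hjk
    obtain ⟨i, rfl⟩ : ∃ i, j = i + 1 := ⟨j - 1, by omega⟩
    have hi : 1 ≤ i := by omega
    have hpc : ∀ J ∈ (ofCol W φ).cross (i + 1), ∀ S ∈ (ofCol W φ).polyCliques (i + 1) J,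
        S ∈ (ofCol W φ).cross (i + 1) ∧ pIso φ S J := by
      intro J hJ S hS
      obtain ⟨h1, h2⟩ := (mem_polyCliques_ofCol hi hJ).1 hS
      exact ⟨mem_cross_ofCol.2 ⟨h1, h2.symm.cross (mem_cross_ofCol.1 hJ).2⟩, h2⟩
    refine ⟨fun J hJ => mem_cls_ofCol.2 ⟨hJ, (fIso_equivalence φ).refl J⟩,
      fun J hJ I hI => ?_, fun J hJ I hI => ?_, fun J hJ I hI => (hpc J hJ I hI).1, ?_⟩
    · exact (cls_ofCol_eq_iff (mem_cls_ofCol.1 hI).1).2 (mem_cls_ofCol.1 hI).2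
    · obtain ⟨h1, h2⟩ := mem_cls_ofCol.1 hI
      exact (mem_polyCliques_ofCol hi hJ).2 ⟨(mem_cross_ofCol.1 h1).1, h2.1⟩
    · intro J hJ
      obtain ⟨hJ1, hJc⟩ := mem_cross_ofCol.1 hJ
      have h1 : (((ofCol W φ).polyCliques (i + 1) J).image ((ofCol W φ).cls (i + 1))).card =
          (((ofCol W φ).polyCliques (i + 1) J).image φ).card := by
        refine card_image_congr fun S hS S' hS' => ?_
        obtain ⟨h2, h3⟩ := hpc J hJ S hS
        obtain ⟨h4, h5⟩ := hpc J hJ S' hS'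
        rw [cls_ofCol_eq_iff h2]
        exact ⟨fun h6 => h6.2, fun h6 => ⟨h3.trans h5.symm, h6⟩⟩
      rw [h1]
      have h2 : ((ofCol W φ).polyCliques (i + 1) J).image φ = range (a (i + 1)) := by
        ext b
        rw [mem_image, mem_range]
        constructor
        · rintro ⟨S, hS, rfl⟩
          have h3 := (mem_cross_ofCol.1 (hpc J hJ S hS).1).1
          obtain ⟨h4, h5⟩ := mem_powersetCard.1 h3
          have := h.fam.lt S h4 (by omega) (by omega)
          rwa [h5] at this
        · intro hb
          obtain ⟨S, h3, h4, h5⟩ := h.exists_color hJ1 hJc hj hjk hb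
          exact ⟨S, (mem_polyCliques_ofCol hi hJ).2 ⟨h3, h4⟩, h5⟩
      rw [h2, card_range]

lemma fIso_eq_of_cross {K J T : Finset V} (hK : Cross φ K) (hJ : J ⊆ K) (hT : T ⊆ K)
    (h : pIso φ J T) (hc : 2 ≤ J.card) : J = T := by
  obtain ⟨e, he, rfl, h1⟩ := h
  have h2 : ∀ u ∈ J, e u = u := by
    intro u hu
    have h3 : ({u} : Finset V) ⊂ J := by
      refine (singleton_subset_iff.2 hu).ssubset_of_ne fun h4 => ?_
      rw [← h4] at hc
      simp at hc
    have h4 := h1 _ h3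
    rw [image_singleton] at h4
    exact hK (hT (mem_image_of_mem e hu)) (hJ hu) h4
  rw [image_congr (g := id) fun u hu => h2 u hu, image_id]

lemma BigCells.polyadReg (h : BigCells W k M q a θ φ δ) {ε : ℝ} (hε : 0 < ε)
    (hδ : δ ≤ ε ^ 2 * cellDens k M) : (ofCol W φ).PolyadReg (k + 1) a ε := by
  intro K hK j hj hjk J hJ
  rw [add_tsub_cancel_right] at hjk
  obtain ⟨i, rfl⟩ : ∃ i, j = i + 1 := ⟨j - 1, by omega⟩
  obtain ⟨hJK, hJc⟩ := mem_powersetCard.1 hJ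
  obtain ⟨hK1, hKc⟩ := mem_cross_ofCol.1 hK
  have hJ1 : J ∈ W.powersetCard (i + 1) :=
    mem_powersetCard.2 ⟨hJK.trans (mem_powersetCard.1 hK1).1, hJc⟩
  have hJ2 : Cross φ J := hKc.mono hJK
  have hJ3 : J ∈ (ofCol W φ).cross (i + 1) := mem_cross_ofCol.2 ⟨hJ1, hJ2⟩
  have hb : φ J < a (i + 1) := by
    have := h.fam.lt J (mem_powersetCard.1 hJ1).1 (by omega) (by omega)
    rwa [hJc] at this
  rw [add_tsub_cancel_right]
  refine regPairC_ofCol (c := cellDens k M) (δ := δ) (by omega) hJ3 hε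
    (h.lower hJ1 hJ2 (by omega)) hδ fun Q => ?_
  refine le_of_eq_of_le ?_ (h.fam.unif (i + 1) hj hjk (φ J) hb J hJ1 hJ2 Q)
  congr 1
  refine sum_congr rfl fun S hS => ?_
  rw [tst]
  split_ifs with h1 h2 h2
  · have h3 : φ S = φ J := by
      obtain ⟨-, T, hT, h4⟩ := (mem_polyad_ofCol (by omega) hK).1 h2
      have h5 : J = T := fIso_eq_of_cross hKc hJK (mem_powersetCard.1 hT).1
        (h1.symm.trans h4.1) (by omega)
      rw [h4.2, h5]
    simp only [col, if_pos h3]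
  · have h3 : φ S ≠ φ J := fun h4 =>
      h2 ((mem_polyad_ofCol (by omega) hK).2 ⟨hS, J, hJ, h1, h4⟩)
    simp only [col, if_neg h3]
  · simp
  · simp

lemma BigCells.isEquitableE (h : BigCells W k M q a θ φ δ) {ε η : ℝ} (hε : 0 < ε)
    (hδ : δ ≤ ε ^ 2 * cellDens k M) (hη : 1 ≤ η * a 1) :
    (ofCol W φ).IsEquitableE (k + 1) a η ε := by
  refine ⟨hη, fun v hv => h.fam.size (φ {v}) ?_, h.polyadReg hε hδ⟩
  simpa using h.fam.lt {v} (singleton_subset_iff.2 hv) (by simp) (by simpa using h.one_le)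

lemma BigCells.perfectlyRegular (h : BigCells W k M q a θ φ δ) {ε μ ν : ℝ} (hε : 0 < ε)
    {s c : ℕ} {H G : Finset V → ℕ}
    (hδ : q (k + 1) * (δ + μ) ≤ ε ^ 2 * cellDens k M) (hq : 0 < q (k + 1))
    (hθ : GoodTheta W (k + 1) q μ θ) (hG : RegTop W k s θ φ H G ν δ) (hc : c < s) :
    (ofCol W φ).PerfectlyRegular (k + 1) ε ((W.powersetCard (k + 1)).filter fun S => G S = c) := by
  intro K hK
  obtain ⟨hK1, hKc⟩ := mem_cross_ofCol.1 hK
  have hq' : (0 : ℝ) < q (k + 1) := by exact_mod_cast hq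
  set X := W.powersetCard (k + 1) with hX
  set f : Finset V → ℝ := avg X (rel φ θ) (col G c) with hf
  have hf0 : ∀ S, 0 ≤ f S := avg_nonneg fun S _ => col_nonneg G c S
  have hf1 : ∀ S, f S ≤ 1 := avg_le_one fun S _ => col_le_one G c S
  have hA : ∀ b, ∃ A : ℝ, 0 ≤ A ∧ A ≤ 1 ∧ (∀ S ∈ X, pIso φ S K → θ S = b → f S = A) := by
    intro b
    by_cases hb : ∃ S₀ ∈ X, pIso φ S₀ K ∧ θ S₀ = b
    · obtain ⟨S₀, h1, h2, h3⟩ := hb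
      refine ⟨f S₀, hf0 _, hf1 _, fun S hS hSK hSb => ?_⟩
      exact avg_congr (rel_equivalence φ θ) ⟨hSK.trans h2.symm, hSb.trans h3.symm⟩
    · exact ⟨0, le_rfl, zero_le_one, fun S hS h1 h2 => (hb ⟨S, hS, h1, h2⟩).elim⟩
  choose A hA0 hA1 hAf using hA
  refine ⟨∑ b ∈ range (q (k + 1)), A b / q (k + 1), sum_nonneg fun b _ => by
    have := hA0 b; positivity, ?_⟩
  rw [add_tsub_cancel_right]
  refine regPairC_ofCol (c := cellDens k M) (δ := q (k + 1) * (δ + μ)) h.one_le hK hε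
    (h.lower hK1 hKc le_rfl) hδ fun Q => ?_
  have hψ : ∀ T ⊆ W, ∀ T' ⊆ W, T.card = T'.card → T.card < k + 1 → φ T = φ T' → θ T = θ T' :=
    fun T hT T' hT' h1 h2 h3 => h.fam.eq_of_eq hT hT' h1 (by omega) h3
  have hu : ∀ b < q (k + 1), |∑ S ∈ X, tst W (k + 1) (fun S => pIso φ S K) Q S *
      (col θ b S - 1 / q (k + 1))| ≤ μ * (W.card : ℝ) ^ (k + 1) := fun b hb =>
    hθ.unif (k + 1) (by have := h.one_le; omega) le_rfl φ hψ b hb K hK1 hKc Q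
  have hr : ∀ b < q (k + 1), |∑ S ∈ X, tst W (k + 1) (fun S => pIso φ S K) Q S * (col θ b S *
      (col G c S - A b))| ≤ δ * (W.card : ℝ) ^ (k + 1) := by
    intro b hb
    by_cases hbe : ∃ S₀ ∈ X, pIso φ S₀ K ∧ θ S₀ = b
    · obtain ⟨S₀, h1, h2, h3⟩ := hbe
      refine le_of_eq_of_le ?_ (hG.reg S₀ h1 Q c hc)
      congr 1
      refine sum_congr rfl fun S hS => ?_
      have h4 : rel φ θ S S₀ ↔ pIso φ S K ∧ θ S = b :=
        ⟨fun h5 => ⟨h5.1.trans h2, h5.2.trans h3⟩,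
          fun h5 => ⟨h5.1.trans h2.symm, h5.2.trans h3.symm⟩⟩
      simp only [tst, h4, col]
      by_cases h5 : pIso φ S K <;> by_cases h6 : θ S = b
      · rw [← hAf b S hS h5 h6]
        simp [h5, h6, hf, hX]
      all_goals simp [h5, h6]
    · rw [sum_eq_zero, abs_zero]
      · have := h.nonneg
        positivity
      · intro S hS
        by_cases h5 : pIso φ S K
        · have : θ S ≠ b := fun h6 => hbe ⟨S, hS, h5, h6⟩
          simp [col, this]
        · simp [tst, h5]
  have hsplit : ∑ S ∈ X, tst W (k + 1) (fun S => pIso φ S K) Q S *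
      ((if S ∈ X.filter (fun S => G S = c) then 1 else 0) -
        ∑ b ∈ range (q (k + 1)), A b / q (k + 1)) =
      ∑ b ∈ range (q (k + 1)),
        (∑ S ∈ X, tst W (k + 1) (fun S => pIso φ S K) Q S * (col θ b S * (col G c S - A b)) +
        A b * ∑ S ∈ X, tst W (k + 1) (fun S => pIso φ S K) Q S * (col θ b S - 1 / q (k + 1))) := by
    simp only [mul_sum, ← sum_add_distrib]
    rw [sum_comm]
    refine sum_congr rfl fun S hS => ?_
    have h1 : (if S ∈ X.filter (fun S => G S = c) then (1 : ℝ) else 0) = col G c S := by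
      simp [col, hS]
    have h2 : ∑ b ∈ range (q (k + 1)), col θ b S = 1 := by
      refine sum_col ?_
      obtain ⟨h3, h4⟩ := mem_powersetCard.1 hS
      have := hθ.lt S h3 (by omega) (by omega)
      rwa [h4] at this
    rw [h1]
    calc _ = tst W (k + 1) (fun S => pIso φ S K) Q S *
        ((∑ b ∈ range (q (k + 1)), col θ b S) * col G c S -
          ∑ b ∈ range (q (k + 1)), A b / q (k + 1)) := by rw [h2, one_mul]
      _ = _ := by
        rw [sum_mul, ← sum_sub_distrib, mul_sum]
        exact sum_congr rfl fun b _ => by ring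
  rw [hsplit]
  calc _ ≤ ∑ b ∈ range (q (k + 1)), (δ * (W.card : ℝ) ^ (k + 1) +
        1 * (μ * (W.card : ℝ) ^ (k + 1))) := by
        refine (abs_sum_le_sum_abs _ _).trans (sum_le_sum fun b hb => ?_)
        refine (abs_add_le _ _).trans (add_le_add (hr b (mem_range.1 hb)) ?_)
        rw [abs_mul, abs_of_nonneg (hA0 b)]
        exact mul_le_mul (hA1 b) (hu b (mem_range.1 hb)) (abs_nonneg _) zero_le_one
    _ = _ := by rw [sum_const, card_range, nsmul_eq_mul]; ring

end OfFam
end HypReg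

namespace HypReg
section Index
open Finset
attribute [local instance 10] Classical.propDecidable

/-- An enumeration of a finite set. -/
noncomputable def enumIdx {α : Type*} (s : Finset α) (x : α) : ℕ :=
  if h : x ∈ s then (s.equivFin ⟨x, h⟩ : ℕ) else 0

variable {α : Type*} {s : Finset α} {x y : α}

lemma enumIdx_lt (hx : x ∈ s) : enumIdx s x < s.card := by
  rw [enumIdx, dif_pos hx]
  exact Fin.is_lt _

lemma enumIdx_inj (hx : x ∈ s) (hy : y ∈ s) (h : enumIdx s x = enumIdx s y) : x = y := by
  rw [enumIdx, dif_pos hx, enumIdx, dif_pos hy] at h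
  exact congrArg Subtype.val (s.equivFin.injective (Fin.ext h))

lemma enumIdx_surj {b : ℕ} (hb : b < s.card) : ∃ x ∈ s, enumIdx s x = b := by
  refine ⟨s.equivFin.symm ⟨b, hb⟩, (s.equivFin.symm ⟨b, hb⟩).2, ?_⟩
  rw [enumIdx, dif_pos (s.equivFin.symm ⟨b, hb⟩).2]
  simp

end Index

section Agreement
open Finset
attribute [local instance 10] Classical.propDecidable

variable {V : Type*} [DecidableEq V] {W : Finset V} {K : ℕ} {a : ℕ → ℕ} {θ : Finset V → ℕ}
  {F : PartFam V}

/-- The colouring `θ` encodes the family of partitions `F` up to level `K`. -/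
structure Encodes (F : PartFam V) (W : Finset V) (K : ℕ) (θ : Finset V → ℕ) : Prop where
  vClass : ∀ v ∈ W, F.vClass v = (ofCol W θ).vClass v
  cross : ∀ j, F.cross j = (ofCol W θ).cross j
  cls : ∀ j, 2 ≤ j → j ≤ K → ∀ J ∈ F.cross j, F.cls j J = (ofCol W θ).cls j J

lemma polyad_eq_of_encodes (h : Encodes F W K θ) {j i : ℕ} (hjK : j ≤ K) (hj : 1 ≤ j)
    {J : Finset V} (hJ : J ∈ F.cross i) : F.polyad j J = (ofCol W θ).polyad j J := by
  rw [h.cross] at hJ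
  obtain ⟨hJ1, hJc⟩ := mem_cross_ofCol.1 hJ
  have hJW := (mem_powersetCard.1 hJ1).1
  rcases hj.eq_or_lt with rfl | hj2
  · rw [PartFam.polyad, if_pos rfl, PartFam.polyad, if_pos rfl]
    congr 1
    exact sup_congr rfl fun v hv => h.vClass v (hJW hv)
  · rw [PartFam.polyad, if_neg (by omega), PartFam.polyad, if_neg (by omega)]
    refine sup_congr rfl fun T hT => h.cls j hj2 hjK T ?_
    obtain ⟨h1, h2⟩ := mem_powersetCard.1 hT
    rw [h.cross]
    exact mem_cross_ofCol.2 ⟨mem_powersetCard.2 ⟨h1.trans hJW, h2⟩, hJc.mono h1⟩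

lemma Encodes.mono (h : Encodes F W K θ) {K' : ℕ} (hK : K' ≤ K) : Encodes F W K' θ :=
  ⟨h.vClass, h.cross, fun j h1 h2 => h.cls j h1 (h2.trans hK)⟩

lemma polyCliques_eq_of_encodes (hg : F.gnd = W) {i : ℕ} (h : Encodes F W i θ) (hi : 1 ≤ i)
    {J : Finset V} (hJ : J ∈ F.cross (i + 1)) :
    F.polyCliques (i + 1) J = (ofCol W θ).polyCliques (i + 1) J := by
  rw [PartFam.polyCliques, PartFam.polyCliques, add_tsub_cancel_right,
    polyad_eq_of_encodes h le_rfl hi hJ, h.cross, hg]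
  rfl

lemma mem_polyCliques_of_encodes (hg : F.gnd = W) {i : ℕ} (h : Encodes F W i θ) (hi : 1 ≤ i)
    {J S : Finset V} (hJ : J ∈ F.cross (i + 1)) :
    S ∈ F.polyCliques (i + 1) J ↔ S ∈ W.powersetCard (i + 1) ∧ pIso θ S J := by
  rw [polyCliques_eq_of_encodes hg h hi hJ]
  exact mem_polyCliques_ofCol hi (h.cross (i + 1) ▸ hJ)

lemma polyCliques_congr_of_encodes (hg : F.gnd = W) {i : ℕ} (h : Encodes F W i θ) (hi : 1 ≤ i)
    {J J' : Finset V} (hJ : J ∈ F.cross (i + 1)) (hJ' : J' ∈ F.cross (i + 1))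
    (hJJ : pIso θ J J') : F.polyCliques (i + 1) J = F.polyCliques (i + 1) J' := by
  ext S
  rw [mem_polyCliques_of_encodes hg h hi hJ, mem_polyCliques_of_encodes hg h hi hJ']
  exact and_congr_right fun _ => ⟨fun h1 => h1.trans hJJ, fun h1 => h1.trans hJJ.symm⟩

/-- The values of `θ` on singletons and on crossing sets enumerate the classes of `F`. -/
structure Labels (F : PartFam V) (K : ℕ) (θ : Finset V → ℕ) : Prop where
  one : ∀ v ∈ F.gnd, θ {v} = enumIdx (F.gnd.image F.vClass) (F.vClass v)
  cls : ∀ j, 2 ≤ j → j ≤ K → ∀ S ∈ F.cross j,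
    θ S = enumIdx ((F.polyCliques j S).image (F.cls j)) (F.cls j S)

lemma encodes_of_labels (hF : F.IsFamily (K + 1) a) (hθ : Labels F K θ) :
    Encodes F F.gnd K θ := by
  obtain ⟨h1, h2, h3, -, -, h6⟩ := hF
  rw [add_tsub_cancel_right] at h6
  have hone : ∀ u ∈ F.gnd, ∀ v ∈ F.gnd, θ {u} = θ {v} ↔ F.vClass u = F.vClass v := by
    intro u hu v hv
    rw [hθ.one u hu, hθ.one v hv]
    exact ⟨fun h => enumIdx_inj (mem_image_of_mem _ hu) (mem_image_of_mem _ hv) h,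
      fun h => by rw [h]⟩
  have hv : ∀ v ∈ F.gnd, F.vClass v = (ofCol F.gnd θ).vClass v := by
    intro v hv
    ext u
    refine ⟨fun hu => ?_, fun hu => ?_⟩
    · have hu' := h2 v hv hu
      exact mem_filter.2 ⟨hu', (hone u hu' v hv).2 (h3 u hu' v hv hu)⟩
    · obtain ⟨hu', hu2⟩ := mem_filter.1 hu
      rw [← (hone u hu' v hv).1 hu2]
      exact h1 u hu'
  have hc : ∀ j, F.cross j = (ofCol F.gnd θ).cross j := by
    intro j
    refine filter_congr fun S hS => ?_
    have hSW := (mem_powersetCard.1 hS).1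
    refine forall₂_congr fun u hu => forall₂_congr fun v hv' => ?_
    rw [hv u (hSW hu), hv v (hSW hv')]
  have key : ∀ i, Encodes F F.gnd (min i K) θ := by
    intro i
    induction i with
    | zero => exact ⟨hv, hc, fun j hj hj' => by omega⟩
    | succ i ih =>
      refine ⟨hv, hc, fun j hj hj' J hJ => ?_⟩
      by_cases hji : j ≤ i
      · exact ih.cls j hj (by omega) J hJ
      obtain rfl : j = i + 1 := by omega
      have hi : 1 ≤ i := by omega
      have hiK : i + 1 ≤ K := by omega
      have ih' : Encodes F F.gnd i θ := ih.mono (by omega)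
      obtain ⟨g1, g2, g3, g4, -⟩ := h6 (i + 1) hj hiK
      have hpc := fun J' S hJ' => mem_polyCliques_of_encodes (S := S) (J := J') rfl ih' hi hJ'
      ext S
      rw [mem_cls_ofCol, ← hc]
      constructor
      · intro hS
        have hS1 := g3 J hJ hS
        have hS2 := g4 J hJ hS1
        have hS3 := ((hpc J S hJ).1 hS1).2
        refine ⟨hS2, hS3, ?_⟩
        rw [hθ.cls _ hj hiK S hS2, hθ.cls _ hj hiK J hJ,
          polyCliques_congr_of_encodes rfl ih' hi hS2 hJ hS3, g2 J hJ S hS]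
      · rintro ⟨hS2, hS3, hS4⟩
        rw [hθ.cls _ hj hiK S hS2, hθ.cls _ hj hiK J hJ,
          polyCliques_congr_of_encodes rfl ih' hi hS2 hJ hS3] at hS4
        have hSJ : S ∈ F.polyCliques (i + 1) J :=
          (hpc J S hJ).2 ⟨(mem_filter.1 hS2).1, hS3⟩
        have := enumIdx_inj (mem_image_of_mem _ hSJ) (mem_image_of_mem _ (g3 J hJ (g1 J hJ))) hS4
        rw [← this]
        exact g1 S hS2
  simpa using key K

lemma exists_cross_superset (hF : F.IsFamily (K + 1) a) {j m : ℕ} (hjm : j ≤ m) (hm : m ≤ K + 1)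
    {J : Finset V} (hJ : J ∈ F.cross j) : ∃ J' ∈ F.cross m, J ⊆ J' := by
  induction m with
  | zero =>
    obtain rfl : j = 0 := by omega
    exact ⟨J, hJ, subset_rfl⟩
  | succ m ih =>
    rcases hjm.eq_or_lt with rfl | hlt
    · exact ⟨J, hJ, subset_rfl⟩
    obtain ⟨J', h1, h2⟩ := ih (by omega) (by omega)
    obtain ⟨h3, h4⟩ := mem_filter.1 h1
    obtain ⟨h5, h6⟩ := mem_powersetCard.1 h3
    have h7 : (J'.image F.vClass).card < (F.gnd.image F.vClass).card := by
      rw [hF.2.2.2.1]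
      have := hF.2.2.2.2.1
      have := card_image_le (s := J') (f := F.vClass)
      omega
    obtain ⟨C, hC, hC'⟩ := exists_mem_notMem_of_card_lt_card h7
    obtain ⟨v, hv, rfl⟩ := mem_image.1 hC
    have hvJ : ∀ u ∈ J', F.vClass u ≠ F.vClass v := fun u hu h =>
      hC' (mem_image.2 ⟨u, hu, h⟩)
    refine ⟨insert v J', mem_filter.2 ⟨mem_powersetCard.2 ⟨insert_subset hv h5, ?_⟩, ?_⟩,
      h2.trans (subset_insert _ _)⟩
    · rw [card_insert_of_notMem (fun h => hvJ v h rfl), h6]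
    · intro x hx y hy hxy
      rcases mem_insert.1 hx with rfl | hx' <;> rcases mem_insert.1 hy with rfl | hy'
      · exact absurd rfl hxy
      · exact fun h => hvJ y hy' h.symm
      · exact hvJ x hx'
      · exact h4 x hx' y hy' hxy

lemma PartFam.IsFamily.pos (hF : F.IsFamily (K + 1) a) {j : ℕ} (hj : 1 ≤ j) (hjK : j ≤ K) :
    0 < a j := by
  rcases hj.eq_or_lt with rfl | hj2
  · have := hF.2.2.2.2.1
    omega
  · obtain ⟨J, hJ, -⟩ := exists_cross_superset hF (Nat.zero_le j) (by omega)
      (show ∅ ∈ F.cross 0 by simp [PartFam.cross])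
    obtain ⟨g1, g2, g3, g4, g5⟩ := hF.2.2.2.2.2 j hj2 (by omega)
    rw [← g5 J hJ]
    exact card_pos.2 ⟨_, mem_image_of_mem _ (g3 J hJ (g1 J hJ))⟩

end Agreement
end HypReg

namespace HypReg
section ThetaOfFamily
open Finset
attribute [local instance 10] Classical.propDecidable

variable {V : Type*} [DecidableEq V] {W : Finset V} {K : ℕ} {a : ℕ → ℕ} {θ ψ : Finset V → ℕ}
  {F : PartFam V} {μ : ℝ}

/-- All classes of `F` on the levels `2,…,K` are regular with respect to their polyads. -/
def ClassReg (F : PartFam V) (K : ℕ) (a : ℕ → ℕ) (μ : ℝ) : Prop :=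
  ∀ j, 2 ≤ j → j ≤ K → ∀ J ∈ F.cross j, ∃ A,
    (∀ S ∈ F.polyCliques j J, S ∈ A ↔ S ∈ F.cls j J) ∧
    RegPairC F.gnd (F.cross j) (j - 1) μ (1 / (a j : ℝ)) A (F.polyad (j - 1) J)

lemma classReg_of_polyadReg (hF : F.IsFamily (K + 1) a) (hθ : Encodes F F.gnd K θ)
    (hP : F.PolyadReg K a μ)
    (hT : ∀ J ∈ F.cross K,
      RegPairC F.gnd (F.cross K) (K - 1) μ (1 / (a K : ℝ)) (F.cls K J) (F.polyad (K - 1) J)) :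
    ClassReg F K a μ := by
  intro j hj hjK J hJ
  rcases hjK.eq_or_lt with rfl | hlt
  · exact ⟨F.cls j J, fun S _ => Iff.rfl, hT J hJ⟩
  obtain ⟨J', hJ', hJJ'⟩ := exists_cross_superset hF hjK (Nat.le_succ K) hJ
  have hJc : J.card = j := (mem_powersetCard.1 (mem_filter.1 hJ).1).2
  have hJ'2 : J' ∈ (ofCol F.gnd θ).cross K := hθ.cross K ▸ hJ'
  have hJ'c := (mem_cross_ofCol.1 hJ'2).2
  refine ⟨F.polyad j J', fun S hS => ?_, hP J' hJ' j hj (by omega) J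
    (mem_powersetCard.2 ⟨hJJ', hJc⟩)⟩
  obtain ⟨i, rfl⟩ : ∃ i, j = i + 1 := ⟨j - 1, by omega⟩
  obtain ⟨hS1, hS2⟩ := (mem_polyCliques_of_encodes rfl (hθ.mono (by omega)) (by omega) hJ).1 hS
  rw [polyad_eq_of_encodes hθ hjK (by omega) hJ', hθ.cls _ hj hjK J hJ,
    mem_polyad_ofCol (by omega) hJ'2, mem_cls_ofCol, mem_cross_ofCol]
  constructor
  · rintro ⟨-, T, hT', h⟩
    have h5 : J = T := fIso_eq_of_cross hJ'c hJJ' (mem_powersetCard.1 hT').1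
      (hS2.symm.trans h.1) (by omega)
    rw [h5]
    exact ⟨⟨hS1, h.1.symm.cross (hJ'c.mono (mem_powersetCard.1 hT').1)⟩, h⟩
  · rintro ⟨-, h⟩
    exact ⟨hS1, J, mem_powersetCard.2 ⟨hJJ', hJc⟩, h⟩

/-- A finer colouring is crossing on the sets with crossing facets. -/
lemma mem_tst_iff {i : ℕ} (hi : 1 ≤ i) {S₀ S : Finset V} {Q : Finset (Finset V)}
    (hS₀ : S₀ ∈ W.powersetCard (i + 1)) (hc : Cross ψ S₀) (hS : S ∈ W.powersetCard (i + 1))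
    (hS2 : i = 1 → Cross ψ S) :
    pIso ψ S S₀ ∧ S ∈ Kset W i (i + 1) Q ↔ S ∈ Kset W i (i + 1) (Q ∩ facets W ψ (i + 1) S₀) := by
  have hS₀c := (mem_powersetCard.1 hS₀).2
  have hSc := (mem_powersetCard.1 hS).2
  constructor
  · rintro ⟨h1, h2⟩
    refine mem_filter.2 ⟨hS, fun T hT => mem_inter.2 ⟨(mem_filter.1 h2).2 T hT, ?_⟩⟩
    exact ((pIso_iff_facets (by omega) hS₀c hc hS).1 h1).2 T hT
  · intro h
    have h1 := fun T hT => mem_inter.1 ((mem_filter.1 h).2 T hT)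
    refine ⟨(pIso_iff_facets (by omega) hS₀c hc hS).2 ⟨?_, fun T hT => (h1 T hT).2⟩,
      mem_filter.2 ⟨hS, fun T hT => (h1 T hT).1⟩⟩
    rcases hi.eq_or_lt with rfl | hi2
    · exact hS2 rfl
    · exact cross_of_facets (W := W) (by omega) hc hSc fun T hT => (h1 T hT).2

/-- Regular classes are uniform with respect to finer colourings. -/
lemma abs_sum_le_of_classReg (hF : F.IsFamily (K + 1) a) (hg : F.gnd = W)
    (hlab : Labels F K θ) (hθ : Encodes F W K θ) (hμ : 0 ≤ μ) (hR : ClassReg F K a μ) {i : ℕ}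
    (hi : 1 ≤ i) (hiK : i + 1 ≤ K)
    (hψ : ∀ T ⊆ W, ∀ T' ⊆ W, T.card = T'.card → T.card < i + 1 → ψ T = ψ T' → θ T = θ T')
    {b : ℕ} (hb : b < a (i + 1)) {S₀ : Finset V} (hS₀ : S₀ ∈ W.powersetCard (i + 1))
    (hcψ : Cross ψ S₀) (hcθ : Cross θ S₀) (Q : Finset (Finset V)) :
    |∑ S ∈ W.powersetCard (i + 1), tst W (i + 1) (fun S => pIso ψ S S₀) Q S *
      (col θ b S - 1 / a (i + 1))| ≤ μ * (W.card : ℝ) ^ (i + 1) := by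
  have hS₀' : S₀ ∈ F.cross (i + 1) := by
    rw [hθ.cross]; exact mem_cross_ofCol.2 ⟨hS₀, hcθ⟩
  have hS₀W := (mem_powersetCard.1 hS₀).1
  have hpc := fun J S (hJ : J ∈ F.cross (i + 1)) =>
    mem_polyCliques_of_encodes (S := S) hg (hθ.mono (by omega)) hi hJ
  obtain ⟨J₁, hJ₁, hJ₁b⟩ : ∃ J₁ ∈ F.polyCliques (i + 1) S₀, θ J₁ = b := by
    obtain ⟨-, -, -, -, g5⟩ := hF.2.2.2.2.2 (i + 1) (by omega) (by omega)
    rw [← g5 S₀ hS₀'] at hb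
    obtain ⟨C, hC, hCb⟩ := enumIdx_surj hb
    obtain ⟨J₁, h1, rfl⟩ := mem_image.1 hC
    obtain ⟨h2, h3⟩ := (hpc S₀ J₁ hS₀').1 h1
    have h4 : J₁ ∈ F.cross (i + 1) := by
      rw [hθ.cross]; exact mem_cross_ofCol.2 ⟨h2, h3.symm.cross hcθ⟩
    refine ⟨J₁, h1, ?_⟩
    rw [hlab.cls _ (by omega) hiK J₁ h4,
      polyCliques_congr_of_encodes hg (hθ.mono (by omega)) hi h4 hS₀' h3, hCb]
  obtain ⟨hJ₁1, hJ₁2⟩ := (hpc S₀ J₁ hS₀').1 hJ₁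
  have hJ₁c := hJ₁2.symm.cross hcθ
  have hJ₁' : J₁ ∈ F.cross (i + 1) := by
    rw [hθ.cross]; exact mem_cross_ofCol.2 ⟨hJ₁1, hJ₁c⟩
  have hJ₁'' : J₁ ∈ (ofCol W θ).cross (i + 1) := hθ.cross (i + 1) ▸ hJ₁'
  obtain ⟨A, hA, hreg⟩ := hR (i + 1) (by omega) hiK J₁ hJ₁'
  have hfac : facets W ψ (i + 1) S₀ ⊆ (ofCol W θ).polyad i J₁ := by
    intro T hT
    rw [mem_facets_iff (mem_powersetCard.1 hS₀).2] at hT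
    obtain ⟨h1, T₀, h2, h3⟩ := hT
    obtain ⟨h2, h2'⟩ := mem_powersetCard.1 h2
    obtain ⟨h1', h1''⟩ := mem_powersetCard.1 h1
    have h4 : fIso θ T T₀ := by
      refine ⟨h3.1.mono fun U hU U' hU' hc => ?_, ?_⟩
      · refine hψ U (hU.1.trans h1') U' (hU'.1.trans (h2.trans hS₀W)) hc ?_
        have := card_lt_card hU
        omega
      · exact hψ T h1' T₀ (h2.trans hS₀W) (by omega) (by omega) h3.2
    obtain ⟨T₁, h5, h6⟩ := hJ₁2.symm.exists_fIso (h2.ssubset_of_ne fun h => by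
      rw [h, (mem_powersetCard.1 hS₀).2] at h2'; omega)
    refine (mem_polyad_ofCol hi hJ₁'').2 ⟨h1, T₁, mem_powersetCard.2 ⟨h5.1, ?_⟩,
      (fIso_equivalence θ).trans h4 h6⟩
    rw [← h6.1.card_eq, h2']
  set Q' := Q ∩ facets W ψ (i + 1) S₀ with hQ'
  have hQ'sub : Q' ⊆ F.polyad i J₁ := by
    rw [polyad_eq_of_encodes hθ (by omega) hi hJ₁']
    exact inter_subset_right.trans hfac
  set N := KsetC F.gnd (F.cross (i + 1)) i (i + 1) Q' with hN
  have hNmem : ∀ S, S ∈ N ↔ S ∈ W.powersetCard (i + 1) ∧ pIso θ S J₁ ∧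
      S ∈ Kset W i (i + 1) Q' := by
    intro S
    rw [hN, hθ.cross, hg]
    rw [polyad_eq_of_encodes hθ (by omega) hi hJ₁'] at hQ'sub
    exact mem_KsetC_ofCol hi hJ₁'' hQ'sub
  have hpψ : ∀ S ∈ W.powersetCard (i + 1), pIso ψ S S₀ → pIso θ S S₀ := by
    intro S hS h
    refine h.mono fun U hU U' hU' hc => hψ U (hU.1.trans (mem_powersetCard.1 hS).1) U'
      (hU'.1.trans hS₀W) hc ?_
    have := card_lt_card hU
    rw [(mem_powersetCard.1 hS).2] at this
    exact this
  have hmem : ∀ S ∈ W.powersetCard (i + 1),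
      (pIso ψ S S₀ ∧ S ∈ Kset W i (i + 1) Q ↔ S ∈ N) := by
    intro S hS
    rw [hNmem]
    constructor
    · intro h
      refine ⟨hS, (hpψ S hS h.1).trans hJ₁2.symm, ?_⟩
      exact (mem_tst_iff hi hS₀ hcψ hS fun _ => h.1.symm.cross hcψ).1 h
    · rintro ⟨-, h1, h2⟩
      refine (mem_tst_iff hi hS₀ hcψ hS fun _ => ?_).2 h2
      have h3 := h1.symm.cross hJ₁c
      intro u hu v hv huv
      have hSW := (mem_powersetCard.1 hS).1
      exact h3 hu hv (hψ {u} (singleton_subset_iff.2 (hSW hu)) {v}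
        (singleton_subset_iff.2 (hSW hv)) (by simp) (by rw [card_singleton]; omega) huv)
  have hmemA : ∀ S ∈ N, (S ∈ A ↔ θ S = b) := by
    intro S hS
    obtain ⟨h1, h2, -⟩ := (hNmem S).1 hS
    rw [hA S ((hpc J₁ S hJ₁').2 ⟨h1, h2⟩), hθ.cls _ (by omega) hiK J₁ hJ₁', mem_cls_ofCol,
      mem_cross_ofCol, ← hJ₁b]
    exact ⟨fun h => h.2.2, fun h => ⟨⟨h1, h2.symm.cross hJ₁c⟩, h2, h⟩⟩
  have ha : (1 : ℝ) ≤ a (i + 1) := by exact_mod_cast hF.pos (by omega) hiK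
  set d : ℝ := 1 / (a (i + 1) : ℝ) with hd
  have hd0 : 0 ≤ d := by positivity
  have hd1 : d ≤ 1 := by rw [hd, div_le_one (by linarith)]; exact ha
  have h1 : ∑ S ∈ W.powersetCard (i + 1), tst W (i + 1) (fun S => pIso ψ S S₀) Q S *
      (col θ b S - d) = ((A ∩ N).card : ℝ) - d * N.card := by
    have h2 : ∀ S ∈ W.powersetCard (i + 1), tst W (i + 1) (fun S => pIso ψ S S₀) Q S *
        (col θ b S - d) = if S ∈ N then (if S ∈ A then 1 else 0) - d else 0 := by
      intro S hS
      by_cases hSN : S ∈ N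
      · obtain ⟨h3, h4⟩ := (hmem S hS).2 hSN
        simp [tst, clq, h3, h4, hSN, col, hmemA S hSN]
      · rw [if_neg hSN]
        rw [← hmem S hS, not_and] at hSN
        by_cases h3 : pIso ψ S S₀
        · simp [tst, clq, hSN h3]
        · simp [tst, h3]
    rw [sum_congr rfl h2, ← sum_filter]
    have h3 : (W.powersetCard (i + 1)).filter (fun S => S ∈ N) = N := by
      ext S
      rw [mem_filter]
      exact ⟨fun h => h.2, fun h => ⟨((hNmem S).1 h).1, h⟩⟩
    rw [h3, sum_sub_distrib, sum_const, nsmul_eq_mul, sum_boole, mul_comm d]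
    congr 2
    congr 1
    ext S
    simp only [mem_filter, mem_inter]
    tauto
  rw [h1]
  have hle : ∀ N' : Finset (Finset V), N' ⊆ W.powersetCard (i + 1) →
      (N'.card : ℝ) ≤ (W.card : ℝ) ^ (i + 1) := fun N' h =>
    (Nat.cast_le.2 (card_le_card h)).trans (card_powersetCard_le W (i + 1))
  have hNle := hle N fun S hS => ((hNmem S).1 hS).1
  by_cases hlarge : μ * ((KsetC F.gnd (F.cross (i + 1)) i (i + 1) (F.polyad i J₁)).card : ℝ) ≤
      N.card
  · exact (hreg Q' hQ'sub hlarge).trans (mul_le_mul_of_nonneg_left hNle hμ)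
  · have h2 : (KsetC F.gnd (F.cross (i + 1)) i (i + 1) (F.polyad i J₁)) ⊆
        W.powersetCard (i + 1) := by
      rw [polyad_eq_of_encodes hθ (by omega) hi hJ₁', hθ.cross, hg]
      exact fun S hS => ((mem_KsetC_ofCol hi hJ₁'' subset_rfl).1 hS).1
    have h3 := hle _ h2
    have h4 : ((A ∩ N).card : ℝ) ≤ N.card := by exact_mod_cast card_le_card inter_subset_right
    have h5 : |((A ∩ N).card : ℝ) - d * N.card| ≤ N.card := by
      have h6 : 0 ≤ d * (N.card : ℝ) := by positivity
      have h7 : d * (N.card : ℝ) ≤ 1 * N.card := by gcongr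
      have h8 : (0 : ℝ) ≤ (A ∩ N).card := by positivity
      rw [abs_le]
      constructor <;> linarith
    exact h5.trans ((not_le.1 hlarge).le.trans (by gcongr))

/-- Sets which are crossing for `ψ` but not for `θ` are recognised by a single vertex class. -/
lemma tst_eq_of_not_cross {i : ℕ} (hi : 1 ≤ i) (hθ : Encodes F W K θ)
    (hψ : ∀ T ⊆ W, ∀ T' ⊆ W, T.card = T'.card → T.card < i + 1 → ψ T = ψ T' → θ T = θ T')
    {S₀ : Finset V} (hS₀ : S₀ ∈ W.powersetCard (i + 1)) (hcψ : Cross ψ S₀)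
    (hcθ : ¬ Cross θ S₀) {s₁ : V} (hs₁ : s₁ ∈ S₀) (Q : Finset (Finset V)) {S : Finset V}
    (hS : S ∈ W.powersetCard (i + 1)) :
    tst W (i + 1) (fun S => pIso ψ S S₀) Q S = tst W (i + 1)
      (fun S => S ∉ F.cross (i + 1) ∧ (S.filter fun v => ψ {v} = ψ {s₁}).card = 1)
      (Q ∩ facets W ψ (i + 1) S₀) S := by
  have hSc := (mem_powersetCard.1 hS).2
  have hSW := (mem_powersetCard.1 hS).1
  have hS₀c := (mem_powersetCard.1 hS₀).2
  have hS₀W := (mem_powersetCard.1 hS₀).1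
  have hcr : S ∉ F.cross (i + 1) ↔ ¬ Cross θ S := by
    rw [hθ.cross, mem_cross_ofCol, not_and]
    exact ⟨fun h => h hS, fun h _ => h⟩
  have key : (pIso ψ S S₀ ∧ S ∈ Kset W i (i + 1) Q) ↔
      ((S ∉ F.cross (i + 1) ∧ (S.filter fun v => ψ {v} = ψ {s₁}).card = 1) ∧
        S ∈ Kset W i (i + 1) (Q ∩ facets W ψ (i + 1) S₀)) := by
    constructor
    · intro h
      have hc := h.1.symm.cross hcψ
      refine ⟨⟨?_, ?_⟩, (mem_tst_iff hi hS₀ hcψ hS fun _ => hc).1 h⟩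
      · rw [hcr]
        refine fun h1 => hcθ (pIso.cross (h.1.mono fun U hU U' hU' hcc => ?_) h1)
        refine hψ U (hU.1.trans hSW) U' (hU'.1.trans hS₀W) hcc ?_
        have := card_lt_card hU
        omega
      · have h1 : ({s₁} : Finset V) ⊂ S₀ :=
          (singleton_subset_iff.2 hs₁).ssubset_of_ne fun h => by
            rw [← h] at hS₀c; simp at hS₀c; omega
        obtain ⟨T, h2, h3⟩ := h.1.symm.exists_fIso h1
        obtain ⟨v, rfl⟩ := card_eq_one.1 (show T.card = 1 by rw [← h3.1.card_eq, card_singleton])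
        have hv : v ∈ S := singleton_subset_iff.1 h2.1
        refine card_eq_one.2 ⟨v, ?_⟩
        ext u
        rw [mem_filter, mem_singleton]
        refine ⟨fun hu => hc hu.1 hv (hu.2.trans h3.2), ?_⟩
        rintro rfl
        exact ⟨hv, h3.2.symm⟩
    · rintro ⟨⟨-, h1⟩, h2⟩
      refine (mem_tst_iff hi hS₀ hcψ hS fun hi1 => ?_).2 h2
      subst hi1
      obtain ⟨x, y, hxy, rfl⟩ := card_eq_two.1 hSc
      obtain ⟨x₀, y₀, hxy₀, rfl⟩ := card_eq_two.1 hS₀c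
      have hcol : ∀ z ∈ ({x, y} : Finset V), ψ {z} = ψ {x₀} ∨ ψ {z} = ψ {y₀} := by
        intro z hz
        have h3 := (mem_inter.1 ((mem_filter.1 h2).2 {z}
          (mem_powersetCard.2 ⟨singleton_subset_iff.2 hz, card_singleton z⟩))).2
        obtain ⟨-, T, h4, h5⟩ := (mem_facets_iff hS₀c).1 h3
        obtain ⟨h4, h6⟩ := mem_powersetCard.1 h4
        obtain ⟨w, rfl⟩ := card_eq_one.1 h6
        rw [h5.2]
        rcases mem_insert.1 (singleton_subset_iff.1 h4) with rfl | h7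
        · exact Or.inl rfl
        · rw [mem_singleton.1 h7]; exact Or.inr rfl
      have hne : ψ {x} ≠ ψ {y} := by
        intro he
        rw [filter_insert, filter_singleton, ← he] at h1
        by_cases h8 : ψ {x} = ψ {s₁}
        · rw [if_pos h8, if_pos h8, card_pair hxy] at h1
          omega
        · rw [if_neg h8, if_neg h8, card_empty] at h1
          omega
      intro u hu v hv huv
      dsimp only at huv
      rcases mem_insert.1 (mem_coe.1 hu) with hu' | hu' <;>
        rcases mem_insert.1 (mem_coe.1 hv) with hv' | hv'
      · rw [hu', hv']
      · rw [hu', mem_singleton.1 hv'] at huv; exact absurd huv hne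
      · rw [mem_singleton.1 hu', hv'] at huv; exact absurd huv.symm hne
      · rw [mem_singleton.1 hu', mem_singleton.1 hv']
  simp only [tst, clq, add_tsub_cancel_right]
  by_cases h1 : pIso ψ S S₀ ∧ S ∈ Kset W i (i + 1) Q
  · have h2 := key.1 h1
    rw [if_pos h1.1, if_pos h1.2, if_pos h2.1, if_pos h2.2]
  · have h2 := fun h => h1 (key.2 h)
    rw [not_and] at h1
    by_cases h3 : pIso ψ S S₀
    · rw [if_neg (h1 h3), mul_zero]
      by_cases h4 : S ∉ F.cross (i + 1) ∧ (S.filter fun v => ψ {v} = ψ {s₁}).card = 1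
      · rw [if_neg fun h => h2 ⟨h4, h⟩, mul_zero]
      · rw [if_neg h4, zero_mul]
    · rw [if_neg h3, zero_mul]
      by_cases h4 : S ∉ F.cross (i + 1) ∧ (S.filter fun v => ψ {v} = ψ {s₁}).card = 1
      · rw [if_neg fun h => h2 ⟨h4, h⟩, mul_zero]
      · rw [if_neg h4, zero_mul]

/-- An equitable family of partitions is encoded by an equitable colouring. -/
lemma exists_goodTheta (K o : ℕ) {μ : ℝ} (hμ : 0 < μ) : ∃ n₁ : ℕ,
    ∀ (V : Type) [DecidableEq V] (F : PartFam V) (a : ℕ → ℕ), n₁ ≤ F.gnd.card →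
      F.IsFamily (K + 1) a → (∀ j, 1 ≤ j → j ≤ K → a j ≤ o) →
      F.IsEquitableE K a (1 / (a 1 : ℝ)) μ →
      (∀ J ∈ F.cross K,
        RegPairC F.gnd (F.cross K) (K - 1) μ (1 / (a K : ℝ)) (F.cls K J) (F.polyad (K - 1) J)) →
      ∃ θ, Encodes F F.gnd K θ ∧ GoodTheta F.gnd K a μ θ := by
  have hrand := fun i b : ℕ => exists_random_coloring (i + 1) b (by omega)
    (show 0 < min μ 1 by positivity) (min_le_right μ 1)
  choose n₀ hn₀ using hrand
  refine ⟨max 1 (((range K) ×ˢ (range (o + 1))).sup fun p => n₀ p.1 p.2),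
    fun V _ F a hn hF ha hE hT => ?_⟩
  set W := F.gnd with hW
  have hχ : ∀ i, i + 2 ≤ K → ∃ χ : Finset V → ℕ, (∀ S ∈ W.powersetCard (i + 2), χ S < a (i + 2)) ∧
      ∀ U ⊆ W, ∀ Q, ∀ b < a (i + 2), |∑ S ∈ W.powersetCard (i + 2), tst W (i + 2)
        (fun S => S ∉ F.cross (i + 2) ∧ (S.filter fun v => v ∈ U).card = 1) Q S *
        (col χ b S - 1 / a (i + 2))| ≤ μ * (W.card : ℝ) ^ (i + 2) := by
    intro i hi
    have hpos := hF.pos (j := i + 2) (by omega) hi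
    have hpos' : (0 : ℝ) < a (i + 2) := by exact_mod_cast hpos
    have h1 : n₀ i (a (i + 2)) ≤ W.card := by
      refine le_trans ?_ ((le_max_right _ _).trans hn)
      refine le_sup (f := fun p : ℕ × ℕ => n₀ p.1 p.2) (b := (i, a (i + 2))) ?_
      have := ha (i + 2) (by omega) hi
      exact mem_product.2 ⟨mem_range.2 (by omega), mem_range.2 (by omega)⟩
    have hn1 : 1 ≤ W.card := (le_max_left _ _).trans hn
    obtain ⟨χ, h2, h3, -⟩ := hn₀ i (a (i + 2)) V W h1 (Finset V) W.powerset
      (fun U S => S ∉ F.cross (i + 2) ∧ (S.filter fun v => v ∈ U).card = 1) (by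
        rw [card_powerset]
        refine le_trans ?_ (Nat.le_mul_of_pos_left _ (by positivity))
        exact Nat.pow_le_pow_right (by norm_num) (Nat.le_self_pow (by omega) _))
      (fun _ _ => 1 / a (i + 2)) (fun _ _ => 0) (fun _ _ _ _ => by positivity)
      (fun _ _ => by rw [sum_const, card_range, nsmul_eq_mul]; field_simp) (by simp)
    refine ⟨χ, fun S hS => (h2 S hS).1, fun U hU Q b hb => ?_⟩
    refine (h3 U (mem_powerset.2 hU) Q b hb).trans ?_
    gcongr
    exact min_le_left _ _
  choose! χ hχ1 hχ2 using hχ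
  let θ : Finset V → ℕ := fun S =>
    if S.card ≤ 1 then enumIdx (W.image F.vClass) (S.sup F.vClass)
    else if S ∈ F.cross S.card then
      enumIdx ((F.polyCliques S.card S).image (F.cls S.card)) (F.cls S.card S)
    else χ (S.card - 2) S
  have hlab : Labels F K θ := by
    constructor
    · intro v hv
      simp [θ, ← hW]
    · intro j hj hjK S hS
      have hSc := (mem_powersetCard.1 (mem_filter.1 hS).1).2
      simp only [θ, hSc]
      rw [if_neg (by omega), if_pos hS]
  have henc : Encodes F W K θ := encodes_of_labels hF hlab
  have hnc : ∀ i, ∀ S ∈ W.powersetCard (i + 2), S ∉ F.cross (i + 2) → θ S = χ i S := by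
    intro i S hS hS'
    have hSc := (mem_powersetCard.1 hS).2
    simp only [θ, hSc, add_tsub_cancel_right]
    rw [if_neg (by omega), if_neg hS']
  refine ⟨θ, henc, ?_, ?_, ?_⟩
  · intro S hS h1 h2
    rcases h1.eq_or_lt with h1 | h1
    · obtain ⟨v, rfl⟩ := card_eq_one.1 h1.symm
      have hv := singleton_subset_iff.1 hS
      rw [hlab.one v hv, card_singleton, ← hF.2.2.2.1]
      exact enumIdx_lt (mem_image_of_mem _ hv)
    · obtain ⟨i, hi⟩ : ∃ i, S.card = i + 2 := ⟨S.card - 2, by omega⟩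
      have hSX : S ∈ W.powersetCard (i + 2) := mem_powersetCard.2 ⟨hS, hi⟩
      rw [hi]
      by_cases hSc : S ∈ F.cross (i + 2)
      · obtain ⟨g1, g2, g3, g4, g5⟩ := hF.2.2.2.2.2 (i + 2) (by omega) (by omega)
        rw [hlab.cls (i + 2) (by omega) (by omega) S hSc, ← g5 S hSc]
        exact enumIdx_lt (mem_image_of_mem _ (g3 S hSc (g1 S hSc)))
      · rw [hnc i S hSX hSc]
        exact hχ1 i (by omega) S hSX
  · intro i hi
    rw [← hF.2.2.2.1] at hi
    obtain ⟨C, hC, hCi⟩ := enumIdx_surj hi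
    obtain ⟨v, hv, rfl⟩ := mem_image.1 hC
    have h1 : (W.filter fun u => θ {u} = i) = F.vClass v := by
      rw [henc.vClass v hv, ← hCi, ← hlab.one v hv]
      rfl
    rw [h1]
    exact hE.2.1 v hv
  · intro j hj hjK ψ hψ b hb S₀ hS₀ hcψ Q
    obtain ⟨i, rfl⟩ : ∃ i, j = i + 1 := ⟨j - 1, by omega⟩
    by_cases hcθ : Cross θ S₀
    · exact abs_sum_le_of_classReg hF rfl hlab henc hμ.le
        (classReg_of_polyadReg hF henc hE.2.2 hT) (by omega) hjK hψ hb hS₀ hcψ hcθ Q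
    · obtain ⟨i, rfl⟩ : ∃ i', i = i' + 1 := ⟨i - 1, by omega⟩
      obtain ⟨s₁, hs₁⟩ : S₀.Nonempty := card_pos.1 (by rw [(mem_powersetCard.1 hS₀).2]; omega)
      refine le_of_eq_of_le ?_ (hχ2 i hjK (W.filter fun v => ψ {v} = ψ {s₁}) (filter_subset _ _)
        (Q ∩ facets W ψ (i + 2) S₀) b hb)
      congr 1
      refine sum_congr rfl fun S hS => ?_
      rw [tst_eq_of_not_cross (by omega) henc hψ hS₀ hcψ hcθ hs₁ Q hS]
      have h1 : (S.filter fun v => v ∈ W.filter fun v => ψ {v} = ψ {s₁}) =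
          S.filter fun v => ψ {v} = ψ {s₁} :=
        filter_congr fun v hv => by
          rw [mem_filter]
          exact and_iff_right ((mem_powersetCard.1 hS).1 hv)
      simp only [tst, h1]
      by_cases h2 : S ∉ F.cross (i + 1 + 1) ∧ (S.filter fun v => ψ {v} = ψ {s₁}).card = 1
      · rw [col, col, hnc i S hS h2.1]
        congr!
      · rw [if_neg h2, if_neg (show ¬(S ∉ F.cross (i + 2) ∧
          (S.filter fun v => ψ {v} = ψ {s₁}).card = 1) from h2)]
        simp

end ThetaOfFamily
end HypReg

namespace HypReg
section Refinement
open Finset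
attribute [local instance 10] Classical.propDecidable

/-- Classes which are covered up to a bad set can be assigned to covering sets at small cost. -/
lemma exists_assignment {α : Type*} [DecidableEq α] {Y B : Finset α} {cl : α → Finset α}
    {D : Finset (Finset α)}
    (hcl : ∀ S ∈ Y, ∀ T ∈ cl S, cl T = cl S) (hD : ∀ S ∈ Y, ∃ C ∈ D, cl S \ C ⊆ B) :
    ∃ f : Finset α → Finset α, (∀ S ∈ Y, f (cl S) ∈ D) ∧
      ∑ C ∈ Y.image cl, ((C \ f C).card : ℝ) ≤ B.card := by
  have hD' : ∀ C ∈ Y.image cl, ∃ C' ∈ D, C \ C' ⊆ B := by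
    intro C hC
    obtain ⟨S, hS, rfl⟩ := mem_image.1 hC
    exact hD S hS
  choose! f hf1 hf2 using hD'
  refine ⟨f, fun S hS => hf1 _ (mem_image_of_mem _ hS), ?_⟩
  have hdisj : ((Y.image cl : Finset (Finset α)) : Set (Finset α)).PairwiseDisjoint
      fun C => C \ f C := by
    intro C hC C' hC' hne
    obtain ⟨S, hS, rfl⟩ := mem_image.1 (mem_coe.1 hC)
    obtain ⟨S', hS', rfl⟩ := mem_image.1 (mem_coe.1 hC')
    refine disjoint_left.2 fun T hT hT' => hne ?_
    rw [← hcl S hS T (mem_sdiff.1 hT).1, hcl S' hS' T (mem_sdiff.1 hT').1]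
  rw [← Nat.cast_sum, ← card_biUnion hdisj]
  exact_mod_cast card_le_card (biUnion_subset.2 hf2)

variable {V : Type*} [DecidableEq V] {W : Finset V} {k K j : ℕ} {q a : ℕ → ℕ}
  {θ φ ψ : Finset V → ℕ} {F : PartFam V} {ν δ : ℝ}

lemma Fam.pIso_of_pIso (h : Fam W k q a θ φ δ) {S S' : Finset V} (hS : S ∈ W.powersetCard j)
    (hS' : S' ∈ W.powersetCard j) (hj : j ≤ k + 1) (hI : pIso φ S S') : pIso θ S S' := by
  obtain ⟨h1, h2⟩ := mem_powersetCard.1 hS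
  have h3 := (mem_powersetCard.1 hS').1
  refine hI.mono fun T hT T' hT' hc => h.eq_of_eq (hT.1.trans h1) (hT'.1.trans h3) hc ?_
  have := card_lt_card hT
  omega

lemma Fam.fIso_of_fIso (h : Fam W k q a θ φ δ) {S S' : Finset V} (hS : S ∈ W.powersetCard j)
    (hS' : S' ∈ W.powersetCard j) (hj : j ≤ k) (hI : fIso φ S S') : fIso θ S S' := by
  obtain ⟨h1, h2⟩ := mem_powersetCard.1 hS
  obtain ⟨h3, h4⟩ := mem_powersetCard.1 hS'
  exact ⟨h.pIso_of_pIso hS hS' (by omega) hI.1, h.eq_of_eq h1 h3 (by omega) (by omega) hI.2⟩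

lemma Fam.refinesAt (h : Fam W k q a θ φ δ) (hF : Encodes F W K θ) (hkK : k ≤ K) (hj : 1 ≤ j)
    (hjk : j ≤ k) : RefinesAt (ofCol W φ) F j := by
  unfold RefinesAt
  split_ifs with hj1
  · subst hj1
    intro v hv u hu
    obtain ⟨hu1, hu2⟩ := mem_filter.1 hu
    rw [hF.vClass v hv]
    exact mem_filter.2 ⟨hu1, h.eq_of_eq (singleton_subset_iff.2 hu1) (singleton_subset_iff.2 hv)
      rfl (by simpa using hjk) hu2⟩
  · intro I hI
    have hIX := (mem_cross_ofCol.1 hI).1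
    have hmain : ∀ S ∈ (ofCol W φ).cls j I, S ∈ W.powersetCard j ∧ fIso θ S I := fun S hS => by
      obtain ⟨h1, h2⟩ := mem_cls_ofCol.1 hS
      have h3 := (mem_cross_ofCol.1 h1).1
      exact ⟨h3, h.fIso_of_fIso h3 hIX hjk h2⟩
    by_cases hIF : I ∈ F.cross j
    · refine Or.inl ⟨I, hIF, fun S hS => ?_⟩
      obtain ⟨h1, h2⟩ := hmain S hS
      rw [hF.cls j (by omega) (by omega) I hIF]
      rw [hF.cross j] at hIF
      exact mem_cls_ofCol.2 ⟨mem_cross_ofCol.2 ⟨h1, h2.1.symm.cross (mem_cross_ofCol.1 hIF).2⟩, h2⟩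
    · refine Or.inr fun S hS hSF => hIF ?_
      rw [hF.cross j] at hSF ⊢
      exact mem_cross_ofCol.2 ⟨hIX, (hmain S hS).2.1.cross (mem_cross_ofCol.1 hSF).2⟩

/-- Approximate refinement on all levels gives true refinement outside a small set. -/
lemma exists_small_bad_fIso (h : ∀ i, 1 ≤ i → i ≤ k → Appr W i φ ψ ν) (hj : 1 ≤ j) (hjk : j ≤ k) :
    ∃ B : Finset (Finset V), (B.card : ℝ) ≤ j * ν * (W.card : ℝ) ^ j ∧
      ∀ S ∈ W.powersetCard j, S ∉ B → ∀ S' ∈ W.powersetCard j, S' ∉ B →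
        fIso φ S S' → fIso ψ S S' := by
  obtain ⟨i, rfl⟩ : ∃ i, j = i + 1 := ⟨j - 1, by omega⟩
  obtain ⟨B₁, -, h1, h2⟩ := exists_small_bad (k := i) fun j h1 h2 => h j h1 (by omega)
  obtain ⟨B₂, h3, h4⟩ := h (i + 1) hj hjk
  refine ⟨B₁ ∪ B₂, ?_, fun S hS hSB S' hS' hSB' hI => ?_⟩
  · have h5 : ((B₁ ∪ B₂).card : ℝ) ≤ B₁.card + B₂.card := by exact_mod_cast card_union_le _ _
    push_cast
    linarith
  · rw [mem_union, not_or] at hSB hSB'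
    exact ⟨h2 S (mem_sdiff.2 ⟨hS, hSB.1⟩) S' (mem_sdiff.2 ⟨hS', hSB'.1⟩) hI.1,
      h4 S hS hSB.2 S' hS' hSB'.2 hI⟩

lemma refinesApproxAt_of_appr (h : ∀ i, 1 ≤ i → i ≤ k → Appr W i φ ψ ν) (hF : Encodes F W K ψ)
    (hkK : k ≤ K) (hj : 1 ≤ j) (hjk : j ≤ k) {ν' : ℝ}
    (hν : j * ν * (W.card : ℝ) ^ j ≤ ν' * ((ofCol W φ).cross j).card) :
    RefinesApproxAt (ofCol W φ) F j ν' := by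
  obtain ⟨B, hB, hBB⟩ := exists_small_bad_fIso h hj hjk
  unfold RefinesApproxAt
  split_ifs with hj1
  · subst hj1
    obtain ⟨f, h1, h2⟩ := exists_assignment (Y := W) (B := W.filter fun v => {v} ∈ B)
      (cl := (ofCol W φ).vClass) (D := W.image F.vClass)
      (fun S hS T hT => by
        obtain ⟨h1, h2⟩ := mem_filter.1 hT
        exact (vClass_ofCol_eq_iff h1).2 h2)
      (fun v hv => by
        by_cases hbad : ∃ u ∈ (ofCol W φ).vClass v, {u} ∉ B
        · obtain ⟨u, hu, huB⟩ := hbad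
          obtain ⟨hu1, hu2⟩ := mem_filter.1 hu
          refine ⟨_, mem_image_of_mem _ hu1, fun w hw => ?_⟩
          obtain ⟨hw1, hw2⟩ := mem_sdiff.1 hw
          obtain ⟨hw1, hw3⟩ := mem_filter.1 hw1
          refine mem_filter.2 ⟨hw1, by_contra fun hwB => hw2 ?_⟩
          rw [hF.vClass u hu1]
          exact mem_filter.2 ⟨hw1, (hBB {w} (by simpa [powersetCard_one] using hw1) hwB {u}
            (by simpa [powersetCard_one] using hu1) huB
            (fIso_singleton.2 (hw3.trans hu2.symm))).2⟩
        · push Not at hbad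
          refine ⟨_, mem_image_of_mem _ hv, fun w hw => ?_⟩
          have hw := (mem_sdiff.1 hw).1
          exact mem_filter.2 ⟨(mem_filter.1 hw).1, hbad w hw⟩)
    refine ⟨f, h1, h2.trans ?_⟩
    have h3 : ((W.filter fun v => {v} ∈ B).card : ℝ) ≤ B.card := by
      exact_mod_cast card_le_card_of_injOn (fun v => ({v} : Finset V))
        (fun v hv => (mem_filter.1 hv).2) (singleton_injective.injOn)
    have h4 : (ofCol W φ).cross 1 = W.powersetCard 1 := by
      ext S
      rw [mem_cross_ofCol, and_iff_left_iff_imp]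
      intro hS x hx y hy _
      exact card_le_one.1 (mem_powersetCard.1 hS).2.le x hx y hy
    rw [h4, card_powersetCard, Nat.choose_one_right] at hν
    exact h3.trans (hB.trans hν)
  · obtain ⟨f, h1, h2⟩ := exists_assignment (Y := (ofCol W φ).cross j) (B := B)
      (cl := (ofCol W φ).cls j)
      (D := ((F.cross j).image (F.cls j)) ∪ {(ofCol W φ).cross j \ F.cross j})
      (fun S hS T hT => by
        obtain ⟨h1, h2⟩ := mem_cls_ofCol.1 hT
        exact (cls_ofCol_eq_iff h1).2 h2)
      (fun I hI => by
        by_cases hbad : ∃ T ∈ (ofCol W φ).cls j I, T ∉ B ∧ T ∈ F.cross j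
        · obtain ⟨T, hT, hTB, hTF⟩ := hbad
          refine ⟨F.cls j T, mem_union_left _ (mem_image_of_mem _ hTF), fun S hS => ?_⟩
          obtain ⟨hS1, hS2⟩ := mem_sdiff.1 hS
          by_contra hSB
          obtain ⟨h1, h2⟩ := mem_cls_ofCol.1 hS1
          obtain ⟨h3, h4⟩ := mem_cls_ofCol.1 hT
          have h5 := hBB S (mem_cross_ofCol.1 h1).1 hSB T (mem_cross_ofCol.1 h3).1 hTB
            ((fIso_equivalence φ).trans h2 ((fIso_equivalence φ).symm h4))
          rw [hF.cls j (by omega) (by omega) T hTF] at hS2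
          rw [hF.cross j] at hTF
          exact hS2 (mem_cls_ofCol.2 ⟨mem_cross_ofCol.2 ⟨(mem_cross_ofCol.1 h1).1,
            h5.1.symm.cross (mem_cross_ofCol.1 hTF).2⟩, h5⟩)
        · refine ⟨_, mem_union_right _ (mem_singleton_self _), fun S hS => ?_⟩
          obtain ⟨hS1, hS2⟩ := mem_sdiff.1 hS
          by_contra hSB
          exact hS2 (mem_sdiff.2 ⟨(mem_cls_ofCol.1 hS1).1, fun h => hbad ⟨S, hS1, hSB, h⟩⟩))
    exact ⟨f, fun I hI => by convert h1 I hI, by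
      convert h2.trans (hB.trans hν)⟩

/-- A family of partitions is encoded by a colouring with prescribed values on the next level. -/
lemma exists_encodes_extend (hF : F.IsFamily (K + 1) a) {o : ℕ} (hK : 1 ≤ K)
    (ha : ∀ j, 1 ≤ j → j ≤ K → a j ≤ o) (h : Finset V → ℕ) :
    ∃ ψ, Encodes F F.gnd K ψ ∧ (∀ S ∈ F.gnd.powersetCard (K + 1), ψ S = h S) ∧
      ∀ S ⊆ F.gnd, 1 ≤ S.card → S.card ≤ K → ψ S < o + 1 := by
  let ψ : Finset V → ℕ := fun S =>
    if S.card = K + 1 then h S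
    else if S.card ≤ 1 then enumIdx (F.gnd.image F.vClass) (S.sup F.vClass)
    else if S ∈ F.cross S.card then
      enumIdx ((F.polyCliques S.card S).image (F.cls S.card)) (F.cls S.card S)
    else o
  have hlab : Labels F K ψ := by
    constructor
    · intro v hv
      have : K ≠ 0 := by omega
      simp [ψ, this]
    · intro j hj hjK S hS
      have hSc := (mem_powersetCard.1 (mem_filter.1 hS).1).2
      simp only [ψ, hSc]
      rw [if_neg (by omega), if_neg (by omega), if_pos hS]
  refine ⟨ψ, encodes_of_labels hF hlab, fun S hS => if_pos (mem_powersetCard.1 hS).2, ?_⟩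
  intro S hS h1 h2
  rcases h1.eq_or_lt with h1 | h1
  · obtain ⟨v, rfl⟩ := card_eq_one.1 h1.symm
    have hv := singleton_subset_iff.1 hS
    have h3 := enumIdx_lt (mem_image_of_mem F.vClass hv)
    rw [hF.2.2.2.1] at h3
    rw [hlab.one v hv]
    have := ha 1 le_rfl hK
    omega
  · by_cases hSc : S ∈ F.cross S.card
    · obtain ⟨g1, g2, g3, g4, g5⟩ := hF.2.2.2.2.2 S.card (by omega) (by omega)
      have h3 := enumIdx_lt (mem_image_of_mem (F.cls S.card) (g3 S hSc (g1 S hSc)))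
      rw [g5 S hSc] at h3
      rw [hlab.cls S.card (by omega) h2 S hSc]
      have := ha S.card (by omega) h2
      omega
    · simp only [ψ]
      rw [if_neg (by omega), if_neg (by omega), if_neg hSc]
      omega

end Refinement
end HypReg

namespace HypReg
section Counting
open Finset
attribute [local instance 10] Classical.propDecidable

variable {V : Type*} [DecidableEq V] {W : Finset V} {k s j : ℕ} {q a : ℕ → ℕ}
  {θ φ : Finset V → ℕ} {F : PartFam V} {ν δ : ℝ}

lemma pow_le_choose_of_le {n j k : ℕ} (hjk : j ≤ k) (hn : 2 * k ≤ n) :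
    (1 / (2 ^ k * k.factorial) : ℝ) * (n : ℝ) ^ j ≤ n.choose j := by
  refine le_trans ?_ (Nat.pow_le_choose j n)
  have h1 : (n : ℝ) / 2 ≤ ((n + 1 - j : ℕ) : ℝ) := by
    rw [Nat.cast_sub (by omega), div_le_iff₀ (by norm_num)]
    have h2 : (2 * j : ℝ) ≤ n := by exact_mod_cast (by omega : 2 * j ≤ n)
    push_cast
    linarith
  calc (1 / (2 ^ k * k.factorial) : ℝ) * (n : ℝ) ^ j
      ≤ (1 / (2 ^ j * j.factorial) : ℝ) * (n : ℝ) ^ j := by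
        gcongr
        norm_num
    _ = ((n : ℝ) / 2) ^ j / j.factorial := by rw [div_pow]; field_simp
    _ ≤ _ := by gcongr

/-- In an equitable partition into many classes most `j`-sets are crossing. -/
lemma card_cross_lower (h : Fam W k q a θ φ δ) (hk : 1 ≤ k) (ha : a 1 ≤ W.card) :
    ((W.powersetCard j).card : ℝ) - 2 / a 1 * (W.card : ℝ) ^ j ≤ ((ofCol W φ).cross j).card := by
  have ha0 : (0 : ℝ) < a 1 := by exact_mod_cast h.pos 1 le_rfl hk
  have ha1 : (a 1 : ℝ) ≤ W.card := by exact_mod_cast ha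
  rcases Nat.lt_or_ge j 2 with hj | hj
  · have h1 : (ofCol W φ).cross j = W.powersetCard j := by
      ext S
      rw [mem_cross_ofCol, and_iff_left_iff_imp]
      intro hS x hx y hy _
      exact card_le_one.1 (by have := (mem_powersetCard.1 hS).2; omega) x hx y hy
    rw [h1]
    have : 0 ≤ 2 / (a 1 : ℝ) * (W.card : ℝ) ^ j := by positivity
    linarith
  obtain ⟨i, rfl⟩ : ∃ i, j = i + 2 := ⟨j - 2, by omega⟩
  set n := W.card with hn
  have hcl : ∀ v ∈ W, ((W.filter fun u => φ {u} = φ {v}).card : ℝ) ≤ 2 * n / a 1 := by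
    intro v hv
    have h1 : (W.filter fun u => φ {u} = φ {v}).card ≤ n / a 1 + 1 := by
      have := h.size (φ {v}) (by
        simpa using h.lt {v} (singleton_subset_iff.2 hv) (by simp) (by simpa using hk))
      rw [← hn] at this
      omega
    have h2 : ((n / a 1 : ℕ) : ℝ) ≤ n / a 1 := Nat.cast_div_le
    have h3 : (1 : ℝ) ≤ n / a 1 := by rwa [le_div_iff₀ ha0, one_mul]
    calc _ ≤ (((n / a 1 + 1 : ℕ)) : ℝ) := by exact_mod_cast h1
      _ ≤ (n : ℝ) / a 1 + n / a 1 := by push_cast; linarith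
      _ = _ := by ring
  have hsub : W.powersetCard (i + 2) ⊆ (ofCol W φ).cross (i + 2) ∪
      W.biUnion fun v => ((W.filter fun u => φ {u} = φ {v}).erase v).biUnion fun u =>
        (W.powersetCard (i + 2)).filter fun S => {u, v} ⊆ S := by
    intro S hS
    by_cases hc : Cross φ S
    · exact mem_union_left _ (mem_cross_ofCol.2 ⟨hS, hc⟩)
    · simp only [Cross, Set.InjOn, not_forall] at hc
      obtain ⟨u, hu, v, hv, huv, hne⟩ := hc
      have hSW := (mem_powersetCard.1 hS).1
      refine mem_union_right _ (mem_biUnion.2 ⟨v, hSW hv, mem_biUnion.2 ⟨u, ?_, ?_⟩⟩)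
      · exact mem_erase.2 ⟨hne, mem_filter.2 ⟨hSW hu, huv⟩⟩
      · exact mem_filter.2 ⟨hS, insert_subset hu (singleton_subset_iff.2 hv)⟩
  have hbad : ((W.biUnion fun v => ((W.filter fun u => φ {u} = φ {v}).erase v).biUnion fun u =>
        (W.powersetCard (i + 2)).filter fun S => {u, v} ⊆ S).card : ℝ) ≤
        2 / a 1 * (n : ℝ) ^ (i + 2) := by
    calc _ ≤ ((∑ v ∈ W, (W.filter fun u => φ {u} = φ {v}).card * n ^ i : ℕ) : ℝ) := by
          norm_cast
          refine card_biUnion_le.trans (sum_le_sum fun v hv => ?_)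
          refine (card_biUnion_le_card_mul _ _ (n ^ i) fun u hu => ?_).trans
            (Nat.mul_le_mul_right _ (card_le_card (erase_subset _ _)))
          have h1 := card_filter_superset_le W {u, v} (i + 2)
          rwa [card_pair (mem_erase.1 hu).1, add_tsub_cancel_right] at h1
      _ ≤ ∑ v ∈ W, 2 * (n : ℝ) / a 1 * (n : ℝ) ^ i := by
          push_cast
          exact sum_le_sum fun v hv => mul_le_mul_of_nonneg_right (hcl v hv) (by positivity)
      _ = _ := by rw [sum_const, nsmul_eq_mul, ← hn]; ring
  have h5 := card_le_card hsub
  have h6 : ((W.powersetCard (i + 2)).card : ℝ) ≤ ((ofCol W φ).cross (i + 2)).card +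
      (W.biUnion fun v => ((W.filter fun u => φ {u} = φ {v}).erase v).biUnion fun u =>
        (W.powersetCard (i + 2)).filter fun S => {u, v} ⊆ S).card := by
    exact_mod_cast h5.trans (card_union_le _ _)
  linarith

lemma sum_card_fiber_le (D : Finset (Finset V)) (g : Finset V → ℕ) :
    ∑ i : Fin s, (D.filter fun S => g S = i).card ≤ D.card := by
  rw [← card_biUnion]
  · exact card_le_card (biUnion_subset.2 fun _ _ => filter_subset _ _)
  · intro i _ i' _ hne
    refine disjoint_left.2 fun S h1 h2 => hne (Fin.ext ?_)
    rw [← (mem_filter.1 h1).2, (mem_filter.1 h2).2]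

lemma sum_card_sd_le {X : Finset (Finset V)} {g h : Finset V → ℕ} :
    ∑ i : Fin s, ((sd (X.filter fun S => g S = i) (X.filter fun S => h S = i)).card : ℝ) ≤
      2 * (X.filter fun S => g S ≠ h S).card := by
  set D := X.filter fun S => g S ≠ h S with hD
  have h1 : ∀ i : Fin s, (sd (X.filter fun S => g S = i) (X.filter fun S => h S = i)).card ≤
      (D.filter fun S => g S = i).card + (D.filter fun S => h S = i).card := by
    intro i
    refine (card_union_le _ _).trans (add_le_add (card_le_card ?_) (card_le_card ?_))
    all_goals
      intro S hS
      simp only [hD, mem_sdiff, mem_filter] at hS ⊢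
      obtain ⟨⟨h1, h2⟩, h3⟩ := hS
      exact ⟨⟨h1, fun h4 => h3 ⟨h1, by omega⟩⟩, h2⟩
  calc _ ≤ ((∑ i : Fin s, ((D.filter fun S => g S = i).card + (D.filter fun S => h S = i).card) :
        ℕ) : ℝ) := by
        rw [← Nat.cast_sum]
        exact_mod_cast sum_le_sum fun i _ => h1 i
    _ ≤ ((D.card + D.card : ℕ) : ℝ) := by
        rw [sum_add_distrib]
        exact_mod_cast add_le_add (sum_card_fiber_le D g) (sum_card_fiber_le D h)
    _ = _ := by push_cast; ring

/-- The index function of a partition. -/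
lemma exists_index {X : Finset (Finset V)} {Hs : Fin s → Finset (Finset V)}
    (hd : ∀ i j, i ≠ j → Disjoint (Hs i) (Hs j)) (hu : univ.sup Hs = X) :
    ∃ h : Finset V → ℕ, (∀ S ∈ X, h S < s) ∧ ∀ i : Fin s, Hs i = X.filter fun S => h S = i := by
  have h1 : ∀ S ∈ X, ∃ i : Fin s, S ∈ Hs i := fun S hS => by
    rw [← hu, mem_sup] at hS
    obtain ⟨i, -, hi⟩ := hS
    exact ⟨i, hi⟩
  refine ⟨fun S => if hS : S ∈ X then ((h1 S hS).choose : ℕ) else 0, fun S hS => ?_, fun i => ?_⟩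
  · dsimp only
    rw [dif_pos hS]
    exact Fin.is_lt _
  · ext S
    rw [mem_filter]
    constructor
    · intro hS
      have hSX : S ∈ X := hu ▸ mem_sup.2 ⟨i, mem_univ i, hS⟩
      refine ⟨hSX, ?_⟩
      dsimp only
      rw [dif_pos hSX]
      by_contra hne
      exact disjoint_left.1 (hd _ _ fun h => hne (congrArg Fin.val h)) (h1 S hSX).choose_spec hS
    · rintro ⟨hSX, hi⟩
      dsimp only at hi
      rw [dif_pos hSX] at hi
      have h2 := (h1 S hSX).choose_spec
      rwa [Fin.ext hi] at h2

lemma Fam.fIso_of_rel (h : Fam W k q a θ φ δ) {S S' : Finset V} (hS : S ∈ W.powersetCard (k + 1))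
    (hS' : S' ∈ W.powersetCard (k + 1)) (hr : rel φ θ S S') : fIso θ S S' :=
  ⟨h.pIso_of_pIso hS hS' le_rfl hr.1, hr.2⟩

/-- A partition obtained by recolouring within the cells still refines a given family. -/
lemma RegTop.refines {H G : Finset V → ℕ} (hfam : Fam W k q a θ φ δ)
    (h : RegTop W k s θ φ H G ν δ) (hk : 1 ≤ k) (hF : Encodes F W (k + 1) θ) {c : ℕ}
    (hH : (∃ J ∈ F.cross (k + 1), (W.powersetCard (k + 1)).filter (fun S => H S = c) ⊆
        F.cls (k + 1) J) ∨
      ∀ S ∈ (W.powersetCard (k + 1)).filter (fun S => H S = c), S ∉ F.cross (k + 1)) :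
    (∃ J ∈ F.cross (k + 1), (W.powersetCard (k + 1)).filter (fun S => G S = c) ⊆
        F.cls (k + 1) J) ∨
      ∀ S ∈ (W.powersetCard (k + 1)).filter (fun S => G S = c), S ∉ F.cross (k + 1) := by
  have hw : ∀ S ∈ (W.powersetCard (k + 1)).filter (fun S => G S = c),
      S ∈ W.powersetCard (k + 1) ∧
      ∃ S' ∈ (W.powersetCard (k + 1)).filter (fun S => H S = c), fIso θ S S' := by
    intro S hS
    obtain ⟨h1, h2⟩ := mem_filter.1 hS
    obtain ⟨S', h3, h4, h5⟩ := h.wit S h1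
    exact ⟨h1, S', mem_filter.2 ⟨h3, h5.trans h2⟩, hfam.fIso_of_rel h1 h3 h4⟩
  rcases hH with ⟨J, hJ, hsub⟩ | hno
  · refine Or.inl ⟨J, hJ, fun S hS => ?_⟩
    obtain ⟨h1, S', h2, h3⟩ := hw S hS
    have h4 := hsub h2
    rw [hF.cls (k + 1) (by omega) le_rfl J hJ] at h4 ⊢
    obtain ⟨h5, h6⟩ := mem_cls_ofCol.1 h4
    exact mem_cls_ofCol.2 ⟨mem_cross_ofCol.2 ⟨h1, h3.1.symm.cross (mem_cross_ofCol.1 h5).2⟩,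
      (fIso_equivalence θ).trans h3 h6⟩
  · refine Or.inr fun S hS hSF => ?_
    obtain ⟨h1, S', h2, h3⟩ := hw S hS
    refine hno S' h2 ?_
    rw [hF.cross] at hSF ⊢
    exact mem_cross_ofCol.2 ⟨(mem_filter.1 h2).1, h3.1.cross (mem_cross_ofCol.1 hSF).2⟩

lemma RegTop.subset_cross {H G : Finset V → ℕ} (hfam : Fam W k q a θ φ δ)
    (h : RegTop W k s θ φ H G ν δ) (hF : Encodes F W (k + 1) θ) {c : ℕ}
    (hH : (W.powersetCard (k + 1)).filter (fun S => H S = c) ⊆ F.cross (k + 1)) :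
    (W.powersetCard (k + 1)).filter (fun S => G S = c) ⊆ F.cross (k + 1) := by
  intro S hS
  obtain ⟨h1, h2⟩ := mem_filter.1 hS
  obtain ⟨S', h3, h4, h5⟩ := h.wit S h1
  have h6 := hH (mem_filter.2 ⟨h3, h5.trans h2⟩)
  rw [hF.cross] at h6 ⊢
  exact mem_cross_ofCol.2 ⟨h1, (hfam.fIso_of_rel h1 h3 h4).1.symm.cross (mem_cross_ofCol.1 h6).2⟩

end Counting
end HypReg

namespace HypReg
section Final
open Finset
attribute [local instance 10] Classical.propDecidable

lemma GoodTheta.congr {V : Type*} [DecidableEq V] {W : Finset V} {k : ℕ} {q q' : ℕ → ℕ} {μ : ℝ}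
    {θ : Finset V → ℕ} (h : GoodTheta W k q μ θ) (hk : 1 ≤ k)
    (hq : ∀ j, 1 ≤ j → j ≤ k → q' j = q j) : GoodTheta W k q' μ θ := by
  refine ⟨fun S hS h1 h2 => ?_, fun i hi => ?_, fun j h1 h2 ψ hψ b hb => ?_⟩
  · rw [hq _ h1 h2]
    exact h.lt S hS h1 h2
  · rw [hq 1 le_rfl hk] at hi ⊢
    exact h.size i hi
  · rw [hq j (by omega) h2] at hb ⊢
    exact h.unif j h1 h2 ψ hψ b hb

/-- The regularity lemma for colourings, with constants uniform in the initial colouring. -/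
lemma regz_uniform {k : ℕ} (hk : 1 ≤ k) (o s L : ℕ) {ν : ℝ} (hν : 0 < ν) {δ : (ℕ → ℕ) → ℝ}
    (hδ : ∀ a, 0 < δ a) : ∃ (t n₀ : ℕ) (μ : ℝ), 0 < μ ∧
    ∀ (V : Type) [DecidableEq V] (W : Finset V) (b : ℕ → ℕ) (θ ψ : Finset V → ℕ),
      n₀ ≤ W.card → (∀ j, 1 ≤ j → j ≤ k + 1 → 0 < b j ∧ b j ≤ o) → GoodTheta W (k + 1) b μ θ →
      (∀ S ⊆ W, 1 ≤ S.card → S.card ≤ k + 1 → ψ S < s) →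
      ∃ q a φ G, (∀ j, 1 ≤ j → j ≤ k + 1 → q j = b j) ∧ GoodTheta W (k + 1) q (δ a) θ ∧
        Good W k L t q a θ φ ψ ν (δ a) ∧ RegTop W k s θ φ ψ G ν (δ a) := by
  let q : (Fin (k + 2) → Fin (o + 1)) → ℕ → ℕ := fun f j =>
    if h : j < k + 2 then max 1 (f ⟨j, h⟩) else 1
  have hq : ∀ f j, 0 < q f j := by
    intro f j
    simp only [q]
    split_ifs <;> simp
  choose t n₀ μ hμ h using fun f => regz k hk s L (q f) (hq f) ν hν δ hδ
  choose d hd hd' using fun f => exists_pos_le_of_bounded k (t f) hδ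
  obtain ⟨f₀, hf₀⟩ := Finite.exists_min fun f => min (μ f) (d f)
  refine ⟨univ.sup t, univ.sup n₀, min (μ f₀) (d f₀), lt_min (hμ f₀) (hd f₀), ?_⟩
  intro V _ W b θ ψ hn hb hθ hψ
  let f : Fin (k + 2) → Fin (o + 1) := fun j => ⟨min (b j) o, by omega⟩
  have hqb : ∀ j, 1 ≤ j → j ≤ k + 1 → q f j = b j := by
    intro j h1 h2
    have := hb j h1 h2
    simp only [q, f]
    rw [dif_pos (by omega)]
    omega
  have hθ' : GoodTheta W (k + 1) (q f) (min (μ f) (d f)) θ :=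
    (hθ.congr (by omega) hqb).mono le_rfl (hf₀ f)
  obtain ⟨a, φ, G, h1, h2⟩ := h f V W θ ψ ((le_sup (mem_univ f)).trans hn)
    (hθ'.mono le_rfl (min_le_left _ _)) hψ
  refine ⟨q f, a, φ, G, hqb, hθ'.mono le_rfl ((min_le_right _ _).trans
    (hd' f a h1.bdd fun j hj => h1.zero j (Or.inr hj))), ⟨h1.toFam, fun j => ?_, h1.large, h1.appr⟩,
    h2⟩
  exact (h1.bdd j).trans (le_sup (f := t) (mem_univ f))

/-- The precision required of a colouring with `a j ≤ M` colours to define an `ε`-regular family. -/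
noncomputable def precision (k o : ℕ) (ε : (ℕ → ℕ) → ℝ) (a : ℕ → ℕ) : ℝ :=
  ε a ^ 2 * cellDens k (max 1 ((range (k + 1)).sup a)) /
    (2 ^ (k + 1) * (2 * o * (max 1 ((range (k + 1)).sup a) : ℕ)))

lemma precision_pos {k o : ℕ} (ho : 0 < o) {ε : (ℕ → ℕ) → ℝ} {a : ℕ → ℕ} (hε : 0 < ε a) :
    0 < precision k o ε a := by
  have h1 : 0 < max 1 ((range (k + 1)).sup a) := by positivity
  have h2 := cellDens_pos (k := k) h1
  have h3 : (0 : ℝ) < (max 1 ((range (k + 1)).sup a) : ℕ) := by exact_mod_cast h1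
  have h4 : (0 : ℝ) < o := by exact_mod_cast ho
  unfold precision
  positivity

lemma precision_mul_le {k o : ℕ} (ho : 0 < o) {ε : (ℕ → ℕ) → ℝ} {a : ℕ → ℕ} (hε : 0 < ε a)
    {c : ℝ} (hc : c ≤ 2 ^ (k + 1) * (2 * o * (max 1 ((range (k + 1)).sup a) : ℕ))) :
    c * precision k o ε a ≤ ε a ^ 2 * cellDens k (max 1 ((range (k + 1)).sup a)) := by
  have h1 : (0 : ℝ) < (max 1 ((range (k + 1)).sup a) : ℕ) := by
    exact_mod_cast lt_of_lt_of_le zero_lt_one (le_max_left 1 _)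
  have h4 : (0 : ℝ) < o := by exact_mod_cast ho
  refine (mul_le_mul_of_nonneg_right hc (precision_pos ho hε).le).trans_eq ?_
  unfold precision
  field_simp

lemma bigCells_of_fam {V : Type*} [DecidableEq V] {W : Finset V} {k o : ℕ} {q a : ℕ → ℕ}
    {θ φ : Finset V → ℕ} {ε : (ℕ → ℕ) → ℝ} (hk : 1 ≤ k) (ho : 0 < o) (hε : 0 < ε a) (hε1 : ε a ≤ 1)
    (h : Fam W k q a θ φ (precision k o ε a)) (hW : ∀ j, a j ≤ W.card) (hW1 : 1 ≤ W.card) :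
    BigCells W k (max 1 ((range (k + 1)).sup a)) q a θ φ (precision k o ε a) := by
  set M := max 1 ((range (k + 1)).sup a) with hM
  have hM1 : (1 : ℝ) ≤ M := by exact_mod_cast le_max_left 1 _
  have ho1 : (1 : ℝ) ≤ o := by exact_mod_cast ho
  have hD := cellDens_pos (k := k) (M := M) (lt_of_lt_of_le zero_lt_one (le_max_left 1 _))
  have hp := precision_pos (k := k) (a := a) ho hε
  have h2 : (2 : ℝ) ≤ 2 ^ (k + 1) := by
    rw [pow_succ]
    have : (1 : ℝ) ≤ 2 ^ k := one_le_pow₀ (by norm_num)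
    linarith
  have hεD : ε a ^ 2 * cellDens k M ≤ cellDens k M :=
    mul_le_of_le_one_left hD.le (pow_le_one₀ hε.le hε1)
  have hoM : (1 : ℝ) ≤ o * M := one_le_mul_of_one_le_of_one_le ho1 hM1
  refine ⟨h, hk, fun j => ?_, max_le hW1 (Finset.sup_le fun j _ => hW j), hp.le, ?_, ?_⟩
  · rcases Nat.lt_or_ge j (k + 1) with hj | hj
    · exact (le_sup (f := a) (mem_range.2 hj)).trans (le_max_right _ _)
    · rw [h.zero j (Or.inr hj)]
      exact Nat.zero_le _
  · refine (precision_mul_le ho hε (le_mul_of_one_le_right (by positivity) ?_)).trans hεD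
    rw [← hM]
    linarith
  · have h3 : (2 * M : ℝ) * precision k o ε a ≤ cellDens k M := by
      refine (precision_mul_le ho hε ?_).trans hεD
      rw [← hM]
      have : (M : ℝ) ≤ o * M := le_mul_of_one_le_left (by linarith) ho1
      calc (2 * M : ℝ) ≤ 1 * (2 * o * M) := by linarith
        _ ≤ _ := by gcongr; linarith
    have h4 : 0 < precision k o ε a * M := by positivity
    linarith

end Final
end HypReg

namespace HypReg

open Finset

/-- Strengthened partition version of the regular approximation lemma (Lemma 5.1 of the
paper): the output family of partitions refines `Q` and ν-refines the arbitrary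
prescribed family `O`. -/
theorem refined_regular_approximation :
    ∀ k o s : ℕ, 2 ≤ k → 2 ≤ o → ∀ η ν : ℝ, 0 < η → 0 < ν →
    ∀ ε : (ℕ → ℕ) → ℝ, (∀ b : ℕ → ℕ, 0 < ε b ∧ ε b ≤ 1) →
    ∃ (μ : ℝ) (t n₀ : ℕ), 0 < μ ∧
    ∀ (V : Type) [DecidableEq V], ∀ (W : Finset V) (n : ℕ), W.card = n → n₀ ≤ n →
    -- (O2): an o-bounded family of partitions O(k−1, a^O) on W
    ∀ (aO : ℕ → ℕ) (O : PartFam V), O.gnd = W → O.IsFamily k aO →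
      BoundedVec k o aO →
    -- (O3): a (1/a₁^Q, μ, a^Q)-equitable o-bounded family of partitions Q(k, a^Q) on W
    ∀ (aQ : ℕ → ℕ) (Qf : PartFam V), Qf.gnd = W → Qf.IsFamily (k+1) aQ →
      (∀ j, 1 ≤ j → j ≤ k → aQ j ≤ o) →
      Qf.IsEquitableE k aQ (1 / (aQ 1 : ℝ)) μ →
      (∀ K ∈ Qf.cross k,
        RegPairC Qf.gnd (Qf.cross k) (k-1) μ (1 / (aQ k : ℝ))
          (Qf.cls k K) (Qf.polyad (k-1) K)) →
    -- (O4): a partition {H_1, …, H_s} of the k-subsets of W with H^(k) ≺ Q^(k)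
    ∀ Hs : Fin s → Finset (Finset V),
      (∀ i j, i ≠ j → Disjoint (Hs i) (Hs j)) →
      Finset.univ.sup Hs = W.powersetCard k →
      (∀ i, (∃ J ∈ Qf.cross k, Hs i ⊆ Qf.cls k J) ∨ ∀ S ∈ Hs i, S ∉ Qf.cross k) →
    ∃ (aP : ℕ → ℕ) (P : PartFam V) (Gs : Fin s → Finset (Finset V)),
      -- (P1)
      P.gnd = W ∧ P.IsFamily k aP ∧ BoundedVec k t aP ∧
      P.IsEquitableE k aP η (ε aP) ∧
      (∀ j, 1 ≤ j → j ≤ k - 1 → aQ j ∣ aP j) ∧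
      -- (P2)
      (∀ j, 1 ≤ j → j ≤ k - 1 → RefinesAt P Qf j ∧ RefinesApproxAt P O j ν) ∧
      -- (G1)
      (∀ i, P.PerfectlyRegular k (ε aP) (Gs i)) ∧
      -- G is a partition of the k-subsets of W
      (∀ i j, i ≠ j → Disjoint (Gs i) (Gs j)) ∧
      Finset.univ.sup Gs = W.powersetCard k ∧
      -- (G2)
      (∑ i, ((sd (Gs i) (Hs i)).card : ℝ)) ≤ ν * (n.choose k : ℝ) ∧
      -- (G3)
      (∀ i, (∃ J ∈ Qf.cross k, Gs i ⊆ Qf.cls k J) ∨ ∀ S ∈ Gs i, S ∉ Qf.cross k) ∧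
      (∀ i, Hs i ⊆ Qf.cross k → Gs i ⊆ Qf.cross k) := by
  intro k o s hk ho η ν hη hν ε hε
  obtain ⟨k, rfl⟩ : ∃ k', k = k' + 1 := ⟨k - 1, by omega⟩
  have hk1 : 1 ≤ k := by omega
  set κ : ℝ := 1 / (2 ^ (k + 1) * (k + 1).factorial) with hκ
  have hκ0 : 0 < κ := by positivity
  have ho0 : 0 < o := by omega
  obtain ⟨t, n₀, μ, hμ, hreg⟩ := regz_uniform hk1 o (max (o + 1) s)
    (max (max (k + 1) ⌈1 / η⌉₊) (4 * (2 ^ (k + 1) * (k + 1).factorial)))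
    (ν := ν * κ / (2 * (k + 1))) (by positivity) (δ := precision k o ε)
    fun a => precision_pos ho0 (hε a).1
  obtain ⟨n₁, hn₁⟩ := exists_goodTheta (k + 1) o hμ
  refine ⟨μ, t, max (max n₀ n₁) (max t (2 * (k + 1))), hμ, ?_⟩
  rintro V _ W n rfl hn aO O hOW hO hOo aQ Qf hQW hQ hQo hQE hQT Hs hHd hHu hH
  simp only [max_le_iff] at hn
  obtain ⟨⟨hn0, hn1⟩, hnt, hnk⟩ := hn
  obtain ⟨θ, hθE, hθ⟩ := hn₁ V Qf aQ (hQW ▸ hn1) hQ hQo hQE hQT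
  rw [hQW] at hθE hθ
  obtain ⟨idx, hidx, hHidx⟩ := exists_index hHd hHu
  obtain ⟨ψ, hψE, hψk, hψo⟩ := exists_encodes_extend hO hk1 (fun j h1 h2 => hOo j h1 h2) idx
  rw [hOW] at hψE hψk hψo
  have hψ : ∀ S ⊆ W, 1 ≤ S.card → S.card ≤ k + 1 → ψ S < max (o + 1) s := by
    intro S hS h1 h2
    rcases h2.eq_or_lt with h2 | h2
    · have hSX := mem_powersetCard.2 ⟨hS, h2⟩
      rw [hψk S hSX]
      exact (hidx S hSX).trans_le (le_max_right _ _)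
    · exact (hψo S hS h1 (by omega)).trans_le (le_max_left _ _)
  obtain ⟨q, a, φ, G, hq, hθq, hgood, htop⟩ := hreg V W aQ θ ψ hn0
    (fun j h1 h2 => ⟨hQ.pos h1 h2, hQo j h1 h2⟩) hθ hψ
  have hfam := hgood.toFam
  have hHψ : ∀ i : Fin s, Hs i = (W.powersetCard (k + 1)).filter fun S => ψ S = i := by
    intro i
    rw [hHidx i]
    exact filter_congr fun S hS => by rw [hψk S hS]
  have haW : ∀ j, a j ≤ W.card := fun j => (hgood.bdd j).trans hnt
  have hlarge := hgood.large
  simp only [max_le_iff] at hlarge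
  obtain ⟨⟨hka, hηa⟩, hκa⟩ := hlarge
  have hbig := bigCells_of_fam hk1 ho0 (hε a).1 (hε a).2 hfam haW (by omega)
  have hε0 := (hε a).1
  have hM1 : (1 : ℝ) ≤ (max 1 ((range (k + 1)).sup a) : ℕ) := by
    exact_mod_cast le_max_left 1 _
  have h2k : (1 : ℝ) ≤ 2 ^ (k + 1) := one_le_pow₀ (by norm_num)
  have ho1 : (1 : ℝ) ≤ o := by exact_mod_cast ho0
  have hηa' : 1 ≤ η * a 1 := by
    have h1 : 1 / η ≤ a 1 := (Nat.le_ceil _).trans (by exact_mod_cast hηa)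
    rwa [div_le_iff₀' hη] at h1
  have ha1 : 2 / (a 1 : ℝ) ≤ κ / 2 := by
    have h1 : (4 * (2 ^ (k + 1) * (k + 1).factorial) : ℝ) ≤ a 1 := by exact_mod_cast hκa
    calc 2 / (a 1 : ℝ) ≤ 2 / (4 * (2 ^ (k + 1) * (k + 1).factorial)) := by gcongr
      _ = κ / 2 := by rw [hκ]; field_simp; norm_num
  have hbound : ∀ j : ℕ, j ≤ k + 1 →
      κ / 2 * (W.card : ℝ) ^ j ≤ ((ofCol W φ).cross j).card := by
    intro j hj
    have h1 := card_cross_lower (j := j) hfam hk1 (haW 1)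
    have h2 := pow_le_choose_of_le hj hnk
    rw [card_powersetCard] at h1
    have h3 := mul_le_mul_of_nonneg_right ha1 (pow_nonneg (Nat.cast_nonneg W.card) j)
    linarith
  refine ⟨a, ofCol W φ, fun i => (W.powersetCard (k + 1)).filter fun S => G S = i, rfl,
    hbig.isFamily hka, fun j _ _ => hgood.bdd j, hbig.isEquitableE hε0 ?_ hηa',
    fun j h1 h2 => ?_, fun j h1 h2 => ⟨hfam.refinesAt hθE (by omega) h1 h2,
      refinesApproxAt_of_appr hgood.appr hψE le_rfl h1 h2 ?_⟩, fun i => ?_, fun i j hij => ?_, ?_,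
    ?_, fun i => ?_, fun i hi => ?_⟩
  · refine le_of_eq_of_le (one_mul _).symm (precision_mul_le ho0 hε0 ?_)
    refine one_le_mul_of_one_le_of_one_le h2k (one_le_mul_of_one_le_of_one_le ?_ hM1)
    linarith
  · rw [← hq j h1 (by omega)]
    exact hfam.dvd j h1 h2
  · refine le_trans ?_ (mul_le_mul_of_nonneg_left (hbound j (by omega)) hν.le)
    rw [← mul_assoc]
    refine mul_le_mul_of_nonneg_right ?_ (by positivity)
    have h3 : (j : ℝ) ≤ k + 1 := by exact_mod_cast (show j ≤ k + 1 by omega)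
    calc (j : ℝ) * (ν * κ / (2 * (k + 1))) ≤ (k + 1) * (ν * κ / (2 * (k + 1))) := by gcongr
      _ = ν * (κ / 2) := by field_simp
  · refine hbig.perfectlyRegular hε0 (s := max (o + 1) s) (μ := precision k o ε a) ?_
      (by rw [hq (k + 1) (by omega) le_rfl]; exact hQ.pos (by omega) le_rfl) hθq htop
      (i.2.trans_le (le_max_right _ _))
    have h3 : (q (k + 1) : ℝ) ≤ o := by
      rw [hq (k + 1) (by omega) le_rfl]
      exact_mod_cast hQo (k + 1) (by omega) le_rfl
    rw [← two_mul, ← mul_assoc]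
    refine precision_mul_le ho0 hε0 ?_
    calc (q (k + 1) * 2 : ℝ) ≤ 1 * (2 * o * 1) := by linarith
      _ ≤ _ := by gcongr
  · refine disjoint_left.2 fun S h1 h2 => hij (Fin.ext ?_)
    rw [← (mem_filter.1 h1).2, (mem_filter.1 h2).2]
  · refine subset_antisymm (Finset.sup_le fun i _ => filter_subset _ _) fun S hS => ?_
    obtain ⟨S', h1, -, h2⟩ := htop.wit S hS
    have h3 : G S < s := by
      rw [← h2, hψk S' h1]
      exact hidx S' h1
    exact mem_sup.2 ⟨⟨G S, h3⟩, mem_univ _, mem_filter.2 ⟨hS, rfl⟩⟩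
  · simp only [hHψ]
    refine sum_card_sd_le.trans ?_
    have h1 := htop.close
    have h2 := mul_le_mul_of_nonneg_left (pow_le_choose_of_le (le_refl (k + 1)) hnk) hν.le
    have h3 : 2 * (ν * κ / (2 * (k + 1))) ≤ ν * κ := by
      rw [mul_div_assoc', div_le_iff₀ (by positivity)]
      have h4 : 0 < ν * κ := by positivity
      have h5 : (0 : ℝ) ≤ k := Nat.cast_nonneg k
      nlinarith
    have h6 := mul_le_mul_of_nonneg_right h3 (pow_nonneg (Nat.cast_nonneg W.card) (k + 1))
    linarith
  · exact htop.refines hfam hk1 hθE (by simpa only [hHψ i] using hH i)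
  · refine htop.subset_cross hfam hθE ?_
    rw [← hHψ i]
    exact hi

end HypReg
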